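/- Let (𝒫, 𝒩) be a Beurling generalized number system whose integers are θ-well-behaved for some θ ∈ [0,1), and suppose that for every B > 0 there is a constant C_B with |ζ_𝒫((1+θ)/2 + it)| ≤ C_B (1+|t|)^B for all t. Then for every ε > 0, N(ζ_𝒫; α, T) ≪_ε T^{2(1−α)/(1−θ)+ε} uniformly for α ≥ (1+θ)/2 and T ≥ 2, and for every ε > 0 and δ > 0, N(ζ_𝒫; (3+θ)/4 + δ, T) ≪_{ε,δ} T^ε for T ≥ 2. -/

import Mathlib

open Filter Asymptotics

/-- A Beurling generalized number system: a nondecreasing sequence of generalized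
primes `p` with `1 < p 0` tending to infinity, together with the nondecreasing
enumeration `n` (with multiplicity) of all finite products of the generalized primes,
witnessed by the bijection `equiv` from exponent vectors to indices. -/
structure BeurlingSystem where
  p : ℕ → ℝ
  n : ℕ → ℝ
  one_lt_p : 1 < p 0
  mono_p : Monotone p
  tendsto_p : Tendsto p atTop atTop
  mono_n : Monotone n
  equiv : (ℕ →₀ ℕ) ≃ ℕ
  n_eq : ∀ k : ℕ →₀ ℕ, n (equiv k) = ∏ j ∈ k.support, p j ^ k j

/-- The integer counting function `N_𝒫(x)`. -/
noncomputable def BeurlingSystem.Nint (S : BeurlingSystem) (x : ℝ) : ℕ :=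
  {j : ℕ | S.n j ≤ x}.ncard

/-- `Z` is an analytic continuation of the Beurling zeta function of the system `S`
to the half-plane `Re s > θ`, with density `A`: it agrees with the Dirichlet series
on `Re s > 1` and `Z s - A/(s-1)` is analytic on `Re s > θ`. -/
def BeurlingSystem.IsZeta (S : BeurlingSystem) (θ A : ℝ) (Z : ℂ → ℂ) : Prop :=
  (∀ s : ℂ, 1 < s.re → Z s = ∑' j : ℕ, (S.n j : ℂ) ^ (-s)) ∧
    DifferentiableOn ℂ (fun s => Z s - (A : ℂ) / (s - 1)) {s : ℂ | θ < s.re}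

/-- The number of zeros (without multiplicity) of `Z` with `α ≤ Re ρ` and `|Im ρ| ≤ T`. -/
noncomputable def zeroCount (Z : ℂ → ℂ) (α T : ℝ) : ℕ :=
  {ρ : ℂ | Z ρ = 0 ∧ α ≤ ρ.re ∧ |ρ.im| ≤ T}.ncard

namespace BeurlingSystem

variable (S : BeurlingSystem)

lemma one_lt_prime (j : ℕ) : 1 < S.p j := S.one_lt_p.trans_le (S.mono_p (Nat.zero_le j))

lemma prime_pos (j : ℕ) : 0 < S.p j := one_pos.trans (S.one_lt_prime j)

/-- The value of the generalized integer with exponent vector `k`. -/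
noncomputable def val (k : ℕ →₀ ℕ) : ℝ := k.prod fun j e => S.p j ^ e

lemma n_equiv (k : ℕ →₀ ℕ) : S.n (S.equiv k) = S.val k := S.n_eq k

lemma one_le_val (k : ℕ →₀ ℕ) : 1 ≤ S.val k := by
  unfold val Finsupp.prod
  have := Finset.prod_le_prod (s := k.support) (f := fun _ => (1 : ℝ))
    (g := fun j => S.p j ^ k j) (fun _ _ => zero_le_one)
    (fun j _ => one_le_pow₀ (S.one_lt_prime j).le)
  simpa using this

lemma val_pos (k : ℕ →₀ ℕ) : 0 < S.val k := one_pos.trans_le (S.one_le_val k)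

@[simp] lemma val_zero : S.val 0 = 1 := by simp [val]

lemma val_add (k l : ℕ →₀ ℕ) : S.val (k + l) = S.val k * S.val l :=
  Finsupp.prod_add_index' (fun _ => pow_zero _) (fun _ _ _ => pow_add _ _ _)

@[simp] lemma val_single (j e : ℕ) : S.val (Finsupp.single j e) = S.p j ^ e := by
  simp [val]

lemma prime_le_val {k : ℕ →₀ ℕ} {j : ℕ} (hj : k j ≠ 0) : S.p j ≤ S.val k := by
  have h : k = Finsupp.single j 1 + (k - Finsupp.single j 1) := by
    rw [add_tsub_cancel_of_le]
    simpa [Nat.one_le_iff_ne_zero] using hj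
  rw [h, val_add, val_single, pow_one]
  exact le_mul_of_one_le_right (S.prime_pos j).le (S.one_le_val _)

lemma finite_setOf_n_le (x : ℝ) : {j : ℕ | S.n j ≤ x}.Finite := by
  obtain ⟨i, hi⟩ := (S.tendsto_p.eventually_gt_atTop x).exists
  refine (Set.finite_lt_nat (S.equiv (Finsupp.single i 1))).subset fun j hj => ?_
  by_contra h
  have h1 := S.mono_n (not_lt.mp h)
  rw [n_equiv, val_single, pow_one] at h1
  exact absurd (hj.trans_lt hi) (not_lt.mpr h1)

lemma finite_setOf_val_le (x : ℝ) : {k : ℕ →₀ ℕ | S.val k ≤ x}.Finite := by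
  have := (S.finite_setOf_n_le x).preimage (S.equiv.injective.injOn)
  simpa [Set.preimage, n_equiv] using this

/-- The finite set of exponent vectors of the generalized integers up to `x`. -/
noncomputable def upTo (x : ℝ) : Finset (ℕ →₀ ℕ) := (S.finite_setOf_val_le x).toFinset

@[simp] lemma mem_upTo {x : ℝ} {k : ℕ →₀ ℕ} : k ∈ S.upTo x ↔ S.val k ≤ x := by
  simp [upTo]

lemma card_upTo (x : ℝ) : (S.upTo x).card = S.Nint x := by
  rw [Nint, ← Set.ncard_coe_finset]
  refine Set.ncard_congr (fun k _ => S.equiv k) ?_ ?_ ?_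
  · intro k hk
    simpa [n_equiv] using hk
  · intro k l _ _ h
    exact S.equiv.injective h
  · intro j hj
    refine ⟨S.equiv.symm j, ?_, by simp⟩
    simpa [← n_equiv] using hj

lemma upTo_mono {x y : ℝ} (h : x ≤ y) : S.upTo x ⊆ S.upTo y := by
  intro k; simpa using fun hk => le_trans hk h

lemma Nint_mono : Monotone S.Nint := fun x y h => by
  rw [← card_upTo, ← card_upTo]
  exact Finset.card_le_card (S.upTo_mono h)

lemma succ_le_Nint (j : ℕ) : j + 1 ≤ S.Nint (S.n j) := by
  rw [Nint]
  have : Set.ncard {i : ℕ | i ≤ j} = j + 1 := by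
    rw [show {i : ℕ | i ≤ j} = ((Finset.range (j + 1) : Finset ℕ) : Set ℕ) by
      ext; simp, Set.ncard_coe_finset, Finset.card_range]
  rw [← this]
  exact Set.ncard_le_ncard (fun i hi => S.mono_n hi) (S.finite_setOf_n_le _)

/-- A quantitative form of well-behavedness, valid on the whole range `x ≥ 1`. -/
lemma exists_counting_bound {θ A : ℝ} (hθ : 0 ≤ θ)
    (h : (fun x : ℝ => (S.Nint x : ℝ) - A * x) =O[atTop] fun x : ℝ => x ^ θ) :
    ∃ C : ℝ, 0 ≤ C ∧ ∀ x : ℝ, 1 ≤ x → |(S.Nint x : ℝ) - A * x| ≤ C * x ^ θ := by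
  obtain ⟨c, hc0, hc⟩ := h.exists_pos
  obtain ⟨x₀, hx₀⟩ := eventually_atTop.mp hc.bound
  refine ⟨max c (S.Nint x₀ + |A| * |x₀|), le_max_of_le_left hc0.le, fun x hx => ?_⟩
  have hxθ : 1 ≤ x ^ θ := Real.one_le_rpow hx hθ
  rcases le_total x₀ x with h1 | h1
  · have := hx₀ x h1
    rw [Real.norm_eq_abs, Real.norm_eq_abs, abs_of_pos (by positivity : 0 < x ^ θ)] at this
    exact this.trans (by gcongr; exact le_max_left _ _)
  · have h2 : (S.Nint x : ℝ) ≤ S.Nint x₀ := by exact_mod_cast S.Nint_mono h1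
    have h3 : |x| ≤ |x₀| := abs_le_abs_of_nonneg (by linarith) h1
    calc |(S.Nint x : ℝ) - A * x| ≤ |(S.Nint x : ℝ)| + |A * x| := abs_sub _ _
      _ ≤ S.Nint x₀ + |A| * |x₀| := by
        rw [Nat.abs_cast, abs_mul]; gcongr
      _ ≤ max c (S.Nint x₀ + |A| * |x₀|) * 1 := by rw [mul_one]; exact le_max_right _ _
      _ ≤ _ := by gcongr

end BeurlingSystem

/-- The quantitative data extracted from well-behaved integers: the counting function is
`A x + O(x ^ θ)` with an explicit constant. -/
structure BeurlingSystem.Counting (S : BeurlingSystem) (θ A C : ℝ) : Prop where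
  theta_nonneg : 0 ≤ θ
  theta_lt : θ < 1
  density_pos : 0 < A
  const_nonneg : 0 ≤ C
  bound : ∀ x : ℝ, 1 ≤ x → |(S.Nint x : ℝ) - A * x| ≤ C * x ^ θ

namespace BeurlingSystem.Counting

variable {S : BeurlingSystem} {θ A C : ℝ} (h : S.Counting θ A C)
include h

lemma Nint_le {x : ℝ} (hx : 1 ≤ x) : (S.Nint x : ℝ) ≤ (A + C) * x := by
  have h1 := (abs_le.mp (h.bound x hx)).2
  have h2 : x ^ θ ≤ x ^ (1 : ℝ) := Real.rpow_le_rpow_of_exponent_le hx h.theta_lt.le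
  rw [Real.rpow_one] at h2
  nlinarith [h.const_nonneg]

lemma Nint_sub_le {x y : ℝ} (hy : 1 ≤ y) (hyx : y ≤ x) :
    (S.Nint x : ℝ) - S.Nint y ≤ A * (x - y) + 2 * C * x ^ θ := by
  have h1 := (abs_le.mp (h.bound x (hy.trans hyx))).2
  have h2 := (abs_le.mp (h.bound y hy)).1
  have h3 : y ^ θ ≤ x ^ θ := Real.rpow_le_rpow (by linarith) hyx h.theta_nonneg
  nlinarith [h.const_nonneg]

lemma summable_n_rpow {a : ℝ} (ha : 1 < a) : Summable fun j => S.n j ^ (-a) := by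
  have hAC : 0 < A + C := by linarith [h.density_pos, h.const_nonneg]
  have hn : ∀ j, 1 ≤ S.n j := fun j => by
    have := S.one_le_val (S.equiv.symm j)
    rwa [← S.n_equiv, Equiv.apply_symm_apply] at this
  have key : ∀ j : ℕ, S.n j ^ (-a) ≤ (A + C) ^ a * ((j + 1 : ℕ) : ℝ) ^ (-a) := fun j => by
    have h1 : ((j + 1 : ℕ) : ℝ) ≤ (A + C) * S.n j :=
      (Nat.cast_le.mpr (S.succ_le_Nint j)).trans (h.Nint_le (hn j))
    have hnp : 0 < S.n j := one_pos.trans_le (hn j)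
    have hj : (0 : ℝ) < ((j + 1 : ℕ) : ℝ) := by positivity
    have h2 : ((A + C) * S.n j) ^ (-a) ≤ ((j + 1 : ℕ) : ℝ) ^ (-a) :=
      Real.rpow_le_rpow_of_nonpos hj h1 (by linarith)
    rw [Real.mul_rpow hAC.le hnp.le] at h2
    calc S.n j ^ (-a) = (A + C) ^ a * ((A + C) ^ (-a) * S.n j ^ (-a)) := by
          rw [← mul_assoc, ← Real.rpow_add hAC]; simp
      _ ≤ _ := by gcongr
  refine Summable.of_nonneg_of_le (fun j => Real.rpow_nonneg (by linarith [hn j]) _) key ?_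
  refine Summable.mul_left _ ?_
  exact (summable_nat_add_iff (f := fun j : ℕ => (j : ℝ) ^ (-a)) 1).mpr
    (Real.summable_nat_rpow.mpr (by linarith))

lemma summable_val_rpow {a : ℝ} (ha : 1 < a) : Summable fun k => S.val k ^ (-a) := by
  have := (Equiv.summable_iff S.equiv).mpr (h.summable_n_rpow ha)
  simpa [Function.comp_def, S.n_equiv] using this

end BeurlingSystem.Counting

open MeasureTheory in
/-- The Dirichlet series of a Beurling system as a Stieltjes-type integral of `N`. -/
lemma BeurlingSystem.Counting.tsum_n_cpow_eq {S : BeurlingSystem} {θ A C : ℝ}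
    (h : S.Counting θ A C) {s : ℂ} (hs : 1 < s.re) :
    IntegrableOn (fun x : ℝ => (S.Nint x : ℂ) * (x : ℂ) ^ (-s - 1)) (Set.Ioi 1) ∧
    ∑' j : ℕ, (S.n j : ℂ) ^ (-s) =
      s * ∫ x in Set.Ioi (1 : ℝ), (S.Nint x : ℂ) * (x : ℂ) ^ (-s - 1) := by
  have hn : ∀ j, 1 ≤ S.n j := fun j => by
    have := S.one_le_val (S.equiv.symm j)
    rwa [← S.n_equiv, Equiv.apply_symm_apply] at this
  have hs0 : s ≠ 0 := fun h0 => by simp [h0] at hs; linarith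
  have hre : (-s - 1).re < -1 := by simp; linarith
  have hre' : -s.re - 1 < -1 := by linarith
  set μ := volume.restrict (Set.Ioi (1 : ℝ))
  set F : ℕ → ℝ → ℂ := fun j => (Set.Ici (S.n j)).indicator fun x => (x : ℂ) ^ (-s - 1)
  have hinter : ∀ j, (Set.Ioi (1 : ℝ) ∩ Set.Ici (S.n j) : Set ℝ) =ᵐ[volume]
      (Set.Ioi (S.n j) : Set ℝ) := fun j => by
    have h1 : (Set.Ioi (1 : ℝ) ∩ Set.Ici (S.n j) : Set ℝ) =ᵐ[volume]
        (Set.Ioi (1 : ℝ) ∩ Set.Ioi (S.n j) : Set ℝ) :=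
      (Filter.EventuallyEq.refl _ _).inter Ioi_ae_eq_Ici.symm
    rwa [Set.Ioi_inter_Ioi, sup_eq_right.mpr (hn j)] at h1
  have hint : Integrable (fun x : ℝ => (x : ℂ) ^ (-s - 1)) μ :=
    integrableOn_Ioi_cpow_of_lt hre one_pos
  have hF : ∀ j, Integrable (F j) μ := fun j => hint.indicator measurableSet_Ici
  have hFint : ∀ j, ∫ x, F j x ∂μ = (S.n j : ℂ) ^ (-s) / s := fun j => by
    rw [setIntegral_indicator measurableSet_Ici, setIntegral_congr_set (hinter j),
      integral_Ioi_cpow_of_lt hre (one_pos.trans_le (hn j))]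
    simp only [sub_add_cancel]
    rw [neg_div_neg_eq]
  have hFnorm : ∀ j, ∫ x, ‖F j x‖ ∂μ = S.n j ^ (-s.re) / s.re := fun j => by
    have : ∀ x, ‖F j x‖ = (Set.Ici (S.n j)).indicator (fun x : ℝ => x ^ (-s.re - 1)) x := by
      intro x
      simp only [F, Set.indicator]
      split_ifs with hx
      · rw [Complex.norm_cpow_eq_rpow_re_of_pos
          ((one_pos.trans_le (hn j)).trans_le (Set.mem_Ici.mp hx))]
        simp
      · simp
    simp only [this]
    rw [setIntegral_indicator measurableSet_Ici, setIntegral_congr_set (hinter j),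
      integral_Ioi_rpow_of_lt hre' (one_pos.trans_le (hn j))]
    simp only [sub_add_cancel]
    rw [neg_div_neg_eq]
  have htsum : ∀ x, ∑' j, F j x = (S.Nint x : ℂ) * (x : ℂ) ^ (-s - 1) := fun x => by
    rw [tsum_eq_sum (s := (S.finite_setOf_n_le x).toFinset)]
    · rw [Finset.sum_congr rfl (g := fun _ => (x : ℂ) ^ (-s - 1))]
      · rw [Finset.sum_const, nsmul_eq_mul, BeurlingSystem.Nint,
          Set.ncard_eq_toFinset_card _ (S.finite_setOf_n_le x)]
      · intro j hj
        simp only [Set.Finite.mem_toFinset, Set.mem_ofPred_eq] at hj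
        simp [F, hj]
    · intro j hj
      simp only [Set.Finite.mem_toFinset, Set.mem_ofPred_eq] at hj
      simp [F, hj]
  have hsum : Summable fun j => ∫ x, ‖F j x‖ ∂μ := by
    simp only [hFnorm]
    exact (h.summable_n_rpow hs).div_const _
  have key := hasSum_integral_of_summable_integral_norm hF hsum
  simp only [htsum, hFint] at key
  constructor
  · refine Integrable.mono' (g := fun x => (A + C) * x ^ (-s.re)) ?_ ?_ ?_
    · exact (integrableOn_Ioi_rpow_of_lt (by linarith) one_pos).const_mul _
    · refine AEStronglyMeasurable.mul ?_ hint.aestronglyMeasurable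
      have hm : Measurable fun x : ℝ => (S.Nint x : ℝ) :=
        (Nat.mono_cast.comp S.Nint_mono).measurable
      have := Complex.measurable_ofReal.comp hm
      simpa [Function.comp_def] using this.aestronglyMeasurable
    · filter_upwards [ae_restrict_mem measurableSet_Ioi] with x hx
      have hx : 1 < x := hx
      have hx0 : 0 < x := by linarith
      rw [norm_mul, Complex.norm_natCast, Complex.norm_cpow_eq_rpow_re_of_pos hx0]
      calc (S.Nint x : ℝ) * x ^ (-s - 1).re ≤ ((A + C) * x) * x ^ (-s - 1).re := by
            gcongr; exact h.Nint_le hx.le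
        _ = (A + C) * x ^ (-s.re) := by
            rw [mul_assoc]; nth_rewrite 1 [← Real.rpow_one x]
            rw [← Real.rpow_add hx0]; simp
  · have := key.mul_left s
    rw [← this.tsum_eq]
    congr 1; ext j
    field_simp

open MeasureTheory in
/-- Analytic continuation with linear growth in closed half-planes to the right of `θ`. -/
lemma BeurlingSystem.Counting.norm_regular_part_le {S : BeurlingSystem} {θ A C : ℝ}
    (h : S.Counting θ A C) {Z : ℂ → ℂ} (hZ : S.IsZeta θ A Z) {s : ℂ} (hs : θ < s.re) :
    ‖Z s - (A : ℂ) / (s - 1)‖ ≤ A + ‖s‖ * (C / (s.re - θ)) := by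
  set f : ℝ → ℂ := (Set.Ioi (1 : ℝ)).indicator fun x => (((S.Nint x : ℝ) - A * x : ℝ) : ℂ)
    with hf
  have hfloc : LocallyIntegrable f := by
    refine LocallyIntegrable.indicator ?_ measurableSet_Ioi
    have h1 : LocallyIntegrable (fun x : ℝ => (S.Nint x : ℝ)) :=
      (Nat.mono_cast.comp S.Nint_mono).locallyIntegrable
    have h2 : LocallyIntegrable (fun x : ℝ => A * x) :=
      (continuous_const.mul continuous_id).locallyIntegrable
    have h3 := h1.sub h2
    intro x
    obtain ⟨u, hu, hi⟩ := h3 x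
    exact ⟨u, hu, hi.ofReal⟩
  have hf_top : f =O[atTop] fun x : ℝ => x ^ (-(-θ)) := by
    refine IsBigO.of_bound C ?_
    filter_upwards [eventually_gt_atTop (1 : ℝ)] with x hx
    rw [hf, Set.indicator_of_mem (Set.mem_Ioi.mpr hx), Complex.norm_real, neg_neg,
      Real.norm_eq_abs, Real.norm_of_nonneg (by positivity)]
    exact h.bound x hx.le
  have hf_bot : ∀ b : ℝ, f =O[nhdsWithin 0 (Set.Ioi 0)] fun x : ℝ => x ^ (-b) := fun b => by
    refine IsBigO.of_bound 0 ?_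
    filter_upwards [mem_nhdsWithin_of_mem_nhds (Iio_mem_nhds (one_pos : (0 : ℝ) < 1))] with x hx
    have : x ∉ Set.Ioi (1 : ℝ) := by simpa using (le_of_lt hx)
    simp [hf, Set.indicator_of_notMem this]
  set G : ℂ → ℂ := fun s => A + s * mellin f (-s)
  set U : Set ℂ := {s : ℂ | θ < s.re}
  have hU : IsOpen U := isOpen_lt continuous_const Complex.continuous_re
  have hGd : DifferentiableOn ℂ G U := fun z hz => by
    have hz' : θ < z.re := hz
    refine DifferentiableAt.differentiableWithinAt ?_
    have h1 : DifferentiableAt ℂ (mellin f) (-z) :=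
      mellin_differentiableAt_of_isBigO_rpow (hfloc.locallyIntegrableOn _) hf_top
        (by simpa using hz') (hf_bot ((-z).re - 1)) (by linarith)
    exact (differentiableAt_id.mul (h1.comp z differentiableAt_id.neg)).const_add _
  have hmellin : ∀ z : ℂ, mellin f (-z) = ∫ x in Set.Ioi (1 : ℝ),
      (x : ℂ) ^ (-z - 1) * (((S.Nint x : ℝ) - A * x : ℝ) : ℂ) := fun z => by
    rw [mellin, ← integral_indicator measurableSet_Ioi, ← integral_indicator measurableSet_Ioi]
    congr 1; ext x
    by_cases hx : 1 < x
    · have : 0 < x := by linarith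
      simp [Set.indicator, hx, this, hf]
    · simp [Set.indicator, hx, hf]
  have hEq : ∀ z : ℂ, 1 < z.re → Z z - A / (z - 1) = G z := fun z hz => by
    obtain ⟨hi, hz1⟩ := h.tsum_n_cpow_eq hz
    have hz0 : z - 1 ≠ 0 := fun h0 => by
      rw [sub_eq_zero] at h0; simp [h0] at hz
    have hre : (-z).re < -1 := by simpa using hz
    have h1 : mellin f (-z) = (∫ x in Set.Ioi (1 : ℝ), (S.Nint x : ℂ) * (x : ℂ) ^ (-z - 1))
        - A * ∫ x in Set.Ioi (1 : ℝ), (x : ℂ) ^ (-z) := by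
      rw [hmellin, ← integral_const_mul, ← integral_sub hi
        ((integrableOn_Ioi_cpow_of_lt hre one_pos).const_mul _)]
      refine setIntegral_congr_fun measurableSet_Ioi fun x hx => ?_
      have hx0 : (x : ℂ) ≠ 0 := by
        have : (0 : ℝ) < x := one_pos.trans hx
        exact_mod_cast this.ne'
      have : (x : ℂ) ^ (-z) = x * (x : ℂ) ^ (-z - 1) := by
        rw [Complex.cpow_sub _ _ hx0, Complex.cpow_one]; field_simp
      simp only [this]
      push_cast; ring
    rw [integral_Ioi_cpow_of_lt hre one_pos] at h1
    have hz0' : -z + 1 ≠ 0 := fun h0 => hz0 (by linear_combination -h0)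
    simp only [G, h1]
    rw [hZ.1 z hz, hz1]
    simp only [Complex.ofReal_one, Complex.one_cpow]
    field_simp
    ring
  have hEqOn : Set.EqOn (fun s => Z s - (A : ℂ) / (s - 1)) G U := by
    refine (hZ.2.analyticOnNhd hU).eqOn_of_preconnected_of_eventuallyEq
      (hGd.analyticOnNhd hU) (convex_halfSpace_re_gt θ).isPreconnected (z₀ := 2) ?_ ?_
    · change θ < (2 : ℂ).re
      simpa using (by linarith [h.theta_lt] : θ < 2)
    · have : {z : ℂ | 1 < z.re} ∈ nhds (2 : ℂ) :=
        (isOpen_lt continuous_const Complex.continuous_re).mem_nhds (by norm_num)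
      filter_upwards [this] with z hz using hEq z hz
  have h1 : Z s - (A : ℂ) / (s - 1) = G s := hEqOn hs
  rw [h1]
  refine (norm_add_le _ _).trans ?_
  rw [Complex.norm_real, Real.norm_of_nonneg h.density_pos.le, norm_mul]
  gcongr
  rw [hmellin]
  have hre : θ - s.re - 1 < -1 := by linarith
  calc _ ≤ ∫ x in Set.Ioi (1 : ℝ), C * x ^ (θ - s.re - 1) := by
        refine norm_integral_le_of_norm_le
          ((integrableOn_Ioi_rpow_of_lt hre one_pos).const_mul _) ?_
        filter_upwards [ae_restrict_mem measurableSet_Ioi] with x hx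
        have hx : 1 < x := hx
        have hx0 : 0 < x := by linarith
        rw [norm_mul, Complex.norm_cpow_eq_rpow_re_of_pos hx0, Complex.norm_real,
          Real.norm_eq_abs]
        calc x ^ (-s - 1).re * |(S.Nint x : ℝ) - A * x| ≤ x ^ (-s - 1).re * (C * x ^ θ) := by
              gcongr; exact h.bound x hx.le
          _ = C * x ^ (θ - s.re - 1) := by
              rw [mul_left_comm, ← Real.rpow_add hx0]; congr 2; simp; ring
    _ = C / (s.re - θ) := by
        rw [integral_const_mul, integral_Ioi_rpow_of_lt hre one_pos]
        have : s.re - θ ≠ 0 := by linarith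
        have h2 : θ - s.re ≠ 0 := by intro h0; apply this; linarith
        simp only [sub_add_cancel, Real.one_rpow]
        field_simp
        ring

/-- The regular part `Z s - A / (s - 1)` of the zeta function at `s = 1`. -/
noncomputable def zetaRegular (Z : ℂ → ℂ) (A : ℝ) (s : ℂ) : ℂ := Z s - (A : ℂ) / (s - 1)

namespace BeurlingSystem.Counting

variable {S : BeurlingSystem} {θ A C : ℝ} {Z : ℂ → ℂ}

lemma norm_val_cpow (S : BeurlingSystem) (k : ℕ →₀ ℕ) (s : ℂ) :
    ‖(S.val k : ℂ) ^ s‖ = S.val k ^ s.re :=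
  Complex.norm_cpow_eq_rpow_re_of_pos (S.val_pos k) s

lemma val_ne_zero (S : BeurlingSystem) (k : ℕ →₀ ℕ) : (S.val k : ℂ) ≠ 0 :=
  Complex.ofReal_ne_zero.mpr (S.val_pos k).ne'

lemma summable_val_cpow (h : S.Counting θ A C) {s : ℂ} (hs : 1 < s.re) :
    Summable fun k => (S.val k : ℂ) ^ (-s) := by
  refine Summable.of_norm ?_
  simp only [norm_val_cpow, Complex.neg_re]
  exact h.summable_val_rpow hs

lemma hasSum_val_cpow (h : S.Counting θ A C) (hZ : S.IsZeta θ A Z) {s : ℂ} (hs : 1 < s.re) :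
    HasSum (fun k => (S.val k : ℂ) ^ (-s)) (Z s) := by
  rw [hZ.1 s hs, ← S.equiv.tsum_eq]
  simp only [S.n_equiv]
  exact (h.summable_val_cpow hs).hasSum

lemma differentiableAt_zetaRegular (hZ : S.IsZeta θ A Z) {s : ℂ} (hs : θ < s.re) :
    DifferentiableAt ℂ (zetaRegular Z A) s :=
  hZ.2.differentiableAt
    ((isOpen_lt continuous_const Complex.continuous_re).mem_nhds hs)

lemma norm_zetaRegular_le (h : S.Counting θ A C) (hZ : S.IsZeta θ A Z) {s : ℂ} (hs : θ < s.re) :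
    ‖zetaRegular Z A s‖ ≤ A + ‖s‖ * (C / (s.re - θ)) :=
  h.norm_regular_part_le hZ hs

/-- A uniform bound for the regular part to the right of `Re s = 2`. -/
lemma norm_zetaRegular_le_of_two_le (h : S.Counting θ A C) (hZ : S.IsZeta θ A Z) {s : ℂ}
    (hs : 2 ≤ s.re) : ‖zetaRegular Z A s‖ ≤ (∑' k, S.val k ^ (-2 : ℝ)) + A := by
  have h1 : ‖Z s‖ ≤ ∑' k, S.val k ^ (-2 : ℝ) := by
    rw [← (h.hasSum_val_cpow hZ (by linarith : 1 < s.re)).tsum_eq]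
    refine tsum_of_norm_bounded (h.summable_val_rpow one_lt_two).hasSum fun k => ?_
    rw [norm_val_cpow, Complex.neg_re]
    exact Real.rpow_le_rpow_of_exponent_le (S.one_le_val k) (by linarith)
  have h2 : 1 ≤ ‖s - 1‖ := by
    refine le_trans ?_ (Complex.re_le_norm _)
    simp; linarith
  refine (norm_sub_le _ _).trans (add_le_add h1 ?_)
  rw [norm_div, Complex.norm_real, Real.norm_of_nonneg h.density_pos.le]
  exact div_le_self h.density_pos.le h2

/-- The Lindelöf-type bound on the critical line propagates to the closed half-plane on its
right. -/
lemma zetaRegular_lindelof (h : S.Counting θ A C) (hZ : S.IsZeta θ A Z)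
    (hlin : ∀ B > (0:ℝ), ∃ CB : ℝ, ∀ t : ℝ,
      ‖Z ((((1 + θ) / 2 : ℝ) : ℂ) + Complex.I * (t : ℂ))‖ ≤ CB * (1 + |t|) ^ B)
    {B : ℝ} (hB : 0 < B) :
    ∃ K : ℝ, 0 ≤ K ∧ ∀ s : ℂ, (1 + θ) / 2 ≤ s.re → ‖zetaRegular Z A s‖ ≤ K * (1 + |s.im|) ^ B := by
  obtain ⟨CB, hCB⟩ := hlin B hB
  have h0 := h.theta_nonneg
  have h1 := h.theta_lt
  have hA := h.density_pos
  have hC := h.const_nonneg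
  set K₁ : ℝ := |CB| + A / ((1 - θ) / 2)
  set K₂ : ℝ := (∑' k, S.val k ^ (-2 : ℝ)) + A
  have hK₂ : 0 ≤ K₂ := add_nonneg (tsum_nonneg fun k => (Real.rpow_pos_of_pos (S.val_pos k) _).le)
    hA.le
  have hK₁ : 0 ≤ K₁ := by
    have : 0 ≤ A / ((1 - θ) / 2) := div_nonneg hA.le (by linarith)
    positivity
  have hone : ∀ t : ℝ, 1 ≤ (1 + |t|) ^ B := fun t =>
    Real.one_le_rpow (by linarith [abs_nonneg t]) hB.le
  have hleft : ∀ s : ℂ, s.re = (1 + θ) / 2 → ‖zetaRegular Z A s‖ ≤ K₁ * (1 + |s.im|) ^ B := by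
    intro s hs
    have e : s = (((1 + θ) / 2 : ℝ) : ℂ) + Complex.I * (s.im : ℂ) := by
      rw [← hs, mul_comm, Complex.re_add_im]
    have b1 : ‖Z s‖ ≤ |CB| * (1 + |s.im|) ^ B := by
      rw [e]
      refine (hCB s.im).trans ?_
      simp only [Complex.add_im, Complex.ofReal_im, Complex.mul_im, Complex.I_re, Complex.I_im,
        Complex.ofReal_re, zero_mul, one_mul, zero_add]
      gcongr
      exact le_abs_self _
    have b2 : (1 - θ) / 2 ≤ ‖s - 1‖ := by
      refine le_trans ?_ (Complex.abs_re_le_norm _)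
      refine le_trans ?_ (neg_le_abs _)
      simp; linarith
    refine (norm_sub_le _ _).trans ?_
    rw [norm_div, Complex.norm_real, Real.norm_of_nonneg hA.le]
    have b3 : A / ‖s - 1‖ ≤ A / ((1 - θ) / 2) := by
      have : 0 < (1 - θ) / 2 := by linarith
      gcongr
    have b4 : 0 ≤ A / ((1 - θ) / 2) := div_nonneg hA.le (by linarith)
    have b5 := le_mul_of_one_le_right b4 (hone s.im)
    simp only [K₁, add_mul]
    linarith
  have hright : ∀ s : ℂ, 2 ≤ s.re → ‖zetaRegular Z A s‖ ≤ K₂ * (1 + |s.im|) ^ B := fun s hs => by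
    have := h.norm_zetaRegular_le_of_two_le hZ hs
    nlinarith [hone s.im]
  set f : ℂ → ℂ := fun s => zetaRegular Z A s * (s + 1) ^ (((-B : ℝ)) : ℂ)
  have hfn : ∀ s, ‖f s‖ = ‖zetaRegular Z A s‖ * ‖s + 1‖ ^ (-B) := fun s => by
    simp only [f]; rw [norm_mul, Complex.norm_cpow_real]
  have hlow : ∀ s : ℂ, 0 ≤ s.re → 1 + |s.im| ≤ 2 * ‖s + 1‖ := fun s hs => by
    have a1 : 1 ≤ ‖s + 1‖ := le_trans (by simpa using hs) (Complex.re_le_norm _)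
    have a2 : |s.im| ≤ ‖s + 1‖ := by simpa using Complex.abs_im_le_norm (s + 1)
    linarith
  have hup : ∀ s : ℂ, 0 ≤ s.re → s.re ≤ 2 → ‖s + 1‖ ≤ 3 * (1 + |s.im|) := fun s hs hs' => by
    have := Complex.norm_le_abs_re_add_abs_im (s + 1)
    simp only [Complex.add_re, Complex.one_re, Complex.add_im, Complex.one_im, add_zero] at this
    rw [abs_of_nonneg (by linarith : 0 ≤ s.re + 1)] at this
    linarith [abs_nonneg s.im]
  set M : ℝ := max K₁ K₂ * 2 ^ B
  have hedge : ∀ s : ℂ, 0 ≤ s.re → ‖zetaRegular Z A s‖ ≤ max K₁ K₂ * (1 + |s.im|) ^ B →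
      ‖f s‖ ≤ M := fun s hs hb => by
    rw [hfn]
    have p1 : 0 < ‖s + 1‖ := by have := hlow s hs; linarith [abs_nonneg s.im]
    calc _ ≤ (max K₁ K₂ * (2 * ‖s + 1‖) ^ B) * ‖s + 1‖ ^ (-B) := by
          gcongr
          refine hb.trans ?_
          have : 0 ≤ max K₁ K₂ := le_max_of_le_left hK₁
          gcongr
          exact hlow s hs
      _ = M := by
          rw [Real.mul_rpow zero_le_two p1.le, Real.rpow_neg p1.le]
          field_simp
          rfl
  have hfd : ∀ s : ℂ, θ < s.re → DifferentiableAt ℂ f s := fun s hs => by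
    refine (differentiableAt_zetaRegular hZ hs).mul ?_
    refine (differentiableAt_id.add_const 1).cpow_const ?_
    left; simp; linarith
  have hstrip : ∀ s : ℂ, (1 + θ) / 2 ≤ s.re → s.re ≤ 2 → ‖f s‖ ≤ M := by
    intro s hs hs'
    refine PhragmenLindelof.vertical_strip (a := (1 + θ) / 2) (b := 2) (f := f) ?_ ?_ ?_ ?_ hs hs'
    · refine DifferentiableOn.diffContOnCl fun z hz => ?_
      refine (hfd z ?_).differentiableWithinAt
      have : z ∈ Complex.re ⁻¹' Set.Icc ((1 + θ) / 2) 2 :=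
        closure_minimal (Set.preimage_mono Set.Ioo_subset_Icc_self)
          (isClosed_Icc.preimage Complex.continuous_re) hz
      have := this.1
      linarith
    · have hb2 : (0 : ℝ) < 2 - (1 + θ) / 2 := by linarith
      set c : ℝ := Real.pi / (2 - (1 + θ) / 2) / 2 with hc
      have hc0 : 0 < c := by positivity
      refine ⟨c, half_lt_self (by positivity), 1, ?_⟩
      set K : ℝ := C / ((1 - θ) / 2)
      have hK : 0 ≤ K := div_nonneg hC (by linarith)
      refine IsBigO.of_bound (A + 2 * K + K / c) ?_
      refine Filter.mem_inf_of_right ?_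
      intro z hz
      have hz1 : (1 + θ) / 2 < z.re := hz.1
      have hz2 : z.re < 2 := hz.2
      change ‖f z‖ ≤ _ * ‖Real.exp (1 * Real.exp (c * |z.im|))‖
      rw [one_mul, Real.norm_of_nonneg (Real.exp_pos _).le, hfn]
      have a1 : ‖z + 1‖ ^ (-B) ≤ 1 := by
        refine Real.rpow_le_one_of_one_le_of_nonpos ?_ (by linarith)
        refine le_trans ?_ (Complex.re_le_norm _)
        simp; linarith
      have a2 : ‖zetaRegular Z A z‖ ≤ A + (2 + |z.im|) * K := by
        refine (h.norm_zetaRegular_le hZ (by linarith)).trans ?_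
        have := Complex.norm_le_abs_re_add_abs_im z
        rw [abs_of_nonneg (by linarith : 0 ≤ z.re)] at this
        have hKz : C / (z.re - θ) ≤ K := by
          have : 0 < (1 - θ) / 2 := by linarith
          exact div_le_div_of_nonneg_left hC this (by linarith)
        have := mul_le_mul (by linarith : ‖z‖ ≤ 2 + |z.im|) hKz
          (div_nonneg hC (by linarith)) (by positivity)
        linarith
      have a3 : c * |z.im| + 1 ≤ Real.exp (c * |z.im|) := Real.add_one_le_exp _
      have a4 : Real.exp (c * |z.im|) + 1 ≤ Real.exp (Real.exp (c * |z.im|)) :=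
        Real.add_one_le_exp _
      have a5 : 0 ≤ c * |z.im| := by positivity
      calc _ ≤ ‖zetaRegular Z A z‖ * 1 := by gcongr
        _ ≤ A * 1 + 2 * K * 1 + K / c * (c * |z.im|) := by
          rw [mul_one]; refine a2.trans (le_of_eq ?_); field_simp; ring
        _ ≤ A * Real.exp (Real.exp (c * |z.im|)) + 2 * K * Real.exp (Real.exp (c * |z.im|))
            + K / c * Real.exp (Real.exp (c * |z.im|)) := by
          gcongr <;> linarith
        _ = _ := by ring
    · intro z hz
      refine hedge z (by linarith) ((hleft z hz).trans ?_)
      gcongr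
      exact le_max_left _ _
    · intro z hz
      refine hedge z (by linarith) ((hright z hz.ge).trans ?_)
      gcongr
      exact le_max_right _ _
  refine ⟨max (M * 3 ^ B) K₂, le_max_of_le_right hK₂, fun s hs => ?_⟩
  rcases le_total s.re 2 with hs2 | hs2
  · have := hstrip s hs hs2
    rw [hfn] at this
    have p1 : 0 < ‖s + 1‖ := by
      have := hlow s (by linarith); linarith [abs_nonneg s.im]
    rw [Real.rpow_neg p1.le, ← div_eq_mul_inv, div_le_iff₀ (Real.rpow_pos_of_pos p1 _)] at this
    have hM : 0 ≤ M := by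
      have : 0 ≤ max K₁ K₂ := le_max_of_le_left hK₁
      positivity
    calc _ ≤ M * ‖s + 1‖ ^ B := this
      _ ≤ M * (3 * (1 + |s.im|)) ^ B := by
        gcongr; exact hup s (by linarith) hs2
      _ = M * 3 ^ B * (1 + |s.im|) ^ B := by
        rw [Real.mul_rpow (by norm_num : (0 : ℝ) ≤ 3) (by positivity), ← mul_assoc]
      _ ≤ _ := by gcongr; exact le_max_left _ _
  · refine (hright s hs2).trans ?_
    gcongr
    exact le_max_right _ _

end BeurlingSystem.Counting

/-- Jensen's bound for the number of distinct zeros in a disc. -/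
lemma card_zeros_le_of_norm_le {f : ℂ → ℂ} {c : ℂ} {r R M : ℝ} (hr : 0 < r) (hrR : r < R)
    (hM : 1 ≤ M) (hf : AnalyticOnNhd ℂ f (Metric.closedBall c R)) (hc : f c ≠ 0)
    (hb : ∀ z ∈ Metric.sphere c R, ‖f z‖ ≤ M) (F : Finset ℂ)
    (hF : ∀ z ∈ F, f z = 0 ∧ z ∈ Metric.closedBall c r) :
    (F.card : ℝ) ≤ Real.log (M / ‖f c‖) / Real.log (R / r) := by
  have hR : 0 < R := hr.trans hrR
  have key := AnalyticOnNhd.sum_divisor_le (c := c) (r := r) (R := R) (M := M) (f := f)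
    (by rwa [abs_of_pos hr]) (by rwa [abs_of_pos hr, abs_of_pos hR]) hM
    (by rwa [abs_of_pos hR]) hc (by rwa [abs_of_pos hR])
  rw [abs_of_pos hr] at key
  refine le_trans ?_ key
  set D := MeromorphicOn.divisor f (Metric.closedBall c r)
  have hfr : AnalyticOnNhd ℂ f (Metric.closedBall c r) :=
    hf.mono (Metric.closedBall_subset_closedBall hrR.le)
  have hfin : D.support.Finite := D.finiteSupport (isCompact_closedBall c r)
  have hD0 : 0 ≤ D := MeromorphicOn.AnalyticOnNhd.divisor_nonneg hfr
  have hpre : IsPreconnected (Metric.closedBall c r) := (convex_closedBall c r).isPreconnected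
  have hcc : c ∈ Metric.closedBall c r := Metric.mem_closedBall_self hr.le
  have hD1 : ∀ z ∈ F, 1 ≤ D z := fun z hz => by
    obtain ⟨h0, hz⟩ := hF z hz
    have hne : analyticOrderAt f z ≠ ⊤ := by
      refine hfr.analyticOrderAt_ne_top_of_isPreconnected hpre hcc hz ?_
      rw [(hfr c hcc).analyticOrderAt_eq_zero.mpr hc]
      exact ENat.zero_ne_top
    have h1 : analyticOrderAt f z ≠ 0 := fun h => by
      rw [(hfr z hz).analyticOrderAt_eq_zero] at h
      exact h h0
    rw [MeromorphicOn.AnalyticOnNhd.divisor_apply hfr hz]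
    obtain ⟨n, hn⟩ := ENat.ne_top_iff_exists.mp hne
    rw [← hn] at h1 ⊢
    have h2 : 1 ≤ n := Nat.one_le_iff_ne_zero.mpr (by exact_mod_cast h1)
    rw [ENat.map_natCast, WithTop.untop₀_coe]
    exact_mod_cast h2
  rw [finsum_eq_sum_of_support_subset (s := hfin.toFinset ∪ F) _ (by
    intro x hx
    simp only [Finset.coe_union, Set.Finite.coe_toFinset]
    exact Or.inl hx)]
  have h1 : ∑ z ∈ F, (1 : ℤ) ≤ ∑ z ∈ hfin.toFinset ∪ F, D z :=
    (Finset.sum_le_sum hD1).trans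
      (Finset.sum_le_sum_of_subset_of_nonneg Finset.subset_union_right fun z _ _ => hD0 z)
  simp only [Finset.sum_const, nsmul_eq_mul, mul_one] at h1
  exact_mod_cast h1

namespace BeurlingSystem.Counting

variable {S : BeurlingSystem} {θ A C : ℝ} {Z : ℂ → ℂ}

lemma norm_zeta_sub_one_le_half (h : S.Counting θ A C) (hZ : S.IsZeta θ A Z) :
    ∃ κ₀ : ℝ, 2 ≤ κ₀ ∧ ∀ s : ℂ, κ₀ ≤ s.re → ‖Z s - 1‖ ≤ 1 / 2 := by
  set Q : ℝ := ∑' k, S.val k ^ (-2 : ℝ)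
  have hp := S.one_lt_prime 0
  have hlim : Tendsto (fun κ : ℝ => Q * (S.p 0) ^ (-(κ - 2))) atTop (nhds (Q * 0)) := by
    refine Tendsto.const_mul _ ?_
    have : Tendsto (fun x : ℝ => (S.p 0) ^ (-x)) atTop (nhds 0) := by
      refine (tendsto_rpow_atBot_of_base_gt_one _ hp).comp tendsto_neg_atTop_atBot
    exact this.comp (tendsto_atTop_add_const_right _ _ tendsto_id)
  rw [mul_zero] at hlim
  obtain ⟨κ₁, hκ₁⟩ := eventually_atTop.mp (hlim.eventually_le_const (by norm_num : (0 : ℝ) < 1 / 2))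
  refine ⟨max 2 κ₁, le_max_left _ _, fun s hs => ?_⟩
  have hs2 : 2 ≤ s.re := (le_max_left _ _).trans hs
  have hsum := h.hasSum_val_cpow hZ (by linarith : 1 < s.re)
  have h1 : HasSum (fun k => if k = 0 then (0 : ℂ) else (S.val k : ℂ) ^ (-s)) (Z s - 1) := by
    have := hsum.update 0 0
    simp only [S.val_zero, Complex.ofReal_one, Complex.one_cpow] at this
    rw [zero_sub, neg_add_eq_sub] at this
    refine this.congr_fun fun k => ?_
    by_cases hk : k = 0
    · subst hk; simp
    · simp [hk]
  rw [← h1.tsum_eq]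
  refine le_trans ?_ (hκ₁ s.re ((le_max_right _ _).trans hs))
  have h2 := (h.summable_val_rpow one_lt_two).hasSum.mul_right ((S.p 0) ^ (-(s.re - 2)))
  refine tsum_of_norm_bounded h2 fun k => ?_
  by_cases hk : k = 0
  · simp only [hk, if_true, norm_zero]
    have := S.val_pos 0
    have := S.prime_pos 0
    positivity
  · simp only [hk, if_false]
    rw [norm_val_cpow, Complex.neg_re, show -s.re = -2 + -(s.re - 2) by ring,
      Real.rpow_add (S.val_pos k)]
    have h3 : S.p 0 ≤ S.val k := by
      obtain ⟨j, hj⟩ := Finsupp.ne_iff.mp hk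
      exact (S.mono_p (Nat.zero_le j)).trans (S.prime_le_val hj)
    have := S.val_pos k
    gcongr 1
    exact Real.rpow_le_rpow_of_nonpos (S.prime_pos 0) h3 (by linarith)

set_option maxHeartbeats 1000000 in
/-- Zeros of zeta in a window of length two. -/
lemma exists_card_zeros_le_log (h : S.Counting θ A C) (hZ : S.IsZeta θ A Z) :
    ∃ L : ℝ, 0 ≤ L ∧ ∀ (τ : ℝ) (F : Finset ℂ),
      (∀ ρ ∈ F, Z ρ = 0 ∧ ρ ≠ 1 ∧ (1 + θ) / 2 ≤ ρ.re ∧ |ρ.im - τ| ≤ 1) →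
      (F.card : ℝ) ≤ L * Real.log (2 + |τ|) := by
  obtain ⟨κ₀, hκ₀, hκ⟩ := h.norm_zeta_sub_one_le_half hZ
  have h0 := h.theta_nonneg
  have h1 := h.theta_lt
  have hA := h.density_pos
  have hC := h.const_nonneg
  set d : ℝ := (1 - θ) / 8 with hd
  have hd0 : 0 < d := by simp only [hd]; linarith
  have hd1 : d ≤ 1 / 8 := by simp only [hd]; linarith
  set κ : ℝ := κ₀ + 2 + 1 / d with hκdef
  have hdi : 0 < 1 / d := by positivity
  set r : ℝ := κ - (θ + 3 * d) with hr
  set R : ℝ := κ - (θ + 2 * d) with hR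
  have hr0 : 2 + 1 / d < r := by simp only [hr, hκdef]; linarith
  have hrR : r < R := by simp only [hr, hR]; linarith
  set K : ℝ := C / d
  have hK : 0 ≤ K := by positivity
  set H : ℂ → ℂ := fun s => (s - 1) * zetaRegular Z A s + A with hH
  set M₀ : ℝ := (2 * κ + 1) * (A + 2 * κ * K) + A + 1 with hM₀
  have hM₀1 : 1 ≤ M₀ := by
    have : 0 ≤ (2 * κ + 1) * (A + 2 * κ * K) := by positivity
    linarith
  have hlogRr : 0 < Real.log (R / r) := Real.log_pos (by
    rw [one_lt_div (by linarith)]; exact hrR)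
  have hlogM : 0 ≤ Real.log (2 * M₀) := Real.log_nonneg (by linarith)
  have hlog2 : 0 < Real.log 2 := Real.log_pos one_lt_two
  refine ⟨(Real.log (2 * M₀) / Real.log 2 + 2) / Real.log (R / r), by positivity, ?_⟩
  intro τ F hF
  set c : ℂ := κ + τ * Complex.I with hcdef
  have hcre : c.re = κ := by simp [hcdef]
  have hcim : c.im = τ := by simp [hcdef]
  have hHval : ∀ s : ℂ, s ≠ 1 → H s = (s - 1) * Z s := fun s hs => by
    have : s - 1 ≠ 0 := sub_ne_zero.mpr hs
    simp only [hH, zetaRegular]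
    field_simp
    ring
  have hre : ∀ z ∈ Metric.closedBall c R, θ + 2 * d ≤ z.re := fun z hz => by
    rw [Metric.mem_closedBall, dist_eq_norm, ← norm_neg] at hz
    have := (Complex.re_le_norm _).trans hz
    simp only [neg_sub, Complex.sub_re, hcre] at this
    linarith
  have hHan : AnalyticOnNhd ℂ H (Metric.closedBall c R) := by
    have hopen : IsOpen {s : ℂ | θ < s.re} := isOpen_lt continuous_const Complex.continuous_re
    have hdiff : DifferentiableOn ℂ H {s : ℂ | θ < s.re} := fun s hs => by
      refine DifferentiableAt.differentiableWithinAt ?_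
      exact ((differentiableAt_id.sub_const 1).mul (differentiableAt_zetaRegular hZ hs)).add_const _
    refine (hdiff.analyticOnNhd hopen).mono fun z hz => ?_
    have := hre z hz
    change θ < z.re
    linarith
  have hκ2 : 2 ≤ κ := by simp only [hκdef]; linarith
  have hc1 : c ≠ 1 := fun hc => by
    have := congrArg Complex.re hc
    rw [hcre] at this
    simp at this
    linarith
  have hHc : 1 / 2 ≤ ‖H c‖ := by
    rw [hHval c hc1, norm_mul]
    have a1 : 1 ≤ ‖c - 1‖ := by
      refine le_trans ?_ (Complex.re_le_norm _)
      simp [hcre]; linarith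
    have a2 : 1 / 2 ≤ ‖Z c‖ := by
      have b1 := hκ c (by rw [hcre]; simp only [hκdef]; linarith)
      have b2 := norm_sub_norm_le (1 : ℂ) (1 - Z c)
      rw [norm_one, sub_sub_cancel, norm_sub_rev] at b2
      linarith
    nlinarith [norm_nonneg (Z c)]
  have hτ : 1 ≤ 2 + |τ| := by linarith [abs_nonneg τ]
  have hbound : ∀ z ∈ Metric.sphere c R, ‖H z‖ ≤ M₀ * (2 + |τ|) ^ 2 := fun z hz => by
    have hz' := hre z (Metric.sphere_subset_closedBall hz)
    have a1 : ‖z‖ ≤ 2 * κ * (2 + |τ|) := by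
      have b1 : ‖z‖ ≤ ‖c‖ + R := by
        rw [mem_sphere_iff_norm] at hz
        calc ‖z‖ = ‖c + (z - c)‖ := by ring_nf
          _ ≤ _ := (norm_add_le _ _).trans (by rw [hz])
      have b2 : ‖c‖ ≤ κ + |τ| := by
        have := Complex.norm_le_abs_re_add_abs_im c
        rwa [hcre, hcim, abs_of_pos (by linarith : 0 < κ)] at this
      have b3 : R ≤ κ := by simp only [hR]; linarith
      nlinarith [abs_nonneg τ]
    have a2 : ‖zetaRegular Z A z‖ ≤ A + ‖z‖ * K := by
      refine (h.norm_zetaRegular_le hZ (by linarith)).trans ?_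
      have : C / (z.re - θ) ≤ K := div_le_div_of_nonneg_left hC hd0 (by linarith)
      gcongr
    calc ‖H z‖ ≤ (‖z‖ + 1) * (A + ‖z‖ * K) + A := by
          refine (norm_add_le _ _).trans ?_
          rw [norm_mul, Complex.norm_real, Real.norm_of_nonneg hA.le]
          gcongr
          exact (norm_sub_le _ _).trans (by simp)
      _ ≤ (2 * κ * (2 + |τ|) + 1 * (2 + |τ|)) * (A * (2 + |τ|) + 2 * κ * (2 + |τ|) * K)
          + A * (2 + |τ|) ^ 2 := by
          gcongr
          · linarith
          · exact le_mul_of_one_le_right hA.le hτ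
          · exact le_mul_of_one_le_right hA.le (one_le_pow₀ hτ)
      _ ≤ _ := by
          rw [hM₀]
          nlinarith [sq_nonneg (2 + |τ|)]
  have hFin : ∀ z ∈ F, H z = 0 ∧ z ∈ Metric.closedBall c r := fun z hz => by
    obtain ⟨z0, z1, z2, z3⟩ := hF z hz
    refine ⟨by rw [hHval z z1, z0, mul_zero], ?_⟩
    have hzκ : z.re ≤ κ := by
      by_contra! hlt
      have := hκ z (by have : κ₀ ≤ κ := by { simp only [hκdef]; linarith }
                       linarith)
      rw [z0] at this
      norm_num at this
    rw [Metric.mem_closedBall, dist_eq_norm, Complex.norm_def]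
    refine Real.sqrt_le_iff.mpr ⟨by linarith, ?_⟩
    rw [Complex.normSq_apply, Complex.sub_re, Complex.sub_im, hcre, hcim]
    have e1 : 0 ≤ κ - z.re := by linarith
    have e2 : κ - z.re ≤ r - d := by simp only [hr, hd]; linarith
    have e3 : (z.im - τ) * (z.im - τ) ≤ 1 := by
      have := abs_le.mp z3
      nlinarith
    have e4 : 1 ≤ d * r := by
      have := mul_le_mul_of_nonneg_left hr0.le hd0.le
      have : d * (1 / d) = 1 := by field_simp
      nlinarith
    nlinarith
  have key := card_zeros_le_of_norm_le (by linarith : 0 < r) hrR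
    (by nlinarith : (1 : ℝ) ≤ M₀ * (2 + |τ|) ^ 2) hHan
    (fun h0 => by rw [h0, norm_zero] at hHc; linarith) hbound F hFin
  refine key.trans ?_
  rw [div_mul_eq_mul_div]
  gcongr
  have hl2 : Real.log 2 ≤ Real.log (2 + |τ|) :=
    Real.log_le_log two_pos (by linarith [abs_nonneg τ])
  calc Real.log (M₀ * (2 + |τ|) ^ 2 / ‖H c‖) ≤ Real.log ((2 * M₀) * (2 + |τ|) ^ 2) := by
        refine Real.log_le_log (by positivity) ?_
        rw [div_le_iff₀ (by linarith)]
        have : 0 ≤ M₀ * (2 + |τ|) ^ 2 := by positivity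
        nlinarith
    _ = Real.log (2 * M₀) + 2 * Real.log (2 + |τ|) := by
        rw [Real.log_mul (by positivity) (by positivity), Real.log_pow]
        push_cast; ring
    _ = Real.log (2 * M₀) / Real.log 2 * Real.log 2 + 2 * Real.log (2 + |τ|) := by
        rw [div_mul_cancel₀ _ hlog2.ne']
    _ ≤ Real.log (2 * M₀) / Real.log 2 * Real.log (2 + |τ|) + 2 * Real.log (2 + |τ|) := by
        gcongr
    _ = _ := by ring

end BeurlingSystem.Counting

lemma zeroCount_le_of_forall_finset {Z : ℂ → ℂ} {α T B : ℝ}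
    (h : ∀ F : Finset ℂ, (∀ ρ ∈ F, Z ρ = 0 ∧ ρ ≠ 1 ∧ α ≤ ρ.re ∧ |ρ.im| ≤ T) → (F.card : ℝ) ≤ B) :
    (zeroCount Z α T : ℝ) ≤ B + 1 := by
  rw [zeroCount]
  set s : Set ℂ := {ρ : ℂ | Z ρ = 0 ∧ α ≤ ρ.re ∧ |ρ.im| ≤ T}
  have hB : 0 ≤ B := by simpa using h ∅ (by simp)
  by_cases hs : s.Finite
  · have h1 := h (hs.toFinset.erase 1) fun ρ hρ => by
      rw [Finset.mem_erase, Set.Finite.mem_toFinset] at hρ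
      exact ⟨hρ.2.1, hρ.1, hρ.2.2⟩
    have h2 := Finset.pred_card_le_card_erase (s := hs.toFinset) (a := 1)
    rw [Set.ncard_eq_toFinset_card s hs]
    have h3 : (hs.toFinset.card : ℝ) ≤ (hs.toFinset.erase 1).card + 1 := by
      exact_mod_cast Nat.sub_le_iff_le_add.mp h2
    linarith
  · rw [Set.Infinite.ncard hs]
    push_cast
    linarith

/-- A maximal separated subset. -/
lemma Finset.exists_separated_subset {ι : Type*} [DecidableEq ι] (f : ι → ℝ) {D : ℝ} (hD : 0 < D)
    (F : Finset ι) :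
    ∃ G ⊆ F, (∀ x ∈ G, ∀ y ∈ G, x ≠ y → D ≤ |f x - f y|) ∧ ∀ x ∈ F, ∃ y ∈ G, |f x - f y| ≤ D := by
  induction F using Finset.induction_on with
  | empty => exact ⟨∅, by simp⟩
  | insert a F ha ih =>
    obtain ⟨G, hGF, hsep, hcov⟩ := ih
    by_cases hc : ∃ y ∈ G, |f a - f y| ≤ D
    · refine ⟨G, hGF.trans (Finset.subset_insert _ _), hsep, fun x hx => ?_⟩
      rcases Finset.mem_insert.mp hx with rfl | hx
      · exact hc
      · exact hcov x hx
    · push Not at hc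
      refine ⟨insert a G, Finset.insert_subset_insert _ hGF, ?_, fun x hx => ?_⟩
      · intro x hx y hy hxy
        rcases Finset.mem_insert.mp hx with hxa | hx <;> rcases Finset.mem_insert.mp hy with hya | hy
        · exact absurd (hxa.trans hya.symm) hxy
        · rw [hxa]; exact (hc y hy).le
        · rw [hya, abs_sub_comm]; exact (hc x hx).le
        · exact hsep x hx y hy hxy
      · rcases Finset.mem_insert.mp hx with rfl | hx
        · exact ⟨x, Finset.mem_insert_self _ _, by simpa using hD.le⟩
        · obtain ⟨y, hy, hxy⟩ := hcov x hx
          exact ⟨y, Finset.mem_insert_of_mem hy, hxy⟩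

namespace BeurlingSystem.Counting

variable {S : BeurlingSystem} {θ A C : ℝ} {Z : ℂ → ℂ}

/-- Passing from zeros to zeros with `D`-separated ordinates costs a factor `O(D log (T + D))`. -/
lemma exists_separated_zeros (h : S.Counting θ A C) (hZ : S.IsZeta θ A Z) :
    ∃ L : ℝ, 0 ≤ L ∧ ∀ (T D : ℝ) (F : Finset ℂ), 0 ≤ T → 1 ≤ D →
      (∀ ρ ∈ F, Z ρ = 0 ∧ ρ ≠ 1 ∧ (1 + θ) / 2 ≤ ρ.re ∧ |ρ.im| ≤ T) →
      ∃ G ⊆ F, (∀ x ∈ G, ∀ y ∈ G, x ≠ y → D ≤ |x.im - y.im|) ∧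
        (F.card : ℝ) ≤ G.card * (D * (L * Real.log (4 + T + D))) := by
  classical
  obtain ⟨L, hL, hcount⟩ := h.exists_card_zeros_le_log hZ
  refine ⟨5 * L, by positivity, fun T D F hT hD hF => ?_⟩
  obtain ⟨G, hGF, hsep, hcov⟩ := Finset.exists_separated_subset Complex.im
    (one_pos.trans_le hD) F
  refine ⟨G, hGF, hsep, ?_⟩
  set m : ℕ := ⌈D⌉₊
  have hm : (m : ℝ) ≤ D + 1 := (Nat.ceil_lt_add_one (by linarith)).le
  have hDm : D ≤ m := Nat.le_ceil D
  have hwin : ∀ y ∈ G, ((F.filter fun x => |x.im - y.im| ≤ D).card : ℝ)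
      ≤ D * (5 * L * Real.log (4 + T + D)) := fun y hy => by
    have hcover : (F.filter fun x => |x.im - y.im| ≤ D) ⊆
        (Finset.Icc (-(m : ℤ)) m).biUnion fun j => F.filter fun x => |x.im - (y.im + j)| ≤ 1 := by
      intro x hx
      rw [Finset.mem_filter] at hx
      obtain ⟨hxF, hx⟩ := hx
      rw [Finset.mem_biUnion]
      have h1 := abs_le.mp hx
      refine ⟨⌊x.im - y.im⌋, ?_, ?_⟩
      · rw [Finset.mem_Icc]
        constructor
        · rw [Int.le_floor]
          push_cast; linarith
        · have := (Int.floor_le (x.im - y.im)).trans (h1.2.trans hDm)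
          exact_mod_cast this
      · rw [Finset.mem_filter]
        refine ⟨hxF, ?_⟩
        rw [← sub_sub, abs_of_nonneg (sub_nonneg.mpr (Int.floor_le _))]
        linarith [Int.lt_floor_add_one (x.im - y.im)]
    have hcard := (Finset.card_le_card hcover).trans Finset.card_biUnion_le
    have hyT := (hF y (hGF hy)).2.2.2
    have hlog : 0 ≤ Real.log (4 + T + D) := Real.log_nonneg (by linarith)
    calc ((F.filter fun x => |x.im - y.im| ≤ D).card : ℝ)
        ≤ ∑ j ∈ Finset.Icc (-(m : ℤ)) m, ((F.filter fun x => |x.im - (y.im + j)| ≤ 1).card : ℝ) := by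
          exact_mod_cast hcard
      _ ≤ ∑ j ∈ Finset.Icc (-(m : ℤ)) m, L * Real.log (4 + T + D) := by
          refine Finset.sum_le_sum fun j hj => ?_
          refine (hcount (y.im + j) _ fun ρ hρ => ?_).trans ?_
          · rw [Finset.mem_filter] at hρ
            obtain ⟨a, b, c, -⟩ := hF ρ hρ.1
            exact ⟨a, b, c, hρ.2⟩
          · have hj' : |(j : ℝ)| ≤ m := by
              rw [Finset.mem_Icc] at hj
              rw [abs_le]
              exact ⟨by exact_mod_cast hj.1, by exact_mod_cast hj.2⟩
            have := abs_add_le y.im (j : ℝ)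
            refine mul_le_mul_of_nonneg_left (Real.log_le_log ?_ ?_) hL
            · linarith [abs_nonneg (y.im + j)]
            · linarith
      _ = (2 * m + 1) * (L * Real.log (4 + T + D)) := by
          rw [Finset.sum_const, Int.card_Icc, nsmul_eq_mul]
          congr 1
          have : ((m : ℤ) + 1 - -(m : ℤ)).toNat = 2 * m + 1 := by omega
          rw [this]; push_cast; ring
      _ ≤ (5 * D) * (L * Real.log (4 + T + D)) := by
          gcongr; linarith
      _ = _ := by ring
  have hsub : F ⊆ G.biUnion fun y => F.filter fun x => |x.im - y.im| ≤ D := fun x hx => by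
    obtain ⟨y, hy, hxy⟩ := hcov x hx
    exact Finset.mem_biUnion.mpr ⟨y, hy, Finset.mem_filter.mpr ⟨hx, hxy⟩⟩
  have hcard := (Finset.card_le_card hsub).trans Finset.card_biUnion_le
  calc (F.card : ℝ) ≤ ∑ y ∈ G, ((F.filter fun x => |x.im - y.im| ≤ D).card : ℝ) := by
        exact_mod_cast hcard
    _ ≤ ∑ y ∈ G, D * (5 * L * Real.log (4 + T + D)) := Finset.sum_le_sum hwin
    _ = _ := by rw [Finset.sum_const, nsmul_eq_mul]

end BeurlingSystem.Counting

namespace BeurlingSystem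

variable (S : BeurlingSystem)

/-- Squarefree generalized integers up to `X`. -/
noncomputable def squarefreeUpTo (X : ℝ) : Finset (ℕ →₀ ℕ) :=
  open Classical in (S.upTo X).filter fun d => ∀ j, d j ≤ 1

/-- The partial sum up to `X` of the Dirichlet series of `1 / ζ`. -/
noncomputable def mollifier (X : ℝ) (s : ℂ) : ℂ :=
  ∑ d ∈ S.squarefreeUpTo X, (-1 : ℂ) ^ d.support.card * (S.val d : ℂ) ^ (-s)

/-- The Dirichlet coefficients of `ζ` times the mollifier. -/
noncomputable def mollCoeff (X : ℝ) (k : ℕ →₀ ℕ) : ℝ :=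
  open Classical in
  ∑ d ∈ (S.squarefreeUpTo X).filter fun d => d ≤ k, (-1 : ℝ) ^ d.support.card

variable {S}

lemma mem_squarefreeUpTo {X : ℝ} {d : ℕ →₀ ℕ} :
    d ∈ S.squarefreeUpTo X ↔ S.val d ≤ X ∧ ∀ j, d j ≤ 1 := by
  simp [squarefreeUpTo]

lemma eq_of_support_eq {d e : ℕ →₀ ℕ} (hd : ∀ j, d j ≤ 1) (he : ∀ j, e j ≤ 1)
    (h : d.support = e.support) : d = e := by
  ext j
  have h1 := Finset.ext_iff.mp h j
  simp only [Finsupp.mem_support_iff] at h1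
  have := hd j
  have := he j
  omega

lemma val_le_of_le {d k : ℕ →₀ ℕ} (h : d ≤ k) : S.val d ≤ S.val k := by
  rw [← add_tsub_cancel_of_le h, S.val_add]
  exact le_mul_of_one_le_right (S.val_pos d).le (S.one_le_val _)

lemma abs_mollCoeff_le (X : ℝ) (k : ℕ →₀ ℕ) : |S.mollCoeff X k| ≤ 2 ^ k.support.card := by
  classical
  rw [mollCoeff]
  refine (Finset.abs_sum_le_sum_abs _ _).trans ?_
  simp only [abs_pow, abs_neg, abs_one, one_pow, Finset.sum_const, nsmul_eq_mul, mul_one]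
  rw [← Nat.cast_two, ← Nat.cast_pow, Nat.cast_le, ← Finset.card_powerset]
  refine Finset.card_le_card_of_injOn Finsupp.support ?_ ?_
  · intro d hd
    simp only [Finset.coe_filter, Set.mem_ofPred_eq] at hd
    simpa using Finsupp.support_mono hd.2
  · intro d hd e he hde
    simp only [Finset.coe_filter, Set.mem_ofPred_eq, mem_squarefreeUpTo] at hd he
    exact eq_of_support_eq hd.1.2 he.1.2 hde

lemma mollCoeff_eq {X : ℝ} {k : ℕ →₀ ℕ} (hk : S.val k ≤ X) :
    S.mollCoeff X k = if k = 0 then 1 else 0 := by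
  classical
  have h1 : S.mollCoeff X k = ((∑ D ∈ k.support.powerset, (-1 : ℤ) ^ D.card : ℤ) : ℝ) := by
    rw [mollCoeff]
    push_cast
    refine Finset.sum_bij' (fun d _ => d.support) (fun D _ => Finsupp.indicator D fun _ _ => 1)
      ?_ ?_ ?_ ?_ ?_
    · intro d hd
      rw [Finset.mem_filter] at hd
      simpa using Finsupp.support_mono hd.2
    · intro D hD
      rw [Finset.mem_powerset] at hD
      have hle : (Finsupp.indicator D fun _ _ => 1) ≤ k := fun j => by
        rw [Finsupp.indicator_apply]
        split_ifs with hj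
        · exact Nat.one_le_iff_ne_zero.mpr (Finsupp.mem_support_iff.mp (hD hj))
        · exact Nat.zero_le _
      rw [Finset.mem_filter, mem_squarefreeUpTo]
      refine ⟨⟨(val_le_of_le hle).trans hk, fun j => ?_⟩, hle⟩
      rw [Finsupp.indicator_apply]
      split_ifs <;> simp
    · intro d hd
      rw [Finset.mem_filter, mem_squarefreeUpTo] at hd
      ext j
      have := hd.1.2 j
      rw [Finsupp.indicator_apply]
      split_ifs with hj
      · rw [Finsupp.mem_support_iff] at hj
        omega
      · rw [Finsupp.notMem_support_iff] at hj
        exact hj.symm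
    · intro D hD
      ext j
      simp
    · intro d hd
      rfl
  rw [h1, Finset.sum_powerset_neg_one_pow_card]
  simp

lemma exists_abs_mollCoeff_le (S : BeurlingSystem) {ε : ℝ} (hε : 0 < ε) :
    ∃ K : ℝ, 0 < K ∧ ∀ X k, |S.mollCoeff X k| ≤ K * S.val k ^ ε := by
  obtain ⟨j₀, hj₀⟩ := eventually_atTop.mp
    (((tendsto_rpow_atTop hε).comp S.tendsto_p).eventually_ge_atTop 2)
  refine ⟨2 ^ j₀, by positivity, fun X k => (abs_mollCoeff_le X k).trans ?_⟩
  have h1 : S.val k ^ ε = ∏ j ∈ k.support, (S.p j ^ k j) ^ ε := by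
    rw [val, Finsupp.prod, Real.finsetProd_rpow]
    intro j _
    exact pow_nonneg (S.prime_pos j).le _
  have hpj : ∀ j, k j ≠ 0 → S.p j ^ ε ≤ (S.p j ^ k j) ^ ε := fun j hj => by
    have := S.prime_pos j
    have := le_self_pow₀ (S.one_lt_prime j).le hj
    gcongr
  calc (2 : ℝ) ^ k.support.card = ∏ j ∈ k.support, (2 : ℝ) := by simp
    _ ≤ ∏ j ∈ k.support, ((if j ∈ Finset.range j₀ then 2 else 1) * (S.p j ^ k j) ^ ε) := by
        refine Finset.prod_le_prod (fun _ _ => zero_le_two) fun j hj => ?_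
        rw [Finsupp.mem_support_iff] at hj
        split_ifs with hj'
        · have : 1 ≤ (S.p j ^ k j) ^ ε :=
            (Real.one_le_rpow (S.one_lt_prime j).le hε.le).trans (hpj j hj)
          linarith
        · rw [Finset.mem_range, not_lt] at hj'
          rw [one_mul]
          exact (hj₀ j hj').trans (hpj j hj)
    _ ≤ 2 ^ j₀ * S.val k ^ ε := by
        rw [Finset.prod_mul_distrib, ← h1, Finset.prod_ite, Finset.prod_const, Finset.prod_const_one,
          mul_one]
        have : 0 ≤ S.val k ^ ε := Real.rpow_nonneg (S.val_pos k).le _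
        gcongr
        · norm_num
        · refine (Finset.card_le_card (t := Finset.range j₀) fun j hj => ?_).trans_eq (by simp)
          exact (Finset.mem_filter.mp hj).2

lemma differentiable_mollifier (X : ℝ) : Differentiable ℂ (S.mollifier X) := by
  unfold mollifier
  refine Differentiable.fun_sum fun d _ => Differentiable.const_mul ?_ _
  refine differentiable_id.neg.const_cpow (Or.inl (Counting.val_ne_zero S d))

namespace Counting

variable {θ A C : ℝ} {Z : ℂ → ℂ}

lemma norm_mollifier_le (h : S.Counting θ A C) {X : ℝ} (hX : 1 ≤ X) {s : ℂ} (hs : 0 ≤ s.re) :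
    ‖S.mollifier X s‖ ≤ (A + C) * X := by
  rw [mollifier]
  calc _ ≤ ∑ d ∈ S.squarefreeUpTo X, (1 : ℝ) := by
        refine norm_sum_le_of_le _ fun d _ => ?_
        rw [norm_mul, norm_pow, norm_neg, norm_one, one_pow, one_mul, norm_val_cpow, Complex.neg_re]
        exact Real.rpow_le_one_of_one_le_of_nonpos (S.one_le_val d) (by linarith)
    _ ≤ (S.upTo X).card := by
        rw [Finset.sum_const, nsmul_eq_mul, mul_one]
        exact_mod_cast Finset.card_le_card fun d hd => S.mem_upTo.mpr (mem_squarefreeUpTo.mp hd).1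
    _ ≤ _ := by
        rw [S.card_upTo]
        exact h.Nint_le hX

lemma hasSum_mollCoeff (h : S.Counting θ A C) (hZ : S.IsZeta θ A Z) (X : ℝ) {s : ℂ}
    (hs : 1 < s.re) :
    HasSum (fun k => (S.mollCoeff X k : ℂ) * (S.val k : ℂ) ^ (-s)) (Z s * S.mollifier X s) := by
  classical
  have hZs := h.hasSum_val_cpow hZ hs
  have h1 : ∀ d : ℕ →₀ ℕ, HasSum (fun k => if d ≤ k then (S.val k : ℂ) ^ (-s) else 0)
      ((S.val d : ℂ) ^ (-s) * Z s) := fun d => by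
    have hinj : Function.Injective fun m : ℕ →₀ ℕ => d + m := add_right_injective d
    refine (hinj.hasSum_iff ?_).mp ?_
    · intro k hk
      rw [if_neg]
      exact fun hdk => hk ⟨k - d, add_tsub_cancel_of_le hdk⟩
    · refine (hZs.mul_left ((S.val d : ℂ) ^ (-s))).congr_fun fun m => ?_
      rw [Function.comp_apply, if_pos le_self_add, S.val_add, Complex.ofReal_mul,
        Complex.mul_cpow_ofReal_nonneg (S.val_pos d).le (S.val_pos m).le]
  have h2 := hasSum_sum (s := S.squarefreeUpTo X)
    fun d _ => (h1 d).mul_left ((-1 : ℂ) ^ d.support.card)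
  have e : ∑ d ∈ S.squarefreeUpTo X, (-1 : ℂ) ^ d.support.card * ((S.val d : ℂ) ^ (-s) * Z s)
      = Z s * S.mollifier X s := by
    rw [mollifier, Finset.mul_sum]
    refine Finset.sum_congr rfl fun d _ => by ring
  rw [e] at h2
  refine h2.congr_fun fun k => ?_
  rw [mollCoeff, Finset.sum_filter]
  push_cast
  rw [Finset.sum_mul]
  refine Finset.sum_congr rfl fun d _ => ?_
  split_ifs <;> simp

/-- The zeta function has no zeros in the half-plane of absolute convergence. -/
lemma zeta_ne_zero (h : S.Counting θ A C) (hZ : S.IsZeta θ A Z) {s : ℂ} (hs : 1 < s.re) :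
    Z s ≠ 0 := by
  intro h0
  set ε : ℝ := (s.re - 1) / 4 with hε
  have hε0 : 0 < ε := by simp only [hε]; linarith
  obtain ⟨K, hK, hKb⟩ := S.exists_abs_mollCoeff_le hε0
  set Q : ℝ := ∑' k, S.val k ^ (-(s.re - 2 * ε))
  have hsum : Summable fun k => S.val k ^ (-(s.re - 2 * ε)) :=
    h.summable_val_rpow (by simp only [hε]; linarith)
  have key : ∀ X : ℝ, 1 ≤ X → 1 ≤ K * Q * X ^ (-ε) := fun X hX => by
    have h1 := h.hasSum_mollCoeff hZ X hs
    rw [h0, zero_mul] at h1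
    have h2 := h1.update 0 0
    have e : (S.mollCoeff X 0 : ℂ) * (S.val 0 : ℂ) ^ (-s) = 1 := by
      rw [mollCoeff_eq (by simpa using hX)]; simp
    simp only [e, add_zero, zero_sub] at h2
    have h3 : ‖(-1 : ℂ)‖ ≤ K * Q * X ^ (-ε) := by
      rw [← h2.tsum_eq]
      have h4 := (hsum.hasSum.mul_left K).mul_right (X ^ (-ε))
      refine tsum_of_norm_bounded h4 fun k => ?_
      have hv := S.val_pos k
      have hpos : 0 ≤ K * S.val k ^ (-(s.re - 2 * ε)) * X ^ (-ε) := by positivity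
      by_cases hk : k = 0
      · subst hk
        simpa using hpos
      · rw [Function.update_of_ne hk]
        by_cases hkX : S.val k ≤ X
        · rw [mollCoeff_eq hkX, if_neg hk]
          simpa using hpos
        · push Not at hkX
          rw [norm_mul, Complex.norm_real, norm_val_cpow, Complex.neg_re]
          calc _ ≤ K * S.val k ^ ε * S.val k ^ (-s.re) := by
                gcongr; exact hKb X k
            _ = K * S.val k ^ (-(s.re - 2 * ε)) * S.val k ^ (-ε) := by
                rw [mul_assoc, mul_assoc, ← Real.rpow_add hv, ← Real.rpow_add hv]
                ring_nf
            _ ≤ _ := by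
                gcongr 1
                exact Real.rpow_le_rpow_of_nonpos (by linarith) hkX.le (by linarith)
    simpa using h3
  have hlim : Tendsto (fun X : ℝ => K * Q * X ^ (-ε)) atTop (nhds (K * Q * 0)) :=
    (tendsto_rpow_neg_atTop hε0).const_mul _
  rw [mul_zero] at hlim
  obtain ⟨X, hX1, hX2⟩ := ((eventually_ge_atTop 1).and
    (hlim.eventually_lt_const one_pos)).exists
  linarith [key X hX1]

end Counting

end BeurlingSystem

open MeasureTheory Set in
/-- The Mellin transform of `t ^ (-a)` cut off to `t > 1`. -/
lemma hasMellin_cpow_Ioi (a : ℂ) {s : ℂ} (hs : s.re < a.re) :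
    HasMellin (indicator (Ioi 1) (fun t => (t : ℂ) ^ (-a) : ℝ → ℂ)) s (1 / (a - s)) := by
  have key : ∀ t ∈ Ioi (0 : ℝ), (t : ℂ) ^ (s - 1) • indicator (Ioi 1) (fun t => (t : ℂ) ^ (-a) : ℝ → ℂ) t
      = indicator (Ioi 1) (fun t => (t : ℂ) ^ (s - 1 - a) : ℝ → ℂ) t := by
    intro t ht
    by_cases h1 : t ∈ Ioi (1 : ℝ)
    · rw [indicator_of_mem h1, indicator_of_mem h1, smul_eq_mul,
        ← Complex.cpow_add _ _ (by exact_mod_cast (ne_of_gt ht : t ≠ 0)), sub_eq_add_neg (s - 1) a]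
    · rw [indicator_of_notMem h1, indicator_of_notMem h1, smul_zero]
  have hre : (s - 1 - a).re < -1 := by simp; linarith
  have hsub : Ioi (0 : ℝ) ∩ Ioi 1 = Ioi 1 := by
    rw [Ioi_inter_Ioi]; norm_num
  constructor
  · rw [MellinConvergent, integrableOn_congr_fun key measurableSet_Ioi]
    rw [IntegrableOn, integrable_indicator_iff measurableSet_Ioi, IntegrableOn,
      Measure.restrict_restrict measurableSet_Ioi, inter_comm, hsub]
    exact integrableOn_Ioi_cpow_of_lt hre one_pos
  · rw [mellin, setIntegral_congr_fun measurableSet_Ioi key, setIntegral_indicator measurableSet_Ioi,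
      hsub, integral_Ioi_cpow_of_lt hre one_pos]
    have : a - s ≠ 0 := by
      intro h0
      have := congrArg Complex.re h0
      simp at this; linarith
    have h2 : s - 1 - a + 1 = -(a - s) := by ring
    rw [h2, Complex.ofReal_one, Complex.one_cpow, neg_div_neg_eq]

lemma poisson_nonneg {a : ℝ} (ha : 0 < a) (u : ℝ) : 0 ≤ 2 * a / (a ^ 2 + u ^ 2) := by positivity

open MeasureTheory in
lemma integrable_poisson {a : ℝ} (ha : 0 < a) :
    Integrable fun u : ℝ => 2 * a / (a ^ 2 + u ^ 2) := by
  have h1 := (integrable_inv_one_add_sq.comp_div (ne_of_gt ha)).const_mul (2 / a)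
  refine h1.congr (Eventually.of_forall fun u => ?_)
  simp only
  field_simp

open MeasureTheory Set in
/-- The Fourier transform of the Poisson kernel. -/
lemma integral_cpow_poisson {a x : ℝ} (ha : 0 < a) (hx : 0 < x) :
    ∫ u : ℝ, (x : ℂ) ^ (-((u : ℂ) * Complex.I)) * ((2 * a / (a ^ 2 + u ^ 2) : ℝ) : ℂ) =
      2 * Real.pi * Real.exp (-(a * |Real.log x|)) := by
  set f : ℝ → ℂ := fun t => indicator (Ioc 0 1) (fun t => (t : ℂ) ^ (a : ℂ) : ℝ → ℂ) t +
    indicator (Ioi 1) (fun t => (t : ℂ) ^ (-(a : ℂ)) : ℝ → ℂ) t with hf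
  have hmel : ∀ u : ℝ, HasMellin f ((u : ℂ) * Complex.I) ((2 * a / (a ^ 2 + u ^ 2) : ℝ) : ℂ) := by
    intro u
    have h1 := hasMellin_cpow_Ioc (a : ℂ) (s := (u : ℂ) * Complex.I) (by simpa using ha)
    have h2 := hasMellin_cpow_Ioi (a : ℂ) (s := (u : ℂ) * Complex.I) (by simpa using ha)
    have h3 := hasMellin_add h1.1 h2.1
    refine ⟨h3.1, ?_⟩
    have e1 : mellin f ((u : ℂ) * Complex.I) = _ := h3.2
    rw [e1, h1.2, h2.2]
    have n1 : (u : ℂ) * Complex.I + a ≠ 0 := by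
      intro h0; have := congrArg Complex.re h0; simp at this; linarith
    have n2 : (a : ℂ) - (u : ℂ) * Complex.I ≠ 0 := by
      intro h0; have := congrArg Complex.re h0; simp at this; linarith
    have n3 : ((a : ℂ) ^ 2 + (u : ℂ) ^ 2) ≠ 0 := by
      have : (0:ℝ) < a ^ 2 + u ^ 2 := by positivity
      exact_mod_cast this.ne'
    push_cast
    rw [div_add_div _ _ n1 n2, div_eq_div_iff (mul_ne_zero n1 n2) n3]
    linear_combination (2 * a * (u : ℂ) ^ 2) * Complex.I_sq
  have hfe : ∀ t : ℝ, 0 < t → f t = (Real.exp (-(a * |Real.log t|)) : ℂ) := by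
    intro t ht
    simp only [hf]
    rcases le_or_gt t 1 with h1 | h1
    · rw [indicator_of_mem (show t ∈ Ioc 0 1 from ⟨ht, h1⟩),
        indicator_of_notMem (show t ∉ Ioi 1 from not_lt.mpr h1), add_zero,
        abs_of_nonpos (Real.log_nonpos ht.le h1), ← Complex.ofReal_cpow ht.le,
        Real.rpow_def_of_pos ht]
      congr 2; ring
    · rw [indicator_of_notMem (show t ∉ Ioc 0 1 from fun h => absurd h.2 (not_le.mpr h1)),
        indicator_of_mem (show t ∈ Ioi 1 from h1), zero_add,
        abs_of_nonneg (Real.log_nonneg h1.le), ← Complex.ofReal_neg, ← Complex.ofReal_cpow ht.le,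
        Real.rpow_def_of_pos ht]
      congr 2; ring
  have hinv := mellinInv_mellin_eq 0 f hx (by simpa using (hmel 0).1) (by
      have : (fun u : ℝ => mellin f (((0:ℝ):ℂ) + (u : ℂ) * Complex.I)) =
          fun u : ℝ => ((2 * a / (a ^ 2 + u ^ 2) : ℝ) : ℂ) := by
        funext u
        rw [Complex.ofReal_zero, zero_add, (hmel u).2]
      rw [Complex.VerticalIntegrable, this]
      exact (integrable_poisson ha).ofReal) (by
      have hc : ContinuousAt (fun t : ℝ => (Real.exp (-(a * |Real.log t|)) : ℂ)) x :=
        Complex.continuous_ofReal.continuousAt.comp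
          ((Real.continuousAt_log hx.ne').abs.const_mul a).neg.rexp
      exact hc.congr ((eventually_gt_nhds hx).mono fun t ht => (hfe t ht).symm))
  rw [hfe x hx, mellinInv] at hinv
  have hpi : (2 * (Real.pi : ℂ)) ≠ 0 := by
    have := Real.pi_ne_zero
    exact mul_ne_zero two_ne_zero (by exact_mod_cast this)
  rw [← hinv]
  simp only [Complex.ofReal_zero, zero_add, smul_eq_mul, Complex.real_smul]
  push_cast
  rw [one_div, ← mul_assoc, mul_inv_cancel₀ hpi, one_mul]
  refine integral_congr_ae (Eventually.of_forall fun u => ?_)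
  simp only
  rw [(hmel u).2]
  push_cast
  ring

/-- The Riesz weight `max 0 (1 - 1 / y)`. -/
noncomputable def rieszWeight (y : ℝ) : ℝ := max 0 (1 - y⁻¹)

/-- The Perron kernel `1 / (w (w + 1))`. -/
noncomputable def perronKernel (w : ℂ) : ℂ := 1 / (w * (w + 1))

lemma rieszWeight_nonneg (y : ℝ) : 0 ≤ rieszWeight y := le_max_left _ _

lemma rieszWeight_le_one {y : ℝ} (hy : 0 < y) : rieszWeight y ≤ 1 :=
  max_le zero_le_one (by have := inv_pos.mpr hy; linarith)

lemma rieszWeight_eq_zero {y : ℝ} (hy : 0 < y) (h : y ≤ 1) : rieszWeight y = 0 :=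
  max_eq_left (by have := (one_le_inv₀ hy).mpr h; linarith)

open Complex in
lemma norm_perronKernel_le {c : ℝ} (hc : 0 < c) {w : ℂ} (hw : w.re = c) :
    ‖perronKernel w‖ ≤ (1 + (c ^ 2)⁻¹) * (1 + w.im ^ 2)⁻¹ := by
  have h1 : c ^ 2 + w.im ^ 2 ≤ ‖w‖ ^ 2 := by
    rw [Complex.sq_norm, Complex.normSq_apply, hw]; nlinarith
  have h2 : c ^ 2 + w.im ^ 2 ≤ ‖w + 1‖ ^ 2 := by
    rw [Complex.sq_norm, Complex.normSq_apply]; simp [hw]; nlinarith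
  have hp : 0 < c ^ 2 + w.im ^ 2 := by positivity
  have h3 : c ^ 2 + w.im ^ 2 ≤ ‖w‖ * ‖w + 1‖ := by
    have := mul_le_mul h1 h2 hp.le (by positivity)
    rw [← mul_pow, ← sq] at this
    exact (pow_le_pow_iff_left₀ hp.le (by positivity) two_ne_zero).mp this
  rw [perronKernel, norm_div, norm_one, norm_mul, one_div]
  refine (inv_anti₀ hp h3).trans ?_
  rw [inv_le_iff_one_le_mul₀ hp, ← div_eq_mul_inv, div_mul_eq_mul_div, one_le_div (by positivity)]
  have : (c ^ 2)⁻¹ * c ^ 2 = 1 := inv_mul_cancel₀ (by positivity)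
  have h4 : 0 ≤ (c ^ 2)⁻¹ * w.im ^ 2 := by positivity
  nlinarith [sq_nonneg c]

lemma continuous_perronKernel_line {c : ℝ} (hc : 0 < c) :
    Continuous fun u : ℝ => perronKernel ((c : ℂ) + (u : ℂ) * Complex.I) := by
  unfold perronKernel
  refine continuous_const.div (by fun_prop) fun u => mul_ne_zero ?_ ?_
  · intro h0; have := congrArg Complex.re h0; simp at this; linarith
  · intro h0; have := congrArg Complex.re h0; simp at this; linarith

open MeasureTheory in
lemma integrable_perronKernel_line {c : ℝ} (hc : 0 < c) :
    Integrable fun u : ℝ => perronKernel ((c : ℂ) + (u : ℂ) * Complex.I) := by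
  refine (integrable_inv_one_add_sq.const_mul (1 + (c ^ 2)⁻¹)).mono'
    (continuous_perronKernel_line hc).aestronglyMeasurable (Eventually.of_forall fun u => ?_)
  have := norm_perronKernel_le hc (w := (c : ℂ) + (u : ℂ) * Complex.I) (by simp)
  simpa using this

open MeasureTheory Set in
/-- Perron's formula for the Riesz weight. -/
lemma integral_cpow_perronKernel {c y : ℝ} (hc : 0 < c) (hy : 0 < y) :
    ∫ u : ℝ, (y : ℂ) ^ ((c : ℂ) + (u : ℂ) * Complex.I) *
        perronKernel ((c : ℂ) + (u : ℂ) * Complex.I) =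
      2 * Real.pi * rieszWeight y := by
  set f : ℝ → ℂ := fun t => indicator (Ioc 0 1) (fun t => (t : ℂ) ^ (0 : ℂ) : ℝ → ℂ) t -
    indicator (Ioc 0 1) (fun t => (t : ℂ) ^ (1 : ℂ) : ℝ → ℂ) t with hf
  have hmel : ∀ s : ℂ, 0 < s.re → HasMellin f s (perronKernel s) := by
    intro s hs
    have h1 := hasMellin_cpow_Ioc 0 (s := s) (by simpa using hs)
    have h2 := hasMellin_cpow_Ioc 1 (s := s) (by simp; linarith)
    have h3 := hasMellin_sub h1.1 h2.1
    refine ⟨h3.1, ?_⟩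
    have e1 : mellin f s = _ := h3.2
    rw [e1, h1.2, h2.2, perronKernel]
    have n1 : s ≠ 0 := by
      intro h0; have := congrArg Complex.re h0; simp at this; linarith
    have n2 : s + 1 ≠ 0 := by
      intro h0; have := congrArg Complex.re h0; simp at this; linarith
    simp only [add_zero]
    field_simp
    ring
  have hfe : ∀ t : ℝ, 0 < t → f t = ((max 0 (1 - t) : ℝ) : ℂ) := by
    intro t ht
    simp only [hf]
    rcases le_or_gt t 1 with h1 | h1
    · rw [indicator_of_mem (show t ∈ Ioc 0 1 from ⟨ht, h1⟩),
        indicator_of_mem (show t ∈ Ioc 0 1 from ⟨ht, h1⟩), max_eq_right (by linarith)]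
      simp
    · rw [indicator_of_notMem (show t ∉ Ioc 0 1 from fun h => absurd h.2 (not_le.mpr h1)),
        indicator_of_notMem (show t ∉ Ioc 0 1 from fun h => absurd h.2 (not_le.mpr h1)),
        max_eq_left (by linarith)]
      simp
  have hy' : 0 < y⁻¹ := inv_pos.mpr hy
  have hre : ∀ u : ℝ, ((c : ℂ) + (u : ℂ) * Complex.I).re = c := fun u => by simp
  have hinv := mellinInv_mellin_eq c f hy' (hmel c (by simpa using hc)).1 (by
      have : (fun u : ℝ => mellin f ((c:ℂ) + (u : ℂ) * Complex.I)) =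
          fun u : ℝ => perronKernel ((c : ℂ) + (u : ℂ) * Complex.I) := by
        funext u
        rw [(hmel _ (by rw [hre]; exact hc)).2]
      rw [Complex.VerticalIntegrable, this]
      exact integrable_perronKernel_line hc) (by
      have hc : ContinuousAt (fun t : ℝ => ((max 0 (1 - t) : ℝ) : ℂ)) y⁻¹ := by fun_prop
      exact hc.congr ((eventually_gt_nhds hy').mono fun t ht => (hfe t ht).symm))
  rw [hfe _ hy', mellinInv] at hinv
  have hpi : (2 * (Real.pi : ℂ)) ≠ 0 := by
    have := Real.pi_ne_zero
    exact mul_ne_zero two_ne_zero (by exact_mod_cast this)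
  rw [rieszWeight, ← hinv]
  simp only [smul_eq_mul, Complex.real_smul]
  push_cast
  rw [one_div, ← mul_assoc, mul_inv_cancel₀ hpi, one_mul]
  refine integral_congr_ae (Eventually.of_forall fun u => ?_)
  simp only
  rw [(hmel _ (by rw [hre]; exact hc)).2]
  congr 1
  rw [Complex.inv_cpow _ _ (by rw [Complex.arg_ofReal_of_nonneg hy.le]; exact Real.pi_pos.ne),
    Complex.cpow_neg, inv_inv]

namespace BeurlingSystem.Counting

variable {S : BeurlingSystem} {θ A C : ℝ}

lemma card_filter_le (h : S.Counting θ A C) {a b : ℝ} (hb : 1 ≤ b) (hab : a ≤ b)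
    (J : Finset (ℕ →₀ ℕ)) :
    ((J.filter fun l => a < S.val l ∧ S.val l ≤ b).card : ℝ) ≤
      A * (b - a) + (A + 2 * C) * b ^ θ := by
  classical
  have hA := h.density_pos
  have hC := h.const_nonneg
  have hbθ : 1 ≤ b ^ θ := Real.one_le_rpow hb h.theta_nonneg
  have hsub : (J.filter fun l => a < S.val l ∧ S.val l ≤ b) ⊆ S.upTo b \ S.upTo a := by
    intro l hl
    rw [Finset.mem_filter] at hl
    rw [Finset.mem_sdiff, mem_upTo, mem_upTo]
    exact ⟨hl.2.2, not_le.mpr hl.2.1⟩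
  have h1 : ((J.filter fun l => a < S.val l ∧ S.val l ≤ b).card : ℝ) ≤ S.Nint b - S.Nint a := by
    have h2 := Finset.card_le_card hsub
    rw [Finset.card_sdiff_of_subset (S.upTo_mono hab), card_upTo, card_upTo] at h2
    have h3 : S.Nint a ≤ S.Nint b := S.Nint_mono hab
    rw [← Nat.cast_sub h3]
    exact_mod_cast h2
  refine h1.trans ?_
  rcases le_or_gt 1 a with h2 | h2
  · have := h.Nint_sub_le h2 hab
    nlinarith
  · have h3 := (abs_le.mp (h.bound b hb)).2
    have h4 : (0 : ℝ) ≤ S.Nint a := Nat.cast_nonneg _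
    nlinarith [mul_nonneg hC (zero_le_one.trans hbθ)]

/-- Schur-type row sums of the exponential kernel over the generalized integers. -/
lemma exists_row_sum_le (h : S.Counting θ A C) :
    ∃ K : ℝ, 0 ≤ K ∧ ∀ (T : ℝ) (k : ℕ →₀ ℕ) (J : Finset (ℕ →₀ ℕ)), 2 ≤ T →
      ∑ l ∈ J, Real.exp (-(T * |Real.log (S.val l / S.val k)|)) ≤
        K * (S.val k / T + S.val k ^ θ) := by
  classical
  have hA := h.density_pos
  have hC := h.const_nonneg
  have hsum : Summable fun j : ℕ => ((j : ℝ) + 1) * Real.exp (-(1 / 2) * j) := by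
    have h1 := Real.summable_pow_mul_exp_neg_nat_mul 1 (r := 1 / 2) (by norm_num)
    have h0 := Real.summable_pow_mul_exp_neg_nat_mul 0 (r := 1 / 2) (by norm_num)
    refine (h1.add h0).congr fun j => ?_
    simp only [pow_one, pow_zero]
    ring_nf
  set K0 := ∑' j : ℕ, ((j : ℝ) + 1) * Real.exp (-(1 / 2) * j) with hK0
  have hK0n : 0 ≤ K0 := tsum_nonneg fun j => by positivity
  refine ⟨(2 * A + (A + 2 * C)) * (Real.exp (1 / 2) * K0), by positivity, fun T k J hT => ?_⟩
  have hT0 : 0 < T := by linarith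
  set n := S.val k with hn
  have hn1 : 1 ≤ n := S.one_le_val k
  have hn0 : 0 < n := S.val_pos k
  set g : (ℕ →₀ ℕ) → ℕ := fun l => ⌊T * |Real.log (S.val l / n)|⌋₊ with hg
  have hbase : 0 ≤ n / T + n ^ θ := by positivity
  rw [← Finset.sum_fiberwise_of_maps_to (t := J.image g) (g := g)
    (fun l hl => Finset.mem_image_of_mem g hl)]
  have hfib : ∀ j ∈ J.image g, ∑ l ∈ J with g l = j,
      Real.exp (-(T * |Real.log (S.val l / n)|)) ≤
      ((2 * A + (A + 2 * C)) * (n / T + n ^ θ) * Real.exp (1 / 2)) *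
        (((j : ℝ) + 1) * Real.exp (-(1 / 2) * j)) := by
    intro j _
    set z : ℝ := (j + 1) / T with hz
    have hz0 : 0 < z := by positivity
    have hz2 : z ≤ (j + 1) / 2 := div_le_div_of_nonneg_left (by positivity) two_pos hT
    have hsub : (J.filter fun l => g l = j) ⊆
        J.filter fun l => n * Real.exp (-z) < S.val l ∧ S.val l ≤ n * Real.exp z := by
      intro l hl
      rw [Finset.mem_filter] at hl ⊢
      have hl0 := S.val_pos l
      have h1 : T * |Real.log (S.val l / n)| < j + 1 := by
        rw [← hl.2]; exact Nat.lt_floor_add_one _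
      have h2 : |Real.log (S.val l / n)| < z := by
        rw [hz, lt_div_iff₀ hT0]; linarith
      rw [abs_lt, Real.lt_log_iff_exp_lt (by positivity), Real.log_lt_iff_lt_exp (by positivity),
        lt_div_iff₀ hn0, div_lt_iff₀ hn0] at h2
      exact ⟨hl.1, by linarith [h2.1], by linarith [h2.2]⟩
    have hez : 1 ≤ Real.exp z := Real.one_le_exp hz0.le
    have hcard : ((J.filter fun l => g l = j).card : ℝ) ≤
        (2 * A + (A + 2 * C)) * (n / T + n ^ θ) * ((j + 1) * Real.exp ((j + 1) / 2)) := by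
      have h1 : ((J.filter fun l => g l = j).card : ℝ) ≤ _ :=
        (Nat.cast_le.mpr (Finset.card_le_card hsub)).trans
          (h.card_filter_le (a := n * Real.exp (-z)) (b := n * Real.exp z)
            (by nlinarith) (by gcongr; linarith) J)
      refine h1.trans ?_
      have h2 : n * Real.exp z - n * Real.exp (-z) ≤ 2 * (n / T) * ((j + 1) * Real.exp z) := by
        have h3 : 1 - 2 * z ≤ Real.exp (-(2 * z)) := by
          have := Real.add_one_le_exp (-(2 * z)); linarith
        have h4 : Real.exp (-z) = Real.exp z * Real.exp (-(2 * z)) := by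
          rw [← Real.exp_add]; ring_nf
        have h5 : n / T * (j + 1) = n * z := by rw [hz]; ring
        have h6 : 2 * (n / T) * ((j + 1) * Real.exp z) = 2 * (n * z) * Real.exp z := by
          rw [← h5]; ring
        rw [h6, h4]
        have : 0 ≤ n * Real.exp z := by positivity
        nlinarith
      have h3 : (n * Real.exp z) ^ θ ≤ n ^ θ * ((j + 1) * Real.exp z) := by
        rw [Real.mul_rpow hn0.le (Real.exp_pos _).le]
        refine mul_le_mul_of_nonneg_left ?_ (by positivity)
        calc Real.exp z ^ θ ≤ Real.exp z ^ (1 : ℝ) :=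
              Real.rpow_le_rpow_of_exponent_le hez h.theta_lt.le
          _ = Real.exp z := Real.rpow_one _
          _ ≤ (j + 1) * Real.exp z := le_mul_of_one_le_left (by positivity) (by linarith [(Nat.cast_nonneg j : (0:ℝ) ≤ j)])
      have h4 : (j + 1) * Real.exp z ≤ (j + 1) * Real.exp ((j + 1) / 2) := by
        refine mul_le_mul_of_nonneg_left (Real.exp_le_exp.mpr hz2) (by positivity)
      have h5 : 0 ≤ n / T := by positivity
      have h6 : 0 ≤ n ^ θ := by positivity
      calc A * (n * Real.exp z - n * Real.exp (-z)) + (A + 2 * C) * (n * Real.exp z) ^ θ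
          ≤ A * (2 * (n / T) * ((j + 1) * Real.exp z)) +
            (A + 2 * C) * (n ^ θ * ((j + 1) * Real.exp z)) := by
            refine add_le_add (mul_le_mul_of_nonneg_left h2 hA.le)
              (mul_le_mul_of_nonneg_left h3 (by positivity))
        _ = (2 * A * (n / T) + (A + 2 * C) * n ^ θ) * ((j + 1) * Real.exp z) := by ring
        _ ≤ ((2 * A + (A + 2 * C)) * (n / T + n ^ θ)) * ((j + 1) * Real.exp ((j + 1) / 2)) := by
            refine mul_le_mul ?_ h4 (by positivity) (by positivity)
            nlinarith [mul_nonneg hA.le h6, mul_nonneg hA.le h5, mul_nonneg hC h5]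
    calc ∑ l ∈ J with g l = j, Real.exp (-(T * |Real.log (S.val l / n)|))
        ≤ ∑ l ∈ J with g l = j, Real.exp (-(j : ℝ)) := by
          refine Finset.sum_le_sum fun l hl => ?_
          rw [Finset.mem_filter] at hl
          refine Real.exp_le_exp.mpr (neg_le_neg ?_)
          rw [← hl.2]
          exact Nat.floor_le (by positivity)
      _ = ((J.filter fun l => g l = j).card : ℝ) * Real.exp (-(j : ℝ)) := by
          rw [Finset.sum_const, nsmul_eq_mul]
      _ ≤ (2 * A + (A + 2 * C)) * (n / T + n ^ θ) * ((j + 1) * Real.exp ((j + 1) / 2)) *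
          Real.exp (-(j : ℝ)) := mul_le_mul_of_nonneg_right hcard (Real.exp_pos _).le
      _ = _ := by
          have : Real.exp ((j + 1) / 2) * Real.exp (-(j : ℝ)) =
              Real.exp (1 / 2) * Real.exp (-(1 / 2) * j) := by
            rw [← Real.exp_add, ← Real.exp_add]; ring_nf
          linear_combination ((2 * A + (A + 2 * C)) * (n / T + n ^ θ) * (j + 1)) * this
  refine (Finset.sum_le_sum hfib).trans ?_
  rw [← Finset.mul_sum]
  have := hsum.sum_le_tsum (J.image g) (fun j _ => by positivity)
  calc _ ≤ ((2 * A + (A + 2 * C)) * (n / T + n ^ θ) * Real.exp (1 / 2)) * K0 :=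
        mul_le_mul_of_nonneg_left this (by positivity)
    _ = _ := by ring

end BeurlingSystem.Counting

open MeasureTheory in
/-- Cauchy–Schwarz for a nonnegative weight. -/
lemma sq_norm_integral_mul_le {g : ℝ → ℂ} {P : ℝ → ℝ} {m : ℝ} (hP0 : ∀ u, 0 ≤ P u)
    (hP : Integrable P) (hm : ∫ u, P u = m) (hm0 : 0 < m)
    (hg1 : Integrable fun u => ‖g u‖ * P u) (hg2 : Integrable fun u => ‖g u‖ ^ 2 * P u) :
    ‖∫ u, g u * (P u : ℂ)‖ ^ 2 ≤ m * ∫ u, ‖g u‖ ^ 2 * P u := by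
  set I := ∫ u, ‖g u‖ * P u with hI
  set Q := ∫ u, ‖g u‖ ^ 2 * P u with hQ
  have hI0 : 0 ≤ I := integral_nonneg fun u => mul_nonneg (norm_nonneg _) (hP0 u)
  have h1 : ‖∫ u, g u * (P u : ℂ)‖ ≤ I := by
    refine (norm_integral_le_integral_norm _).trans (le_of_eq ?_)
    refine integral_congr_ae (Eventually.of_forall fun u => ?_)
    simp [abs_of_nonneg (hP0 u)]
  have h2 : 2 * (I / m) * I ≤ (I / m) ^ 2 * m + Q := by
    rw [hI, hQ, ← hm, ← integral_const_mul, ← integral_const_mul, ← integral_add _ hg2]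
    · refine integral_mono (hg1.const_mul _) ((hP.const_mul _).add hg2) fun u => ?_
      simp only
      nlinarith [mul_nonneg (sq_nonneg (((∫ u, ‖g u‖ * P u) / ∫ u, P u) - ‖g u‖)) (hP0 u)]
    · exact hP.const_mul _
  have h3 : I ^ 2 ≤ m * Q := by
    have e1 : 2 * (I / m) * I = 2 * (I ^ 2 / m) := by ring
    have e2 : (I / m) ^ 2 * m = I ^ 2 / m := by field_simp
    rw [e1, e2] at h2
    have h4 : I ^ 2 / m ≤ Q := by linarith
    rwa [div_le_iff₀ hm0, mul_comm] at h4
  exact (pow_le_pow_left₀ (norm_nonneg _) h1 2).trans h3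

lemma summable_inv_one_add_int_sq : Summable fun m : ℤ => (1 + (m : ℝ) ^ 2)⁻¹ := by
  have h1 : Summable fun m : ℤ => 1 / (m : ℝ) ^ 2 := Real.summable_one_div_int_pow.mpr one_lt_two
  refine Summable.of_norm_bounded_eventually h1 ?_
  rw [Filter.eventually_cofinite]
  refine (Set.finite_singleton (0 : ℤ)).subset fun m hm => ?_
  by_contra h0
  apply hm
  have h2 : (0 : ℝ) < (m : ℝ) ^ 2 := by
    have : (m : ℝ) ≠ 0 := by exact_mod_cast h0
    positivity
  rw [Real.norm_of_nonneg (by positivity), one_div]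
  exact inv_anti₀ h2 (by linarith)

/-- Sums of the Cauchy kernel over a `1`-separated set are bounded. -/
lemma exists_sum_inv_one_add_sq_le :
    ∃ K : ℝ, 0 ≤ K ∧ ∀ (I : Finset ℂ) (t : ℂ → ℝ),
      (∀ x ∈ I, ∀ y ∈ I, x ≠ y → 1 ≤ |t x - t y|) → ∀ v : ℝ,
      ∑ r ∈ I, (1 + (v - t r) ^ 2)⁻¹ ≤ K := by
  refine ⟨3 * ∑' m : ℤ, (1 + (m : ℝ) ^ 2)⁻¹, mul_nonneg (by norm_num)
    (tsum_nonneg fun m => by positivity), fun I t hsep v => ?_⟩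
  have hinj : Set.InjOn (fun r => ⌊t r - v⌋) I := by
    intro x hx y hy hxy
    by_contra hne
    have h1 := Int.abs_sub_lt_one_of_floor_eq_floor hxy
    have h2 := hsep x hx y hy hne
    rw [sub_sub_sub_cancel_right] at h1
    linarith
  calc ∑ r ∈ I, (1 + (v - t r) ^ 2)⁻¹
      ≤ ∑ r ∈ I, 3 * (1 + ((⌊t r - v⌋ : ℤ) : ℝ) ^ 2)⁻¹ := by
        refine Finset.sum_le_sum fun r _ => ?_
        have h1 := Int.floor_le (t r - v)
        have h2 := Int.lt_floor_add_one (t r - v)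
        rw [← div_eq_mul_inv, ← one_div, div_le_div_iff₀ (by positivity) (by positivity)]
        set m : ℝ := ((⌊t r - v⌋ : ℤ) : ℝ)
        have h3 : m ^ 2 ≤ 2 * (t r - v) ^ 2 + 2 := by
          nlinarith [sq_nonneg (t r - v + (t r - v - m)), mul_self_nonneg (t r - v - m)]
        nlinarith [sq_nonneg (v - t r)]
    _ = 3 * ∑ m ∈ I.image (fun r => ⌊t r - v⌋), (1 + (m : ℝ) ^ 2)⁻¹ := by
        rw [Finset.sum_image hinj, Finset.mul_sum]
    _ ≤ _ := mul_le_mul_of_nonneg_left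
        (summable_inv_one_add_int_sq.sum_le_tsum _ fun m _ => by positivity) (by norm_num)

lemma exists_sum_inv_one_add_sq_le_mul :
    ∃ K : ℝ, 0 ≤ K ∧ ∀ (T : ℝ) (I : Finset ℂ) (t : ℂ → ℝ), 2 ≤ T → (∀ r ∈ I, |t r| ≤ T) →
      (∀ x ∈ I, ∀ y ∈ I, x ≠ y → 1 ≤ |t x - t y|) → ∀ v : ℝ,
      ∑ r ∈ I, (1 + (v - t r) ^ 2)⁻¹ ≤ K * (T ^ 2 / (T ^ 2 + v ^ 2)) := by
  obtain ⟨K, hK, hsum⟩ := exists_sum_inv_one_add_sq_le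
  refine ⟨7 * K, by positivity, fun T I t hT ht hsep v => ?_⟩
  have hsq : ∀ r ∈ I, t r ^ 2 ≤ T ^ 2 := fun r hr => sq_le_sq.mpr ((ht r hr).trans (le_abs_self T))
  have hT2 : 1 ≤ T ^ 2 := by nlinarith
  have hR : (I.card : ℝ) ≤ K * (2 * T ^ 2) := by
    have h1 : ∑ r ∈ I, (2 * T ^ 2)⁻¹ ≤ ∑ r ∈ I, (1 + (0 - t r) ^ 2)⁻¹ := by
      refine Finset.sum_le_sum fun r hr => inv_anti₀ (by positivity) ?_
      have := hsq r hr
      nlinarith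
    have h2 := h1.trans (hsum I t hsep 0)
    rw [Finset.sum_const, nsmul_eq_mul, ← div_eq_mul_inv, div_le_iff₀ (by positivity)] at h2
    exact h2
  rw [← mul_div_assoc, le_div_iff₀ (by positivity), Finset.sum_mul]
  calc ∑ r ∈ I, (1 + (v - t r) ^ 2)⁻¹ * (T ^ 2 + v ^ 2)
      ≤ ∑ r ∈ I, (3 * T ^ 2 * (1 + (v - t r) ^ 2)⁻¹ + 2) := by
        refine Finset.sum_le_sum fun r hr => ?_
        have h1 : 0 < 1 + (v - t r) ^ 2 := by positivity
        have h2 := hsq r hr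
        rw [inv_mul_eq_div, div_le_iff₀ h1, add_mul, mul_assoc, inv_mul_cancel₀ h1.ne', mul_one]
        nlinarith [sq_nonneg (v - 2 * t r)]
    _ = 3 * T ^ 2 * ∑ r ∈ I, (1 + (v - t r) ^ 2)⁻¹ + I.card * 2 := by
        rw [Finset.sum_add_distrib, ← Finset.mul_sum, Finset.sum_const, nsmul_eq_mul]
    _ ≤ 3 * T ^ 2 * K + K * (2 * T ^ 2) * 2 := by
        gcongr
        exact hsum I t hsep v
    _ = _ := by ring

namespace BeurlingSystem

variable (S : BeurlingSystem)

/-- A generalized Dirichlet polynomial on the imaginary axis. -/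
noncomputable def vertPoly (J : Finset (ℕ →₀ ℕ)) (b : (ℕ →₀ ℕ) → ℂ) (v : ℝ) : ℂ :=
  ∑ k ∈ J, b k * (S.val k : ℂ) ^ (-((v : ℂ) * Complex.I))

lemma continuous_vertPoly (J : Finset (ℕ →₀ ℕ)) (b : (ℕ →₀ ℕ) → ℂ) :
    Continuous (S.vertPoly J b) := by
  unfold vertPoly
  refine continuous_finsetSum _ fun k _ => continuous_const.mul ?_
  refine Continuous.const_cpow (by fun_prop) (Or.inl (Counting.val_ne_zero S k))

lemma norm_vertPoly_le (J : Finset (ℕ →₀ ℕ)) (b : (ℕ →₀ ℕ) → ℂ) (v : ℝ) :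
    ‖S.vertPoly J b v‖ ≤ ∑ k ∈ J, ‖b k‖ := by
  refine (norm_sum_le _ _).trans (Finset.sum_le_sum fun k _ => ?_)
  rw [norm_mul, Counting.norm_val_cpow]
  simp

open MeasureTheory in
lemma integrable_vertPoly_mul {J : Finset (ℕ →₀ ℕ)} {b : (ℕ →₀ ℕ) → ℂ} {P : ℝ → ℝ}
    (hP : Integrable P) (t : ℝ) (m : ℕ) :
    Integrable fun u => ‖S.vertPoly J b (t + u)‖ ^ m * P u := by
  refine hP.bdd_mul (c := (∑ k ∈ J, ‖b k‖) ^ m) ?_ (Eventually.of_forall fun u => ?_)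
  · exact (((S.continuous_vertPoly J b).comp (by fun_prop)).norm.pow m).aestronglyMeasurable
  · rw [norm_pow, norm_norm]
    exact pow_le_pow_left₀ (norm_nonneg _) (S.norm_vertPoly_le J b _) m

open MeasureTheory in
lemma integral_vertPoly_poisson (J : Finset (ℕ →₀ ℕ)) (b : (ℕ →₀ ℕ) → ℂ) {w : ℝ} (hw : 0 < w)
    (t : ℝ) :
    ∫ u : ℝ, S.vertPoly J b (t + u) * ((2 * w / (w ^ 2 + u ^ 2) : ℝ) : ℂ) =
      2 * Real.pi * ∑ k ∈ J, b k * (S.val k : ℂ) ^ (-((w : ℂ) + (t : ℂ) * Complex.I)) := by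
  have hterm : ∀ k u, b k * (S.val k : ℂ) ^ (-(((t + u : ℝ) : ℂ) * Complex.I)) *
      ((2 * w / (w ^ 2 + u ^ 2) : ℝ) : ℂ) = (b k * (S.val k : ℂ) ^ (-((t : ℂ) * Complex.I))) *
      ((S.val k : ℂ) ^ (-((u : ℂ) * Complex.I)) * ((2 * w / (w ^ 2 + u ^ 2) : ℝ) : ℂ)) := by
    intro k u
    have : -(((t + u : ℝ) : ℂ) * Complex.I) =
        -((t : ℂ) * Complex.I) + -((u : ℂ) * Complex.I) := by push_cast; ring
    rw [this, Complex.cpow_add _ _ (Counting.val_ne_zero S k)]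
    ring
  simp only [vertPoly, Finset.sum_mul, hterm]
  rw [integral_finsetSum, Finset.mul_sum]
  · refine Finset.sum_congr rfl fun k _ => ?_
    rw [integral_const_mul, integral_cpow_poisson hw (S.val_pos k),
      abs_of_nonneg (Real.log_nonneg (S.one_le_val k))]
    have h1 : -((w : ℂ) + (t : ℂ) * Complex.I) = -((t : ℂ) * Complex.I) + ((-w : ℝ) : ℂ) := by
      push_cast; ring
    rw [h1, Complex.cpow_add _ _ (Counting.val_ne_zero S k),
      ← Complex.ofReal_cpow (S.val_pos k).le, Real.rpow_def_of_pos (S.val_pos k)]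
    rw [show Real.log (S.val k) * -w = -(w * Real.log (S.val k)) by ring]
    ring
  · intro k _
    refine Integrable.const_mul ?_ _
    refine (integrable_poisson hw).ofReal.bdd_mul (c := 1) ?_ (Eventually.of_forall fun u => ?_)
    · exact (Continuous.const_cpow (by fun_prop)
        (Or.inl (Counting.val_ne_zero S k))).aestronglyMeasurable
    · rw [Counting.norm_val_cpow]; simp

lemma integral_poisson {a : ℝ} (ha : 0 < a) : ∫ u : ℝ, 2 * a / (a ^ 2 + u ^ 2) = 2 * Real.pi := by
  have h1 := integral_cpow_poisson ha one_pos
  simp only [Complex.ofReal_one, Complex.one_cpow, one_mul, Real.log_one, abs_zero, mul_zero,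
    neg_zero, Real.exp_zero, mul_one] at h1
  rw [integral_complex_ofReal] at h1
  exact_mod_cast h1

open MeasureTheory in
lemma sq_norm_dirichletPoly_le (J : Finset (ℕ →₀ ℕ)) (b : (ℕ →₀ ℕ) → ℂ) {η w : ℝ} (hη : 0 < η)
    (hη1 : η ≤ 1) (hw : η ≤ w) (hw3 : w ≤ 3) (t : ℝ) :
    ‖∑ k ∈ J, b k * (S.val k : ℂ) ^ (-((w : ℂ) + (t : ℂ) * Complex.I))‖ ^ 2 ≤
      (η ^ 2)⁻¹ * ∫ v : ℝ, ‖S.vertPoly J b v‖ ^ 2 * (1 + (v - t) ^ 2)⁻¹ := by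
  have hw0 : 0 < w := hη.trans_le hw
  have hpi := Real.pi_gt_three
  have h1 := sq_norm_integral_mul_le (g := fun u => S.vertPoly J b (t + u)) (poisson_nonneg hw0)
    (integrable_poisson hw0) (integral_poisson hw0) (by positivity)
    (by simpa using S.integrable_vertPoly_mul (J := J) (b := b) (integrable_poisson hw0) t 1)
    (S.integrable_vertPoly_mul (J := J) (b := b) (integrable_poisson hw0) t 2)
  rw [S.integral_vertPoly_poisson J b hw0 t] at h1
  set F := ∑ k ∈ J, b k * (S.val k : ℂ) ^ (-((w : ℂ) + (t : ℂ) * Complex.I))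
  have h2 : ∫ u, ‖S.vertPoly J b (t + u)‖ ^ 2 * (2 * w / (w ^ 2 + u ^ 2)) ≤
      (6 * (η ^ 2)⁻¹) * ∫ u, ‖S.vertPoly J b (t + u)‖ ^ 2 * (1 + u ^ 2)⁻¹ := by
    rw [← integral_const_mul]
    refine integral_mono (S.integrable_vertPoly_mul (integrable_poisson hw0) t 2)
      ((S.integrable_vertPoly_mul integrable_inv_one_add_sq t 2).const_mul _) fun u => ?_
    simp only
    have : 2 * w / (w ^ 2 + u ^ 2) ≤ 6 * (η ^ 2)⁻¹ * (1 + u ^ 2)⁻¹ := by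
      rw [mul_assoc, ← mul_inv, ← div_eq_mul_inv]
      have h5 : η ^ 2 ≤ w ^ 2 := pow_le_pow_left₀ hη.le hw 2
      have h6 : η ^ 2 ≤ 1 := pow_le_one₀ hη.le hη1
      exact div_le_div₀ (by norm_num) (by linarith) (by positivity) (by nlinarith [sq_nonneg u])
    calc _ ≤ ‖S.vertPoly J b (t + u)‖ ^ 2 * (6 * (η ^ 2)⁻¹ * (1 + u ^ 2)⁻¹) :=
          mul_le_mul_of_nonneg_left this (by positivity)
      _ = _ := by ring
  have h3 : ∫ u, ‖S.vertPoly J b (t + u)‖ ^ 2 * (1 + u ^ 2)⁻¹ =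
      ∫ v, ‖S.vertPoly J b v‖ ^ 2 * (1 + (v - t) ^ 2)⁻¹ := by
    rw [← integral_add_left_eq_self (fun v => ‖S.vertPoly J b v‖ ^ 2 * (1 + (v - t) ^ 2)⁻¹) t]
    simp
  rw [h3] at h2
  set Q := ∫ v, ‖S.vertPoly J b v‖ ^ 2 * (1 + (v - t) ^ 2)⁻¹
  have hQ : 0 ≤ Q := integral_nonneg fun v => by positivity
  have h4 : ‖(2 * (Real.pi : ℂ)) * F‖ = 2 * Real.pi * ‖F‖ := by
    rw [norm_mul, norm_mul, Complex.norm_real, Real.norm_of_nonneg Real.pi_pos.le]; simp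
  rw [h4] at h1
  have h5 : (2 * Real.pi * ‖F‖) ^ 2 ≤ 2 * Real.pi * (6 * (η ^ 2)⁻¹ * Q) :=
    h1.trans (mul_le_mul_of_nonneg_left h2 (by positivity))
  have h6 : 0 ≤ (η ^ 2)⁻¹ * Q := by positivity
  have h7 : 2 * Real.pi * ‖F‖ ^ 2 ≤ 6 * ((η ^ 2)⁻¹ * Q) := by
    have h8 : 2 * Real.pi * (2 * Real.pi * ‖F‖ ^ 2) ≤ 2 * Real.pi * (6 * ((η ^ 2)⁻¹ * Q)) := by
      linarith [h5]
    exact le_of_mul_le_mul_left h8 (by positivity)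
  nlinarith [sq_nonneg ‖F‖]

open MeasureTheory in
lemma integral_sq_vertPoly_le (J : Finset (ℕ →₀ ℕ)) (b : (ℕ →₀ ℕ) → ℂ) {T : ℝ} (hT : 0 < T) :
    ∫ v : ℝ, ‖S.vertPoly J b v‖ ^ 2 * (T ^ 2 / (T ^ 2 + v ^ 2)) ≤
      Real.pi * T * ∑ k ∈ J, ‖b k‖ ^ 2 *
        ∑ l ∈ J, Real.exp (-(T * |Real.log (S.val l / S.val k)|)) := by
  set m : (ℕ →₀ ℕ) → (ℕ →₀ ℕ) → ℝ := fun k l =>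
    Real.exp (-(T * |Real.log (S.val l / S.val k)|)) with hm
  have hsymm : ∀ k l, m k l = m l k := by
    intro k l
    simp only [hm]
    rw [← inv_div, Real.log_inv, abs_neg]
  have hexp : ∀ v : ℝ, ((‖S.vertPoly J b v‖ ^ 2 * (2 * T / (T ^ 2 + v ^ 2)) : ℝ) : ℂ) =
      ∑ k ∈ J, ∑ l ∈ J, (b k * (starRingEnd ℂ) (b l)) *
        (((S.val k / S.val l : ℝ) : ℂ) ^ (-((v : ℂ) * Complex.I)) *
          ((2 * T / (T ^ 2 + v ^ 2) : ℝ) : ℂ)) := by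
    intro v
    rw [Complex.ofReal_mul, Complex.ofReal_pow, ← Complex.mul_conj', vertPoly, map_sum,
      Finset.sum_mul_sum, Finset.sum_mul]
    refine Finset.sum_congr rfl fun k _ => ?_
    rw [Finset.sum_mul]
    refine Finset.sum_congr rfl fun l _ => ?_
    have h1 : (starRingEnd ℂ) ((S.val l : ℂ) ^ (-((v : ℂ) * Complex.I))) =
        (S.val l : ℂ) ^ ((v : ℂ) * Complex.I) := by
      have h0 := Complex.cpow_conj (S.val l : ℂ) (-((v : ℂ) * Complex.I)) (by
        rw [Complex.arg_ofReal_of_nonneg (S.val_pos l).le]; exact Real.pi_pos.ne)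
      rw [Complex.conj_ofReal] at h0
      rw [← h0]
      simp
    have h2 : ((S.val k / S.val l : ℝ) : ℂ) ^ (-((v : ℂ) * Complex.I)) =
        (S.val k : ℂ) ^ (-((v : ℂ) * Complex.I)) * (S.val l : ℂ) ^ ((v : ℂ) * Complex.I) := by
      rw [div_eq_mul_inv, Complex.ofReal_mul, Complex.mul_cpow_ofReal_nonneg (S.val_pos k).le
        (inv_pos.mpr (S.val_pos l)).le, Complex.ofReal_inv, Complex.inv_cpow _ _ (by
        rw [Complex.arg_ofReal_of_nonneg (S.val_pos l).le]; exact Real.pi_pos.ne),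
        Complex.cpow_neg (S.val l : ℂ), inv_inv]
    rw [map_mul, h1, h2]
    ring
  have hint : ∀ k l, Integrable fun v : ℝ => (b k * (starRingEnd ℂ) (b l)) *
        (((S.val k / S.val l : ℝ) : ℂ) ^ (-((v : ℂ) * Complex.I)) *
          ((2 * T / (T ^ 2 + v ^ 2) : ℝ) : ℂ)) := by
    intro k l
    have hpos : 0 < S.val k / S.val l := div_pos (S.val_pos k) (S.val_pos l)
    refine Integrable.const_mul ?_ _
    refine (integrable_poisson hT).ofReal.bdd_mul (c := 1) ?_ (Eventually.of_forall fun u => ?_)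
    · exact (Continuous.const_cpow (by fun_prop)
        (Or.inl (Complex.ofReal_ne_zero.mpr hpos.ne'))).aestronglyMeasurable
    · rw [Complex.norm_cpow_eq_rpow_re_of_pos hpos]; simp
  have hI : ((∫ v : ℝ, ‖S.vertPoly J b v‖ ^ 2 * (2 * T / (T ^ 2 + v ^ 2)) : ℝ) : ℂ) =
      ∑ k ∈ J, ∑ l ∈ J, (b k * (starRingEnd ℂ) (b l)) * (2 * Real.pi * (m k l : ℂ)) := by
    rw [← integral_complex_ofReal]
    simp_rw [hexp]
    rw [integral_finsetSum _ fun k _ => integrable_finsetSum _ fun l _ => hint k l]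
    refine Finset.sum_congr rfl fun k _ => ?_
    rw [integral_finsetSum _ fun l _ => hint k l]
    refine Finset.sum_congr rfl fun l _ => ?_
    rw [integral_const_mul, integral_cpow_poisson hT (div_pos (S.val_pos k) (S.val_pos l)), hsymm]
  have hI0 : 0 ≤ ∫ v : ℝ, ‖S.vertPoly J b v‖ ^ 2 * (2 * T / (T ^ 2 + v ^ 2)) :=
    integral_nonneg fun v => by positivity
  have hbound : ∫ v : ℝ, ‖S.vertPoly J b v‖ ^ 2 * (2 * T / (T ^ 2 + v ^ 2)) ≤
      2 * Real.pi * ∑ k ∈ J, ‖b k‖ ^ 2 * ∑ l ∈ J, m k l := by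
    have h1 : ∫ v : ℝ, ‖S.vertPoly J b v‖ ^ 2 * (2 * T / (T ^ 2 + v ^ 2)) =
        ‖((∫ v : ℝ, ‖S.vertPoly J b v‖ ^ 2 * (2 * T / (T ^ 2 + v ^ 2)) : ℝ) : ℂ)‖ := by
      rw [Complex.norm_real, Real.norm_of_nonneg hI0]
    rw [h1, hI]
    calc ‖∑ k ∈ J, ∑ l ∈ J, (b k * (starRingEnd ℂ) (b l)) * (2 * Real.pi * (m k l : ℂ))‖
        ≤ ∑ k ∈ J, ∑ l ∈ J, (‖b k‖ ^ 2 + ‖b l‖ ^ 2) * (Real.pi * m k l) := by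
          refine (norm_sum_le _ _).trans (Finset.sum_le_sum fun k _ => ?_)
          refine (norm_sum_le _ _).trans (Finset.sum_le_sum fun l _ => ?_)
          have hmp : 0 ≤ m k l := (Real.exp_pos _).le
          rw [norm_mul, norm_mul, norm_mul, norm_mul, Complex.norm_conj, Complex.norm_real,
            Complex.norm_real, Real.norm_of_nonneg hmp, Real.norm_of_nonneg Real.pi_pos.le,
            Complex.norm_ofNat]
          have := mul_nonneg (sq_nonneg (‖b k‖ - ‖b l‖)) (mul_nonneg Real.pi_pos.le hmp)
          nlinarith
      _ = ∑ k ∈ J, ∑ l ∈ J, ‖b k‖ ^ 2 * (Real.pi * m k l) +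
            ∑ k ∈ J, ∑ l ∈ J, ‖b l‖ ^ 2 * (Real.pi * m k l) := by
          simp_rw [add_mul, Finset.sum_add_distrib]
      _ = ∑ k ∈ J, ∑ l ∈ J, ‖b k‖ ^ 2 * (Real.pi * m k l) +
            ∑ k ∈ J, ∑ l ∈ J, ‖b k‖ ^ 2 * (Real.pi * m k l) := by
          congr 1
          rw [Finset.sum_comm]
          simp_rw [hsymm]
      _ = _ := by
          rw [Finset.mul_sum, ← Finset.sum_add_distrib]
          refine Finset.sum_congr rfl fun k _ => ?_
          rw [Finset.mul_sum, Finset.mul_sum, ← Finset.sum_add_distrib]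
          refine Finset.sum_congr rfl fun l _ => ?_
          ring
  have hconv : ∫ v : ℝ, ‖S.vertPoly J b v‖ ^ 2 * (T ^ 2 / (T ^ 2 + v ^ 2)) =
      T / 2 * ∫ v : ℝ, ‖S.vertPoly J b v‖ ^ 2 * (2 * T / (T ^ 2 + v ^ 2)) := by
    rw [← integral_const_mul]
    refine integral_congr_ae (Eventually.of_forall fun v => ?_)
    simp only
    ring
  rw [hconv]
  calc _ ≤ T / 2 * (2 * Real.pi * ∑ k ∈ J, ‖b k‖ ^ 2 * ∑ l ∈ J, m k l) :=
        mul_le_mul_of_nonneg_left hbound (by positivity)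
    _ = _ := by ring

namespace Counting

variable {S} {θ A C : ℝ}

open MeasureTheory in
/-- A discrete mean value theorem for generalized Dirichlet polynomials. -/
theorem exists_mean_value (h : S.Counting θ A C) {η : ℝ} (hη : 0 < η) (hη1 : η ≤ 1) :
    ∃ K : ℝ, 0 ≤ K ∧ ∀ (T : ℝ) (I : Finset ℂ) (t w : ℂ → ℝ), 2 ≤ T → (∀ r ∈ I, |t r| ≤ T) →
      (∀ x ∈ I, ∀ y ∈ I, x ≠ y → 1 ≤ |t x - t y|) → (∀ r ∈ I, η ≤ w r ∧ w r ≤ 3) →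
      ∀ (J : Finset (ℕ →₀ ℕ)) (b : (ℕ →₀ ℕ) → ℂ),
      ∑ r ∈ I, ‖∑ k ∈ J, b k * (S.val k : ℂ) ^ (-((w r : ℂ) + (t r : ℂ) * Complex.I))‖ ^ 2 ≤
        K * ∑ k ∈ J, ‖b k‖ ^ 2 * (S.val k + T * S.val k ^ θ) := by
  obtain ⟨K1, hK1, hsep1⟩ := exists_sum_inv_one_add_sq_le_mul
  obtain ⟨K2, hK2, hrow⟩ := h.exists_row_sum_le
  refine ⟨(η ^ 2)⁻¹ * (K1 * (Real.pi * K2)), by positivity, fun T I t w hT ht hsep hw J b => ?_⟩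
  have hT0 : 0 < T := by linarith
  have hint : ∀ s : ℝ, Integrable fun v : ℝ => ‖S.vertPoly J b v‖ ^ 2 * (1 + (v - s) ^ 2)⁻¹ := by
    intro s
    have h1 := S.integrable_vertPoly_mul (J := J) (b := b)
      (integrable_inv_one_add_sq.comp_sub_right s) 0 2
    simpa using h1
  have hpois : Integrable fun v : ℝ => ‖S.vertPoly J b v‖ ^ 2 * (T ^ 2 / (T ^ 2 + v ^ 2)) := by
    have h1 := (S.integrable_vertPoly_mul (J := J) (b := b) (integrable_poisson hT0) 0 2).const_mul
      (T / 2)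
    refine h1.congr (Eventually.of_forall fun v => ?_)
    simp only [zero_add]
    ring
  calc _ ≤ ∑ r ∈ I, (η ^ 2)⁻¹ * ∫ v : ℝ, ‖S.vertPoly J b v‖ ^ 2 * (1 + (v - t r) ^ 2)⁻¹ :=
        Finset.sum_le_sum fun r hr =>
          S.sq_norm_dirichletPoly_le J b hη hη1 (hw r hr).1 (hw r hr).2 (t r)
    _ = (η ^ 2)⁻¹ * ∫ v : ℝ, ‖S.vertPoly J b v‖ ^ 2 * ∑ r ∈ I, (1 + (v - t r) ^ 2)⁻¹ := by
        rw [← Finset.mul_sum, ← integral_finsetSum _ fun r _ => hint (t r)]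
        simp_rw [Finset.mul_sum]
    _ ≤ (η ^ 2)⁻¹ * ∫ v : ℝ, K1 * (‖S.vertPoly J b v‖ ^ 2 * (T ^ 2 / (T ^ 2 + v ^ 2))) := by
        refine mul_le_mul_of_nonneg_left (integral_mono ?_ (hpois.const_mul _) fun v => ?_)
          (by positivity)
        · simp_rw [Finset.mul_sum]
          exact integrable_finsetSum _ fun r _ => hint (t r)
        · simp only
          calc _ ≤ ‖S.vertPoly J b v‖ ^ 2 * (K1 * (T ^ 2 / (T ^ 2 + v ^ 2))) :=
                mul_le_mul_of_nonneg_left (hsep1 T I t hT ht hsep v) (by positivity)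
            _ = _ := by ring
    _ ≤ (η ^ 2)⁻¹ * (K1 * (Real.pi * T * ∑ k ∈ J, ‖b k‖ ^ 2 *
          (K2 * (S.val k / T + S.val k ^ θ)))) := by
        rw [integral_const_mul]
        refine mul_le_mul_of_nonneg_left (mul_le_mul_of_nonneg_left
          ((S.integral_sq_vertPoly_le J b hT0).trans ?_) hK1) (by positivity)
        refine mul_le_mul_of_nonneg_left (Finset.sum_le_sum fun k _ => ?_) (by positivity)
        exact mul_le_mul_of_nonneg_left (hrow T k J hT) (by positivity)
    _ = _ := by
        simp_rw [Finset.mul_sum]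
        refine Finset.sum_congr rfl fun k _ => ?_
        field_simp

end Counting

end BeurlingSystem

namespace BeurlingSystem.Counting

variable {S : BeurlingSystem} {θ A C : ℝ} {Z : ℂ → ℂ}

/-- The discrete mean value theorem for convergent generalized Dirichlet series. -/
theorem exists_mean_value_hasSum (h : S.Counting θ A C) {η : ℝ} (hη : 0 < η) (hη1 : η ≤ 1) :
    ∃ K : ℝ, 0 ≤ K ∧ ∀ (T : ℝ) (I : Finset ℂ) (t w : ℂ → ℝ), 2 ≤ T → (∀ r ∈ I, |t r| ≤ T) →
      (∀ x ∈ I, ∀ y ∈ I, x ≠ y → 1 ≤ |t x - t y|) → (∀ r ∈ I, η ≤ w r ∧ w r ≤ 3) →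
      ∀ (b : (ℕ →₀ ℕ) → ℂ) (g : ℂ → ℂ) (Q : ℝ),
      (∀ r ∈ I, HasSum (fun k => b k * (S.val k : ℂ) ^ (-((w r : ℂ) + (t r : ℂ) * Complex.I)))
        (g r)) →
      (∀ J : Finset (ℕ →₀ ℕ), ∑ k ∈ J, ‖b k‖ ^ 2 * (S.val k + T * S.val k ^ θ) ≤ Q) →
      ∑ r ∈ I, ‖g r‖ ^ 2 ≤ K * Q := by
  obtain ⟨K, hK, hmv⟩ := h.exists_mean_value hη hη1
  refine ⟨K, hK, fun T I t w hT ht hsep hw b g Q hg hQ => ?_⟩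
  have hlim : Tendsto (fun J : Finset (ℕ →₀ ℕ) => ∑ r ∈ I,
      ‖∑ k ∈ J, b k * (S.val k : ℂ) ^ (-((w r : ℂ) + (t r : ℂ) * Complex.I))‖ ^ 2) atTop
      (nhds (∑ r ∈ I, ‖g r‖ ^ 2)) :=
    tendsto_finsetSum _ fun r hr => ((hg r hr).norm.pow 2)
  refine le_of_tendsto hlim (Eventually.of_forall fun J => ?_)
  exact (hmv T I t w hT ht hsep hw J b).trans (mul_le_mul_of_nonneg_left (hQ J) hK)

lemma norm_exp_sq_mul_le {w : ℂ} (hw : |w.re| ≤ 3) :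
    ‖Complex.exp (w ^ 2)‖ * ((1 + ‖w‖) * (1 + |w.im|)) ≤ 8 * Real.exp 9 := by
  have h1 : (w ^ 2).re = w.re ^ 2 - w.im ^ 2 := by simp [sq, Complex.mul_re]
  have h2 : ‖w‖ ≤ 3 + |w.im| := (Complex.norm_le_abs_re_add_abs_im w).trans (by linarith)
  have h3 : w.re ^ 2 ≤ 9 := by
    have := sq_le_sq' (abs_le.mp hw).1 (abs_le.mp hw).2
    linarith
  have h0 := abs_nonneg w.im
  have h4 : (1 + ‖w‖) * (1 + |w.im|) ≤ 8 * Real.exp (w.im ^ 2) := by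
    have h5 := Real.add_one_le_exp (w.im ^ 2)
    have h6 := sq_abs w.im
    nlinarith [sq_nonneg (|w.im| - 1), norm_nonneg w]
  rw [Complex.norm_exp, h1]
  calc Real.exp (w.re ^ 2 - w.im ^ 2) * ((1 + ‖w‖) * (1 + |w.im|))
      ≤ Real.exp (9 - w.im ^ 2) * (8 * Real.exp (w.im ^ 2)) := by
        gcongr
    _ = 8 * Real.exp 9 := by
        rw [mul_left_comm, ← Real.exp_add]; ring_nf

/-- The mollified function detecting a zero `ρ`, normalized to be `-1` at `w = 0`. -/
noncomputable def detector (S : BeurlingSystem) (Z : ℂ → ℂ) (A X : ℝ) (ρ w : ℂ) : ℂ :=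
  ((ρ + w - 1) * (zetaRegular Z A (ρ + w) * S.mollifier X (ρ + w) - 1) +
    A * S.mollifier X (ρ + w)) / (ρ - 1)

lemma detector_zero {X : ℝ} {ρ : ℂ} (hρ : Z ρ = 0) (hρ1 : ρ ≠ 1) :
    detector S Z A X ρ 0 = -1 := by
  have h1 : ρ - 1 ≠ 0 := sub_ne_zero.mpr hρ1
  rw [detector, zetaRegular, add_zero, hρ]
  field_simp
  ring

lemma detector_eq {X : ℝ} {ρ w : ℂ} (hs : ρ + w ≠ 1) :
    detector S Z A X ρ w = (ρ + w - 1) / (ρ - 1) * (Z (ρ + w) * S.mollifier X (ρ + w) - 1) := by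
  have h1 : ρ + w - 1 ≠ 0 := sub_ne_zero.mpr hs
  rw [detector, zetaRegular, div_mul_eq_mul_div]
  congr 1
  field_simp
  ring

lemma norm_div_sub_one_le {ρ w : ℂ} (hρ : 1 ≤ |ρ.im|) : ‖(ρ + w - 1) / (ρ - 1)‖ ≤ 1 + ‖w‖ := by
  have h1 : 1 ≤ ‖ρ - 1‖ := by
    have := Complex.abs_im_le_norm (ρ - 1)
    simp at this
    linarith
  rw [norm_div, div_le_iff₀ (by linarith)]
  calc ‖ρ + w - 1‖ = ‖(ρ - 1) + w‖ := by ring_nf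
    _ ≤ ‖ρ - 1‖ + ‖w‖ := norm_add_le _ _
    _ ≤ _ := by nlinarith [norm_nonneg w]

lemma norm_detector_le (hA : 0 < A) {X : ℝ} {ρ w : ℂ} (hρ : 1 ≤ |ρ.im|) :
    ‖detector S Z A X ρ w‖ ≤ (1 + ‖w‖) *
      ((‖zetaRegular Z A (ρ + w)‖ + A) * ‖S.mollifier X (ρ + w)‖ + 1) := by
  have h1 : 1 ≤ ‖ρ - 1‖ := by
    have := Complex.abs_im_le_norm (ρ - 1)
    simp at this
    linarith
  have h2 : detector S Z A X ρ w = (ρ + w - 1) / (ρ - 1) *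
      (zetaRegular Z A (ρ + w) * S.mollifier X (ρ + w) - 1) +
      A * S.mollifier X (ρ + w) / (ρ - 1) := by
    rw [detector]; ring
  have h3 : ‖(A : ℂ) * S.mollifier X (ρ + w) / (ρ - 1)‖ ≤ A * ‖S.mollifier X (ρ + w)‖ := by
    rw [norm_div, norm_mul, Complex.norm_real, Real.norm_of_nonneg hA.le]
    exact div_le_self (by positivity) h1
  have h4 : ‖zetaRegular Z A (ρ + w) * S.mollifier X (ρ + w) - 1‖ ≤
      ‖zetaRegular Z A (ρ + w)‖ * ‖S.mollifier X (ρ + w)‖ + 1 := by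
    refine (norm_sub_le _ _).trans ?_
    rw [norm_mul, norm_one]
  have h5 : 0 ≤ A * ‖S.mollifier X (ρ + w)‖ := by positivity
  rw [h2]
  refine (norm_add_le _ _).trans ?_
  rw [norm_mul]
  have h6 := mul_le_mul (norm_div_sub_one_le (w := w) hρ) h4 (norm_nonneg _) (by positivity)
  nlinarith [norm_nonneg w, mul_nonneg (norm_nonneg w) h5]

lemma differentiableAt_detector (hZ : S.IsZeta θ A Z) {X : ℝ} {ρ w : ℂ}
    (hs : θ < (ρ + w).re) : DifferentiableAt ℂ (detector S Z A X ρ) w := by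
  have h1 : DifferentiableAt ℂ (fun w => zetaRegular Z A (ρ + w)) w := by
    have := differentiableAt_zetaRegular hZ hs
    exact this.comp w ((differentiableAt_const ρ).add differentiableAt_id)
  have h2 : DifferentiableAt ℂ (fun w => S.mollifier X (ρ + w)) w :=
    (S.differentiable_mollifier X _).comp w ((differentiableAt_const ρ).add differentiableAt_id)
  have h3 : DifferentiableAt ℂ (fun w => ρ + w - 1) w := by fun_prop
  unfold detector
  exact ((h3.mul ((h1.mul h2).sub_const 1)).add (h2.const_mul _)).div_const _

/-- Mean value of the mollifier just to the right of the critical line `(1 + θ) / 2`. -/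
lemma exists_sum_sq_mollifier_le (h : S.Counting θ A C) {η : ℝ} (hη : 0 < η) (hη1 : η ≤ 1) :
    ∃ K : ℝ, 0 ≤ K ∧ ∀ (T X : ℝ) (I : Finset ℂ) (w : ℂ), 2 ≤ T → 1 ≤ X →
      X ^ (1 - θ) = T → (∀ ρ ∈ I, |ρ.im| ≤ T) →
      (∀ x ∈ I, ∀ y ∈ I, x ≠ y → 1 ≤ |x.im - y.im|) →
      (∀ ρ ∈ I, (1 + θ) / 2 ≤ ρ.re + w.re ∧ ρ.re + w.re ≤ (1 + θ) / 2 + 2) →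
      ∑ ρ ∈ I, ‖S.mollifier X (ρ + w)‖ ^ 2 ≤ K * (T * X ^ (3 * η)) := by
  obtain ⟨K, hK, hmv⟩ := h.exists_mean_value hη hη1
  have hsum := h.summable_val_rpow (a := 1 + η) (by linarith)
  set K1 := ∑' k, S.val k ^ (-(1 + η)) with hK1
  have hK1n : 0 ≤ K1 := tsum_nonneg fun k => Real.rpow_nonneg (S.val_pos k).le _
  refine ⟨K * (2 * K1), by positivity, fun T X I w hT hX hXT him hsep hre => ?_⟩
  set σ0 : ℝ := (1 + θ) / 2 - η with hσ0
  set s0 : ℂ := (σ0 : ℂ) + (w.im : ℂ) * Complex.I with hs0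
  set b : (ℕ →₀ ℕ) → ℂ := fun d => (-1 : ℂ) ^ d.support.card * (S.val d : ℂ) ^ (-s0) with hb
  have hmain := hmv T I (fun ρ => ρ.im) (fun ρ => ρ.re + w.re - σ0) hT him hsep (fun ρ hρ => by
    have := hre ρ hρ
    constructor <;> simp only [hσ0] <;> linarith) (S.squarefreeUpTo X) b
  have hM : ∀ ρ ∈ I, ‖∑ k ∈ S.squarefreeUpTo X, b k * (S.val k : ℂ) ^
      (-(((ρ.re + w.re - σ0 : ℝ) : ℂ) + (ρ.im : ℂ) * Complex.I))‖ ^ 2 =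
      ‖S.mollifier X (ρ + w)‖ ^ 2 := by
    intro ρ _
    rw [mollifier]
    congr 2
    refine Finset.sum_congr rfl fun k _ => ?_
    simp only [hb]
    rw [mul_assoc, ← Complex.cpow_add _ _ (val_ne_zero S k)]
    congr 2
    simp only [hs0]
    apply Complex.ext <;> simp <;> ring
  rw [Finset.sum_congr rfl hM] at hmain
  refine hmain.trans ?_
  have hX0 : 0 < X := by linarith
  have hT0 : 0 < T := by linarith
  have hterm : ∀ k ∈ S.squarefreeUpTo X, ‖b k‖ ^ 2 * (S.val k + T * S.val k ^ θ) ≤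
      2 * (T * X ^ (3 * η)) * S.val k ^ (-(1 + η)) := by
    intro k hk
    have hkX : S.val k ≤ X := (mem_squarefreeUpTo.mp hk).1
    have hn := S.val_pos k
    set n := S.val k
    have hbk : ‖b k‖ = n ^ (-σ0) := by
      simp only [hb]
      rw [norm_mul, norm_pow, norm_neg, norm_one, one_pow, one_mul, norm_val_cpow]
      simp [hs0, n]
    have hsq : (n ^ (-σ0)) ^ 2 = n ^ (-σ0 * 2) := by
      rw [Real.rpow_mul hn.le]; norm_cast
    have h1 : n ^ (1 - θ) ≤ T := by
      rw [← hXT]; exact Real.rpow_le_rpow hn.le hkX (by linarith [h.theta_lt])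
    have h2 : n ^ (3 * η) ≤ X ^ (3 * η) := Real.rpow_le_rpow hn.le hkX (by positivity)
    have e1 : n ^ (-σ0 * 2) * n = n ^ (-(1 + η)) * (n ^ (1 - θ) * n ^ (3 * η)) := by
      nth_rewrite 2 [← Real.rpow_one n]
      rw [← Real.rpow_add hn, ← Real.rpow_add hn, ← Real.rpow_add hn]
      congr 1; simp only [hσ0]; ring
    have e2 : n ^ (-σ0 * 2) * n ^ θ = n ^ (-(1 + η)) * n ^ (3 * η) := by
      rw [← Real.rpow_add hn, ← Real.rpow_add hn]
      congr 1; simp only [hσ0]; ring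
    rw [hbk, hsq]
    calc n ^ (-σ0 * 2) * (n + T * n ^ θ)
        = n ^ (-σ0 * 2) * n + T * (n ^ (-σ0 * 2) * n ^ θ) := by ring
      _ = n ^ (-(1 + η)) * (n ^ (1 - θ) * n ^ (3 * η)) + T * (n ^ (-(1 + η)) * n ^ (3 * η)) := by
          rw [e1, e2]
      _ ≤ n ^ (-(1 + η)) * (T * X ^ (3 * η)) + T * (n ^ (-(1 + η)) * X ^ (3 * η)) := by
          gcongr
      _ = _ := by ring
  calc _ ≤ K * ∑ k ∈ S.squarefreeUpTo X, 2 * (T * X ^ (3 * η)) * S.val k ^ (-(1 + η)) :=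
        mul_le_mul_of_nonneg_left (Finset.sum_le_sum hterm) hK
    _ ≤ K * (2 * (T * X ^ (3 * η)) * K1) := by
        rw [← Finset.mul_sum]
        gcongr
        exact hsum.sum_le_tsum _ fun k _ => Real.rpow_nonneg (S.val_pos k).le _
    _ = _ := by ring

/-- Mean value of `ζ M - 1` just to the right of the line `1`. -/
lemma exists_sum_sq_zeta_mul_mollifier_sub_one_le (h : S.Counting θ A C) (hZ : S.IsZeta θ A Z)
    {η : ℝ} (hη : 0 < η) (hη1 : η ≤ 1) :
    ∃ K : ℝ, 0 ≤ K ∧ ∀ (T X : ℝ) (I : Finset ℂ) (w : ℂ), 2 ≤ T → 1 ≤ X →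
      X ^ (1 - θ) = T → (∀ ρ ∈ I, |ρ.im| ≤ T) →
      (∀ x ∈ I, ∀ y ∈ I, x ≠ y → 1 ≤ |x.im - y.im|) →
      (∀ ρ ∈ I, 1 + 2 * η ≤ ρ.re + w.re ∧ ρ.re + w.re ≤ 4) →
      ∑ ρ ∈ I, ‖Z (ρ + w) * S.mollifier X (ρ + w) - 1‖ ^ 2 ≤ K := by
  obtain ⟨K, hK, hmv⟩ := h.exists_mean_value_hasSum hη hη1
  obtain ⟨K2, hK2, hcoeff⟩ := exists_abs_mollCoeff_le S (ε := η / 2) (by positivity)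
  have hsum := h.summable_val_rpow (a := 1 + η) (by linarith)
  set K1 := ∑' k, S.val k ^ (-(1 + η)) with hK1
  have hK1n : 0 ≤ K1 := tsum_nonneg fun k => Real.rpow_nonneg (S.val_pos k).le _
  refine ⟨K * (2 * K2 ^ 2 * K1), by positivity, fun T X I w hT hX hXT him hsep hre => ?_⟩
  have hX0 : 0 < X := by linarith
  have hT0 : 0 < T := by linarith
  set s0 : ℂ := ((1 + η : ℝ) : ℂ) + (w.im : ℂ) * Complex.I with hs0
  set b : (ℕ →₀ ℕ) → ℂ := fun k => (if k = 0 then 0 else (S.mollCoeff X k : ℂ)) *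
    (S.val k : ℂ) ^ (-s0) with hb
  refine hmv T I (fun ρ => ρ.im) (fun ρ => ρ.re + w.re - (1 + η)) hT him hsep (fun ρ hρ => by
    have := hre ρ hρ
    constructor <;> linarith) b _ _ (fun ρ hρ => ?_) (fun J => ?_)
  · have h1 := h.hasSum_mollCoeff hZ X (s := ρ + w) (by
      have := (hre ρ hρ).1
      simp only [Complex.add_re]; linarith)
    have h2 := h1.update 0 0
    have e0 : (0 : ℂ) - (S.mollCoeff X 0 : ℂ) * (S.val 0 : ℂ) ^ (-(ρ + w)) +
        Z (ρ + w) * S.mollifier X (ρ + w) = Z (ρ + w) * S.mollifier X (ρ + w) - 1 := by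
      rw [mollCoeff_eq (by rw [val_zero]; exact hX)]
      simp
      ring
    rw [e0] at h2
    refine h2.congr_fun fun k => ?_
    rw [Function.update_apply]
    simp only [hb]
    by_cases hk : k = 0
    · simp [hk]
    · rw [if_neg hk, if_neg hk, mul_assoc, ← Complex.cpow_add _ _ (val_ne_zero S k)]
      congr 2
      simp only [hs0]
      apply Complex.ext <;> simp <;> ring
  · have hterm : ∀ k ∈ J, ‖b k‖ ^ 2 * (S.val k + T * S.val k ^ θ) ≤
        2 * K2 ^ 2 * S.val k ^ (-(1 + η)) := by
      intro k _
      have hn := S.val_pos k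
      have hn1 := S.one_le_val k
      by_cases hkX : S.val k ≤ X
      · have hb0 : b k = 0 := by
          simp only [hb]
          rw [mollCoeff_eq hkX]
          split_ifs <;> simp
        rw [hb0, norm_zero]
        have := Real.rpow_nonneg hn.le (-(1 + η))
        simp only [ne_eq, OfNat.ofNat_ne_zero, not_false_eq_true, zero_pow, zero_mul]
        positivity
      · push Not at hkX
        have hcoeff' : ‖(if k = 0 then 0 else (S.mollCoeff X k : ℂ))‖ ≤
            K2 * S.val k ^ (η / 2) := by
          split_ifs
          · rw [norm_zero]
            positivity
          · rw [Complex.norm_real]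
            exact hcoeff X k
        have hbk : ‖b k‖ ≤ K2 * (S.val k ^ (η / 2) * S.val k ^ (-(1 + η))) := by
          simp only [hb]
          rw [norm_mul, norm_val_cpow]
          calc _ ≤ K2 * S.val k ^ (η / 2) * S.val k ^ (-s0).re :=
                mul_le_mul_of_nonneg_right hcoeff' (Real.rpow_nonneg hn.le _)
            _ = _ := by rw [mul_assoc]; simp [hs0]
        set n := S.val k
        rw [← Real.rpow_add hn] at hbk
        have hsq : (n ^ (η / 2 + -(1 + η))) ^ 2 = n ^ (-(2 + η)) := by
          rw [← Real.rpow_natCast, ← Real.rpow_mul hn.le]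
          congr 1; push_cast; ring
        have h1 : T ≤ n ^ (1 - θ) := by
          rw [← hXT]; exact Real.rpow_le_rpow hX0.le hkX.le (by linarith [h.theta_lt])
        have h2 : T * n ^ θ ≤ n := by
          calc T * n ^ θ ≤ n ^ (1 - θ) * n ^ θ := by gcongr
            _ = n := by rw [← Real.rpow_add hn]; simp
        have e1 : n ^ (-(2 + η)) * n = n ^ (-(1 + η)) := by
          nth_rewrite 2 [← Real.rpow_one n]
          rw [← Real.rpow_add hn]
          congr 1; ring
        calc ‖b k‖ ^ 2 * (n + T * n ^ θ)
            ≤ (K2 * n ^ (η / 2 + -(1 + η))) ^ 2 * (n + n) := by gcongr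
          _ = 2 * K2 ^ 2 * (n ^ (-(2 + η)) * n) := by rw [mul_pow, hsq]; ring
          _ = _ := by rw [e1]
    refine (Finset.sum_le_sum hterm).trans ?_
    rw [← Finset.mul_sum]
    gcongr
    exact hsum.sum_le_tsum _ fun k _ => Real.rpow_nonneg (S.val_pos k).le _

end BeurlingSystem.Counting

lemma sum_le_sqrt_card_mul_sqrt {ι : Type*} (I : Finset ι) {f : ι → ℝ} {Q : ℝ}
    (hQ : ∑ i ∈ I, f i ^ 2 ≤ Q) : ∑ i ∈ I, f i ≤ √I.card * √Q := by
  rw [← Real.sqrt_mul (Nat.cast_nonneg _)]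
  refine Real.le_sqrt_of_sq_le ?_
  exact sq_sum_le_card_mul_sum_sq.trans (mul_le_mul_of_nonneg_left hQ (Nat.cast_nonneg _))

namespace BeurlingSystem.Counting

variable {S : BeurlingSystem} {θ A C : ℝ} {Z : ℂ → ℂ}

/-- The number of `1`-separated points with ordinates in `[-T, T]` is `O(T)`. -/
lemma exists_card_le_mul (h : S.Counting θ A C) :
    ∃ K : ℝ, 0 ≤ K ∧ ∀ (T : ℝ) (I : Finset ℂ), 2 ≤ T → (∀ ρ ∈ I, |ρ.im| ≤ T) →
      (∀ x ∈ I, ∀ y ∈ I, x ≠ y → 1 ≤ |x.im - y.im|) → (I.card : ℝ) ≤ K * T := by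
  obtain ⟨K, hK, hmv⟩ := h.exists_mean_value one_pos le_rfl
  refine ⟨2 * K, by positivity, fun T I hT him hsep => ?_⟩
  have h1 := hmv T I (fun ρ => ρ.im) (fun _ => 1) hT him hsep (fun _ _ => ⟨le_rfl, by norm_num⟩)
    {0} (fun _ => 1)
  simp at h1
  nlinarith

lemma norm_zetaRegular_add_le {K B : ℝ} (hA : 0 < A) (hK : 0 ≤ K) (hB : 0 < B) (hB1 : B ≤ 1)
    (hE : ∀ s : ℂ, (1 + θ) / 2 ≤ s.re → ‖zetaRegular Z A s‖ ≤ K * (1 + |s.im|) ^ B)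
    {T : ℝ} (hT : 2 ≤ T) {ρ w : ℂ} (hρ : |ρ.im| ≤ T) (hs : (1 + θ) / 2 ≤ ρ.re + w.re) :
    ‖zetaRegular Z A (ρ + w)‖ + A ≤ 2 * (K + A) * T ^ B * (1 + |w.im|) := by
  have hv := abs_nonneg w.im
  have h1 : (1 + |(ρ + w).im|) ^ B ≤ 2 * T ^ B * (1 + |w.im|) := by
    have h2 : 1 + |(ρ + w).im| ≤ 2 * T * (1 + |w.im|) := by
      have := abs_add_le ρ.im w.im
      rw [Complex.add_im]
      nlinarith
    calc (1 + |(ρ + w).im|) ^ B ≤ (2 * T * (1 + |w.im|)) ^ B :=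
          Real.rpow_le_rpow (by positivity) h2 hB.le
      _ = 2 ^ B * T ^ B * (1 + |w.im|) ^ B := by
          rw [Real.mul_rpow (by positivity) (by positivity),
            Real.mul_rpow (by norm_num) (by linarith)]
      _ ≤ 2 * T ^ B * (1 + |w.im|) := by
          have e1 : (2 : ℝ) ^ B ≤ 2 ^ (1 : ℝ) := Real.rpow_le_rpow_of_exponent_le (by norm_num) hB1
          have e2 : (1 + |w.im|) ^ B ≤ (1 + |w.im|) ^ (1 : ℝ) :=
            Real.rpow_le_rpow_of_exponent_le (by linarith) hB1
          rw [Real.rpow_one] at e1 e2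
          have : 0 ≤ T ^ B := Real.rpow_nonneg (by linarith) B
          gcongr
  have h3 : 1 ≤ 2 * T ^ B * (1 + |w.im|) := by
    have := Real.one_le_rpow (by linarith : 1 ≤ T) hB.le
    nlinarith
  have h4 := hE (ρ + w) (by simpa using hs)
  calc _ ≤ K * (2 * T ^ B * (1 + |w.im|)) + A * (2 * T ^ B * (1 + |w.im|)) :=
        add_le_add (h4.trans (mul_le_mul_of_nonneg_left h1 hK)) (le_mul_of_one_le_right hA.le h3)
    _ = _ := by ring

set_option maxHeartbeats 1000000 in
/-- The number of `1`-separated zeros, by the three lines theorem. -/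
theorem exists_card_separated_zeros_le (h : S.Counting θ A C) (hZ : S.IsZeta θ A Z)
    (hlin : ∀ B > (0:ℝ), ∃ CB : ℝ, ∀ t : ℝ,
      ‖Z ((((1 + θ) / 2 : ℝ) : ℂ) + Complex.I * (t : ℂ))‖ ≤ CB * (1 + |t|) ^ B)
    {η : ℝ} (hη : 0 < η) (hη1 : η ≤ 1) :
    ∃ K : ℝ, 0 ≤ K ∧ ∀ (T α : ℝ) (G : Finset ℂ), 2 ≤ T → (1 + θ) / 2 ≤ α → α ≤ 1 →
      (∀ ρ ∈ G, Z ρ = 0 ∧ ρ ≠ 1 ∧ α ≤ ρ.re ∧ ρ.re ≤ 1 ∧ 1 ≤ |ρ.im| ∧ |ρ.im| ≤ T) →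
      (∀ x ∈ G, ∀ y ∈ G, x ≠ y → 1 ≤ |x.im - y.im|) →
      (G.card : ℝ) ≤ K * T ^ (2 * (1 - α) / (1 - θ) + η * (7 / (1 - θ) + 2)) := by
  have hA := h.density_pos
  have hθ0 := h.theta_nonneg
  have hθ1 : 0 < 1 - θ := by linarith [h.theta_lt]
  obtain ⟨KE, hKE, hE⟩ := h.zetaRegular_lindelof hZ hlin hη
  obtain ⟨KM, hKM, hM⟩ := h.exists_sum_sq_mollifier_le hη hη1
  obtain ⟨KR, hKR, hR⟩ := h.exists_sum_sq_zeta_mul_mollifier_sub_one_le hZ hη hη1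
  obtain ⟨K0, hK0, hcard⟩ := h.exists_card_le_mul
  set c0 : ℝ := 8 * Real.exp 9 with hc0
  have hc0p : 0 < c0 := by positivity
  set D : ℝ := c0 * (2 * (KE + A) * √KM + √K0) + c0 * √KR with hD
  have hD0 : 0 ≤ D := by positivity
  refine ⟨D ^ 2, by positivity, fun T α G hT hα hα1 hG hsep => ?_⟩
  have hT0 : 0 < T := by linarith
  have hT1 : 1 ≤ T := by linarith
  set κ : ℝ := 1 / (1 - θ) with hκ
  have hκ0 : 0 < κ := by positivity
  set X : ℝ := T ^ κ with hX
  have hX1 : 1 ≤ X := Real.one_le_rpow hT1 hκ0.le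
  have hXT : X ^ (1 - θ) = T := by
    rw [hX, ← Real.rpow_mul hT0.le, hκ, one_div_mul_cancel hθ1.ne', Real.rpow_one]
  have him : ∀ ρ ∈ G, |ρ.im| ≤ T := fun ρ hρ => (hG ρ hρ).2.2.2.2.2
  set R : ℝ := (G.card : ℝ) with hRdef
  have hR0 : 0 ≤ R := Nat.cast_nonneg _
  set e : ℝ := 1 / 2 + 3 * η * κ / 2 + η with he
  set l : ℝ := (1 + θ) / 2 - α with hl
  set u : ℝ := 1 + 2 * η - α with hu
  have hlu : l < u := by simp only [hl, hu]; linarith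
  set f : ℂ → ℂ := fun w => Complex.exp (w ^ 2) * ∑ ρ ∈ G, detector S Z A X ρ w with hf
  have hwre : ∀ w : ℂ, l ≤ w.re → w.re ≤ u → |w.re| ≤ 3 := fun w h1 h2 => by
    simp only [hl, hu] at h1 h2
    rw [abs_le]; constructor <;> linarith
  have hsre : ∀ ρ ∈ G, ∀ w : ℂ, l ≤ w.re → (1 + θ) / 2 ≤ ρ.re + w.re := fun ρ hρ w h1 => by
    have := (hG ρ hρ).2.2.1
    simp only [hl] at h1
    linarith
  have hnorm_f : ∀ w, ‖f w‖ ≤ ‖Complex.exp (w ^ 2)‖ * ∑ ρ ∈ G, ‖detector S Z A X ρ w‖ := by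
    intro w
    simp only [hf]
    rw [norm_mul]
    exact mul_le_mul_of_nonneg_left (norm_sum_le _ _) (norm_nonneg _)
  have hgen : ∀ w : ℂ, l ≤ w.re → w.re ≤ u →
      ‖f w‖ ≤ c0 * (2 * (KE + A) * T ^ η * ∑ ρ ∈ G, ‖S.mollifier X (ρ + w)‖ + R) := by
    intro w h1 h2
    refine (hnorm_f w).trans ?_
    have h3 : ∑ ρ ∈ G, ‖detector S Z A X ρ w‖ ≤ ((1 + ‖w‖) * (1 + |w.im|)) *
        (2 * (KE + A) * T ^ η * ∑ ρ ∈ G, ‖S.mollifier X (ρ + w)‖ + R) := by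
      have h4 : R = ∑ ρ ∈ G, (1 : ℝ) := by simp [hRdef]
      rw [h4, Finset.mul_sum, ← Finset.sum_add_distrib, Finset.mul_sum]
      refine Finset.sum_le_sum fun ρ hρ => ?_
      refine (norm_detector_le hA (hG ρ hρ).2.2.2.2.1).trans ?_
      rw [mul_assoc]
      refine mul_le_mul_of_nonneg_left ?_ (by positivity)
      have h5 := norm_zetaRegular_add_le hA hKE hη hη1 hE hT (him ρ hρ) (hsre ρ hρ w h1)
      have h6 := mul_le_mul_of_nonneg_right h5 (norm_nonneg (S.mollifier X (ρ + w)))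
      have h7 := abs_nonneg w.im
      nlinarith
    calc _ ≤ ‖Complex.exp (w ^ 2)‖ * (((1 + ‖w‖) * (1 + |w.im|)) *
        (2 * (KE + A) * T ^ η * ∑ ρ ∈ G, ‖S.mollifier X (ρ + w)‖ + R)) :=
          mul_le_mul_of_nonneg_left h3 (norm_nonneg _)
      _ = (‖Complex.exp (w ^ 2)‖ * ((1 + ‖w‖) * (1 + |w.im|))) *
        (2 * (KE + A) * T ^ η * ∑ ρ ∈ G, ‖S.mollifier X (ρ + w)‖ + R) := by ring
      _ ≤ _ := by
          refine mul_le_mul_of_nonneg_right (norm_exp_sq_mul_le (hwre w h1 h2)) ?_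
          have := Finset.sum_nonneg fun ρ (_ : ρ ∈ G) => norm_nonneg (S.mollifier X (ρ + w))
          positivity
  have hbdd : BddAbove ((norm ∘ f) '' Complex.HadamardThreeLines.verticalClosedStrip l u) := by
    refine ⟨c0 * (2 * (KE + A) * T ^ η * ∑ ρ ∈ G, (A + C) * X + R), ?_⟩
    rintro _ ⟨w, hw, rfl⟩
    have hw' : w.re ∈ Set.Icc l u := hw
    refine (hgen w hw'.1 hw'.2).trans ?_
    gcongr with ρ hρ
    refine h.norm_mollifier_le hX1 ?_
    have := hsre ρ hρ w hw'.1
    simp only [Complex.add_re]; linarith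
  have hdiff : DiffContOnCl ℂ f (Complex.HadamardThreeLines.verticalStrip l u) := by
    refine DifferentiableOn.diffContOnCl fun w hw => ?_
    have hw' : l ≤ w.re := by
      have hcl : closure (Complex.HadamardThreeLines.verticalStrip l u) ⊆
          {w : ℂ | l ≤ w.re} := by
        refine closure_minimal (fun z hz => ?_) (isClosed_le continuous_const Complex.continuous_re)
        have hz' : z.re ∈ Set.Ioo l u := hz
        exact hz'.1.le
      exact hcl hw
    refine DifferentiableAt.differentiableWithinAt ?_
    simp only [hf]
    refine DifferentiableAt.mul (by fun_prop) ?_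
    refine DifferentiableAt.fun_sum fun ρ hρ => differentiableAt_detector hZ ?_
    have := hsre ρ hρ w hw'
    simp only [Complex.add_re]; linarith
  have hTe : 1 ≤ T ^ e := Real.one_le_rpow hT1 (by positivity)
  have hleft : ∀ w : ℂ, w.re = l → ‖f w‖ ≤ D * √R * T ^ e := by
    intro w hw
    refine (hgen w hw.ge (by rw [hw]; exact hlu.le)).trans ?_
    have h1 := hM T X G w hT hX1 hXT him hsep (fun ρ hρ => by
      refine ⟨hsre ρ hρ w hw.ge, ?_⟩
      have := (hG ρ hρ).2.2.2.1
      rw [hw]; simp only [hl]; linarith)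
    have h2 := sum_le_sqrt_card_mul_sqrt G h1
    have h3 : √(KM * (T * X ^ (3 * η))) = √KM * T ^ (1 / 2 + 3 * η * κ / 2) := by
      rw [Real.sqrt_mul hKM]
      congr 1
      rw [hX, ← Real.rpow_mul hT0.le, ← Real.rpow_one_add' hT0.le (by positivity),
        Real.sqrt_eq_rpow, ← Real.rpow_mul hT0.le]
      congr 1; ring
    have h4 : T ^ e = T ^ (1 / 2 + 3 * η * κ / 2) * T ^ η := by
      rw [← Real.rpow_add hT0]
    have h5 : R ≤ √K0 * √R * T ^ e := by
      have h6 : R ≤ K0 * T := hcard T G hT him hsep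
      have h7 : R = √R * √R := (Real.mul_self_sqrt hR0).symm
      have h8 : √R ≤ √K0 * √T := by
        rw [← Real.sqrt_mul hK0]; exact Real.sqrt_le_sqrt h6
      have h9 : √T ≤ T ^ e := by
        rw [Real.sqrt_eq_rpow]
        refine Real.rpow_le_rpow_of_exponent_le hT1 ?_
        have : 0 < η * κ := by positivity
        simp only [he]; nlinarith
      calc R = √R * √R := h7
        _ ≤ √R * (√K0 * T ^ e) := mul_le_mul_of_nonneg_left
            (h8.trans (mul_le_mul_of_nonneg_left h9 (Real.sqrt_nonneg _))) (Real.sqrt_nonneg _)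
        _ = _ := by ring
    calc c0 * (2 * (KE + A) * T ^ η * ∑ ρ ∈ G, ‖S.mollifier X (ρ + w)‖ + R)
        ≤ c0 * (2 * (KE + A) * T ^ η * (√R * √(KM * (T * X ^ (3 * η)))) + √K0 * √R * T ^ e) := by
          gcongr
      _ = c0 * (2 * (KE + A) * √KM + √K0) * √R * T ^ e := by
          rw [h3, h4]; ring
      _ ≤ D * √R * T ^ e := by
          have : 0 ≤ c0 * √KR := by positivity
          gcongr
          simp only [hD]; linarith
  have hright : ∀ w : ℂ, w.re = u → ‖f w‖ ≤ D * √R := by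
    intro w hw
    refine (hnorm_f w).trans ?_
    have hre : ∀ ρ ∈ G, 1 + 2 * η ≤ ρ.re + w.re := fun ρ hρ => by
      have := (hG ρ hρ).2.2.1
      rw [hw]; simp only [hu]; linarith
    have h1 := hR T X G w hT hX1 hXT him hsep (fun ρ hρ => by
      refine ⟨hre ρ hρ, ?_⟩
      have := (hG ρ hρ).2.2.2.1
      rw [hw]; simp only [hu]; linarith)
    have h2 := sum_le_sqrt_card_mul_sqrt G h1
    have h3 : ∑ ρ ∈ G, ‖detector S Z A X ρ w‖ ≤ ((1 + ‖w‖) * (1 + |w.im|)) * (√R * √KR) := by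
      refine le_trans ?_ (mul_le_mul_of_nonneg_left h2 (by positivity))
      rw [Finset.mul_sum]
      refine Finset.sum_le_sum fun ρ hρ => ?_
      have hne : ρ + w ≠ 1 := fun h0 => by
        have h4 := congrArg Complex.re h0
        have h5 := hre ρ hρ
        simp at h4
        linarith
      rw [detector_eq hne, norm_mul]
      refine mul_le_mul_of_nonneg_right ?_ (norm_nonneg _)
      refine (norm_div_sub_one_le (hG ρ hρ).2.2.2.2.1).trans ?_
      have := abs_nonneg w.im
      exact le_mul_of_one_le_right (by positivity) (by linarith)
    calc _ ≤ ‖Complex.exp (w ^ 2)‖ * (((1 + ‖w‖) * (1 + |w.im|)) * (√R * √KR)) :=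
          mul_le_mul_of_nonneg_left h3 (norm_nonneg _)
      _ = (‖Complex.exp (w ^ 2)‖ * ((1 + ‖w‖) * (1 + |w.im|))) * (√R * √KR) := by ring
      _ ≤ c0 * (√R * √KR) := by
          refine mul_le_mul_of_nonneg_right
            (norm_exp_sq_mul_le (hwre w (by rw [hw]; exact hlu.le) hw.le)) (by positivity)
      _ = c0 * √KR * √R := by ring
      _ ≤ D * √R := by
          have : 0 ≤ c0 * (2 * (KE + A) * √KM + √K0) := by positivity
          gcongr
          simp only [hD]; linarith
  have h0mem : (0 : ℂ) ∈ Complex.HadamardThreeLines.verticalClosedStrip l u := by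
    change (0 : ℂ).re ∈ Set.Icc l u
    simp only [Complex.zero_re, hl, hu]
    constructor <;> linarith
  have h3l := Complex.HadamardThreeLines.norm_le_interp_of_mem_verticalClosedStrip' (f := f)
    (a := D * √R * T ^ e) (b := D * √R) hlu h0mem hdiff hbdd
    (fun w hw => hleft w hw) (fun w hw => hright w hw)
  have hf0 : ‖f 0‖ = R := by
    simp only [hf]
    rw [Finset.sum_congr rfl fun ρ hρ => detector_zero (hG ρ hρ).1 (hG ρ hρ).2.1]
    simp [hRdef]
  rw [hf0, Complex.zero_re] at h3l
  set τ : ℝ := (0 - l) / (u - l) with hτ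
  have hul : 0 < u - l := by linarith
  have h1τ : 1 - τ = u / (u - l) := by
    rw [hτ]; field_simp; ring
  have hu0 : 0 ≤ u := by simp only [hu]; linarith
  have hτ1 : 0 ≤ 1 - τ := by rw [h1τ]; positivity
  have hτ0 : 0 ≤ τ := by
    rw [hτ]; refine div_nonneg ?_ hul.le
    simp only [hl]; linarith
  have hDR : 0 ≤ D * √R := by positivity
  have hbound : R ≤ D * √R * T ^ (e * (1 - τ)) := by
    refine h3l.trans (le_of_eq ?_)
    rw [Real.mul_rpow hDR (by positivity), ← Real.rpow_mul hT0.le, mul_right_comm,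
      ← Real.rpow_add' hDR (by ring_nf; norm_num)]
    simp
  have hsq : R ≤ D ^ 2 * T ^ (2 * (e * (1 - τ))) := by
    rcases hR0.eq_or_lt with h0 | hpos
    · rw [← h0]; positivity
    · have h1 : 0 < √R := Real.sqrt_pos.mpr hpos
      have h2 : √R ≤ D * T ^ (e * (1 - τ)) := by
        have h3 : √R * √R ≤ √R * (D * T ^ (e * (1 - τ))) := by
          rw [Real.mul_self_sqrt hR0]; linarith
        exact le_of_mul_le_mul_left h3 h1
      calc R = √R ^ 2 := (Real.sq_sqrt hR0).symm
        _ ≤ (D * T ^ (e * (1 - τ))) ^ 2 := pow_le_pow_left₀ h1.le h2 2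
        _ = _ := by
            rw [mul_pow, ← Real.rpow_natCast (T ^ _), ← Real.rpow_mul hT0.le]
            congr 2; push_cast; ring
  refine hsq.trans (mul_le_mul_of_nonneg_left (Real.rpow_le_rpow_of_exponent_le hT1 ?_)
    (by positivity))
  have hb1 : 1 - τ ≤ 1 := by linarith
  have hb2 : 1 - τ ≤ 2 * κ * (1 - α + 2 * η) := by
    rw [h1τ, div_le_iff₀ hul]
    have e1 : κ * (1 - θ) = 1 := by rw [hκ]; field_simp
    have e2 : u - l = (1 - θ) / 2 + 2 * η := by simp only [hu, hl]; ring
    have e3 : 2 * κ * (1 - α + 2 * η) * (u - l) =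
        (κ * (1 - θ)) * (1 - α + 2 * η) + 4 * κ * η * (1 - α + 2 * η) := by rw [e2]; ring
    rw [e3, e1]
    have : 0 ≤ 4 * κ * η * (1 - α + 2 * η) := by
      have : 0 ≤ 1 - α + 2 * η := by linarith
      positivity
    simp only [hu]; linarith
  have hηκ : 0 < η * κ := by positivity
  have e4 : 2 * (1 - α) / (1 - θ) + η * (7 / (1 - θ) + 2) =
      2 * κ * (1 - α + 2 * η) + (3 * (η * κ) + 2 * η) := by rw [hκ]; ring
  rw [e4]
  have e5 : 2 * (e * (1 - τ)) = (1 - τ) + (3 * (η * κ) + 2 * η) * (1 - τ) := by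
    simp only [he]; ring
  rw [e5]
  have : (3 * (η * κ) + 2 * η) * (1 - τ) ≤ (3 * (η * κ) + 2 * η) * 1 :=
    mul_le_mul_of_nonneg_left hb1 (by positivity)
  linarith

lemma re_le_one_of_zero (h : S.Counting θ A C) (hZ : S.IsZeta θ A Z) {ρ : ℂ} (hρ : Z ρ = 0) :
    ρ.re ≤ 1 := by
  by_contra hc
  exact h.zeta_ne_zero hZ (not_le.mp hc) hρ

/-- The density hypothesis for the zeros of a Beurling zeta function. -/
theorem zeroCount_le_density (h : S.Counting θ A C) (hZ : S.IsZeta θ A Z)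
    (hlin : ∀ B > (0:ℝ), ∃ CB : ℝ, ∀ t : ℝ,
      ‖Z ((((1 + θ) / 2 : ℝ) : ℂ) + Complex.I * (t : ℂ))‖ ≤ CB * (1 + |t|) ^ B)
    {ε : ℝ} (hε : 0 < ε) :
    ∃ K : ℝ, ∀ α T : ℝ, (1 + θ) / 2 ≤ α → 2 ≤ T →
      (zeroCount Z α T : ℝ) ≤ K * T ^ (2 * (1 - α) / (1 - θ) + ε) := by
  classical
  have hθ1 : 0 < 1 - θ := by linarith [h.theta_lt]
  have hden : 0 < 7 / (1 - θ) + 2 := by positivity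
  set η : ℝ := min 1 (ε / 2 / (7 / (1 - θ) + 2)) with hη
  have hη0 : 0 < η := lt_min one_pos (by positivity)
  have hηε : η * (7 / (1 - θ) + 2) ≤ ε / 2 := by
    rw [← le_div_iff₀ hden]; exact min_le_right _ _
  obtain ⟨K, hK, hsepb⟩ := h.exists_card_separated_zeros_le hZ hlin hη0 (min_le_left _ _)
  obtain ⟨L, hL, hsep⟩ := h.exists_separated_zeros hZ
  obtain ⟨L0, hL0, hlow⟩ := h.exists_card_zeros_le_log hZ
  have hlog2 : 0 ≤ Real.log 2 := Real.log_nonneg (by norm_num)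
  set Q : ℝ := L0 * Real.log 2 + 1 + K * (L * (4 ^ (ε / 2) / (ε / 2))) with hQ
  have hQ0 : 0 ≤ Q := by positivity
  refine ⟨Q, fun α T hα hT => ?_⟩
  have hT0 : 0 < T := by linarith
  have hT1 : 1 ≤ T := by linarith
  rcases le_or_gt α 1 with hα1 | hα1
  swap
  · have h0 : {ρ : ℂ | Z ρ = 0 ∧ α ≤ ρ.re ∧ |ρ.im| ≤ T} = ∅ := by
      refine Set.eq_empty_of_forall_notMem fun ρ hρ => ?_
      have := h.re_le_one_of_zero hZ hρ.1
      linarith [hρ.2.1]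
    rw [zeroCount, h0, Set.ncard_empty, Nat.cast_zero]
    positivity
  set E : ℝ := 2 * (1 - α) / (1 - θ) with hE
  have hE0 : 0 ≤ E := div_nonneg (by linarith) hθ1.le
  have hTE : 1 ≤ T ^ (E + ε) := Real.one_le_rpow hT1 (by positivity)
  refine (zeroCount_le_of_forall_finset (B := L0 * Real.log 2 +
    K * (L * (4 ^ (ε / 2) / (ε / 2))) * T ^ (E + ε)) fun F hF => ?_).trans ?_
  · have h1 : ((F.filter fun ρ => |ρ.im| ≤ 1).card : ℝ) ≤ L0 * Real.log 2 := by
      have := hlow 0 (F.filter fun ρ => |ρ.im| ≤ 1) fun ρ hρ => by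
        rw [Finset.mem_filter] at hρ
        have h2 := hF ρ hρ.1
        exact ⟨h2.1, h2.2.1, hα.trans h2.2.2.1, by simpa using hρ.2⟩
      simpa using this
    have h2 : ((F.filter fun ρ => ¬ |ρ.im| ≤ 1).card : ℝ) ≤
        K * (L * (4 ^ (ε / 2) / (ε / 2))) * T ^ (E + ε) := by
      obtain ⟨G, hGF, hGsep, hGcard⟩ := hsep T 1 (F.filter fun ρ => ¬ |ρ.im| ≤ 1) hT0.le le_rfl
        fun ρ hρ => by
          have h2 := hF ρ (Finset.mem_filter.mp hρ).1
          exact ⟨h2.1, h2.2.1, hα.trans h2.2.2.1, h2.2.2.2⟩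
      have h3 := hsepb T α G hT hα hα1 (fun ρ hρ => by
        have h4 := Finset.mem_filter.mp (hGF hρ)
        have h5 := hF ρ h4.1
        exact ⟨h5.1, h5.2.1, h5.2.2.1, h.re_le_one_of_zero hZ h5.1, (not_le.mp h4.2).le,
          h5.2.2.2⟩) hGsep
      have h4 : (G.card : ℝ) ≤ K * T ^ (E + ε / 2) := h3.trans
        (mul_le_mul_of_nonneg_left (Real.rpow_le_rpow_of_exponent_le hT1 (by linarith)) hK)
      have h5 : Real.log (4 + T + 1) ≤ 4 ^ (ε / 2) / (ε / 2) * T ^ (ε / 2) := by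
        have h6 := Real.log_le_rpow_div (x := 4 + T + 1) (ε := ε / 2) (by linarith) (by positivity)
        refine h6.trans ?_
        rw [div_mul_eq_mul_div, ← Real.mul_rpow (by norm_num) hT0.le]
        gcongr
        linarith
      have h6 : 0 ≤ Real.log (4 + T + 1) := Real.log_nonneg (by linarith)
      calc _ ≤ (G.card : ℝ) * (1 * (L * Real.log (4 + T + 1))) := hGcard
        _ ≤ K * T ^ (E + ε / 2) * (1 * (L * (4 ^ (ε / 2) / (ε / 2) * T ^ (ε / 2)))) := by
            gcongr
        _ = K * (L * (4 ^ (ε / 2) / (ε / 2))) * (T ^ (E + ε / 2) * T ^ (ε / 2)) := by ring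
        _ = _ := by
            rw [← Real.rpow_add hT0]; congr 2; ring
    rw [← Finset.card_filter_add_card_filter_not (s := F) (fun ρ => |ρ.im| ≤ 1)]
    push_cast
    exact add_le_add h1 h2
  · have h1 : L0 * Real.log 2 + 1 ≤ (L0 * Real.log 2 + 1) * T ^ (E + ε) :=
      le_mul_of_one_le_right (by positivity) hTE
    simp only [hQ]
    linarith

end BeurlingSystem.Counting

lemma integrable_one_add_sq_rpow :
    MeasureTheory.Integrable fun u : ℝ => (1 + u ^ 2) ^ (-(3 / 4) : ℝ) := by
  have := integrable_rpow_neg_one_add_norm_sq (E := ℝ) (μ := MeasureTheory.volume)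
    (r := 3 / 2) (by norm_num)
  refine this.congr (Eventually.of_forall fun u => ?_)
  simp only [Real.norm_eq_abs, sq_abs]
  norm_num

lemma tendsto_one_add_sq_rpow {l : Filter ℝ} (hl : Tendsto (fun u : ℝ => u ^ 2) l atTop) :
    Tendsto (fun u : ℝ => (1 + u ^ 2) ^ (-(3 / 4) : ℝ)) l (nhds 0) :=
  (tendsto_rpow_neg_atTop (by norm_num)).comp (tendsto_atTop_add_const_left _ _ hl)

open MeasureTheory in
lemma integrable_vertical {f : ℂ → ℂ} {a K : ℝ}
    (hd : ∀ z : ℂ, z.re = a → DifferentiableAt ℂ f z)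
    (hf : ∀ z : ℂ, z.re = a → 1 ≤ |z.im| → ‖f z‖ ≤ K * (1 + z.im ^ 2) ^ (-(3 / 4) : ℝ)) :
    Integrable fun u : ℝ => f ((a : ℂ) + (u : ℂ) * Complex.I) := by
  have hcont : Continuous fun u : ℝ => f ((a : ℂ) + (u : ℂ) * Complex.I) := by
    rw [continuous_iff_continuousAt]
    intro u
    have h1 := (hd ((a : ℂ) + (u : ℂ) * Complex.I) (by simp)).continuousAt
    exact ContinuousAt.comp (f := fun u : ℝ => (a : ℂ) + (u : ℂ) * Complex.I) h1
      (by fun_prop)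
  refine hcont.locallyIntegrable.integrable_of_isBigO_cocompact
    (g := fun u : ℝ => (1 + u ^ 2) ^ (-(3 / 4) : ℝ)) ?_
    (integrable_one_add_sq_rpow.integrableAtFilter _)
  refine IsBigO.of_bound K ?_
  have h1 : ∀ᶠ u : ℝ in cocompact ℝ, 1 ≤ ‖u‖ :=
    tendsto_norm_cocompact_atTop.eventually_ge_atTop 1
  filter_upwards [h1] with u hu
  have h2 := hf ((a : ℂ) + (u : ℂ) * Complex.I) (by simp) (by simpa using hu)
  rw [Real.norm_of_nonneg (by positivity)]
  simpa using h2

open MeasureTheory in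
/-- Shifting the integral of a decaying holomorphic function between vertical lines. -/
lemma integral_vertical_eq {f : ℂ → ℂ} {a b K : ℝ} (hab : a ≤ b)
    (hd : ∀ z : ℂ, a ≤ z.re → z.re ≤ b → DifferentiableAt ℂ f z)
    (hf : ∀ z : ℂ, a ≤ z.re → z.re ≤ b → 1 ≤ |z.im| →
      ‖f z‖ ≤ K * (1 + z.im ^ 2) ^ (-(3 / 4) : ℝ)) :
    ∫ u : ℝ, f ((a : ℂ) + (u : ℂ) * Complex.I) = ∫ u : ℝ, f ((b : ℂ) + (u : ℂ) * Complex.I) := by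
  have hia := integrable_vertical (f := f) (a := a) (K := K)
    (fun z hz => hd z hz.ge (hz.le.trans hab)) (fun z hz => hf z hz.ge (hz.le.trans hab))
  have hib := integrable_vertical (f := f) (a := b) (K := K)
    (fun z hz => hd z (hab.trans hz.ge) hz.le) (fun z hz => hf z (hab.trans hz.ge) hz.le)
  have ha := intervalIntegral_tendsto_integral hia tendsto_neg_atTop_atBot tendsto_id
  have hb := intervalIntegral_tendsto_integral hib tendsto_neg_atTop_atBot tendsto_id
  have hhor : ∀ l : Filter ℝ, Tendsto (fun u : ℝ => u ^ 2) l atTop →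
      (∀ᶠ u in l, 1 ≤ |u|) →
      Tendsto (fun y : ℝ => ∫ x in a..b, f ((x : ℂ) + (y : ℂ) * Complex.I)) l (nhds 0) := by
    intro l hl hl1
    have h0 := ((tendsto_one_add_sq_rpow hl).const_mul K).mul_const |b - a|
    rw [mul_zero, zero_mul] at h0
    refine squeeze_zero_norm' ?_ h0
    filter_upwards [hl1] with y hy
    refine intervalIntegral.norm_integral_le_of_norm_le_const fun x hx => ?_
    rw [Set.uIoc_of_le hab] at hx
    simpa using hf ((x : ℂ) + (y : ℂ) * Complex.I) (by simpa using hx.1.le)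
      (by simpa using hx.2) (by simpa using hy)
  have hsq : Tendsto (fun u : ℝ => u ^ 2) atTop atTop := tendsto_pow_atTop two_ne_zero
  have htop := hhor atTop hsq
    ((eventually_ge_atTop 1).mono fun u hu => hu.trans (le_abs_self u))
  have hbot := (hhor atBot (by
      have := hsq.comp tendsto_neg_atBot_atTop
      simpa [Function.comp_def] using this)
    ((eventually_le_atBot (-1)).mono fun u hu => le_abs.mpr (Or.inr (by linarith)))).comp
      tendsto_neg_atTop_atBot
  have hrect : ∀ y : ℝ, 0 ≤ y →
      (∫ x in a..b, f ((x : ℂ) + ((-y : ℝ) : ℂ) * Complex.I)) -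
      (∫ x in a..b, f ((x : ℂ) + (y : ℂ) * Complex.I)) +
      Complex.I • (∫ u in (-y)..y, f ((b : ℂ) + (u : ℂ) * Complex.I)) -
      Complex.I • (∫ u in (-y)..y, f ((a : ℂ) + (u : ℂ) * Complex.I)) = 0 := by
    intro y hy
    have := Complex.integral_boundary_rect_eq_zero_of_differentiableOn f ⟨a, -y⟩ ⟨b, y⟩
      (fun z hz => by
        rw [Complex.mem_reProdIm] at hz
        simp only at hz
        rw [Set.uIcc_of_le hab] at hz
        exact (hd z hz.1.1 hz.1.2).differentiableWithinAt)
    simpa using this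
  have hlim := ((hbot.sub htop).add (hb.const_smul Complex.I)).sub (ha.const_smul Complex.I)
  have hzero := tendsto_nhds_unique (hlim.congr' ?_) (tendsto_const_nhds (x := (0 : ℂ)))
  · rw [sub_zero, zero_add, ← smul_sub, smul_eq_zero] at hzero
    rcases hzero with h0 | h0
    · exact absurd h0 Complex.I_ne_zero
    · exact (sub_eq_zero.mp h0).symm
  · filter_upwards [eventually_ge_atTop (0 : ℝ)] with y hy
    simpa using hrect y hy

lemma norm_perronKernel_le_of_ne_zero {w : ℂ} (h0 : w.re ≠ 0) (h1 : -(1 / 2) ≤ w.re) :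
    ‖perronKernel w‖ ≤ 2 * (1 + (w.re ^ 2)⁻¹) * (1 + w.im ^ 2)⁻¹ := by
  have hx : 0 < w.re ^ 2 := by positivity
  have hinv : (w.re ^ 2)⁻¹ * w.re ^ 2 = 1 := inv_mul_cancel₀ hx.ne'
  set x2 := (w.re ^ 2)⁻¹
  have hx2 : 0 < x2 := inv_pos.mpr hx
  have e1 : 1 + w.im ^ 2 ≤ (1 + x2) ^ 2 * ‖w‖ ^ 2 := by
    rw [Complex.sq_norm, Complex.normSq_apply]
    have : 0 ≤ x2 * w.im ^ 2 := by positivity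
    have h3 : 1 + w.im ^ 2 ≤ (1 + x2) * (w.re * w.re + w.im * w.im) := by nlinarith
    have h4 : 0 ≤ w.re * w.re + w.im * w.im := by nlinarith [mul_self_nonneg w.re, mul_self_nonneg w.im]
    have h5 : (1 + x2) * (w.re * w.re + w.im * w.im) ≤
        (1 + x2) ^ 2 * (w.re * w.re + w.im * w.im) := by
      refine mul_le_mul_of_nonneg_right ?_ h4
      nlinarith
    linarith
  have e2 : 1 + w.im ^ 2 ≤ 4 * ‖w + 1‖ ^ 2 := by
    rw [Complex.sq_norm, Complex.normSq_apply]
    simp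
    nlinarith [mul_self_nonneg w.im]
  have hp : 0 < 1 + w.im ^ 2 := by positivity
  have h3 : 1 + w.im ^ 2 ≤ 2 * (1 + x2) * (‖w‖ * ‖w + 1‖) := by
    have := mul_le_mul e1 e2 hp.le (by positivity)
    have h4 : (1 + w.im ^ 2) ^ 2 ≤ (2 * (1 + x2) * (‖w‖ * ‖w + 1‖)) ^ 2 := by
      calc _ = (1 + w.im ^ 2) * (1 + w.im ^ 2) := by ring
        _ ≤ _ := this
        _ = _ := by ring
    exact (pow_le_pow_iff_left₀ hp.le (by positivity) two_ne_zero).mp h4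
  rw [perronKernel, norm_div, norm_one, norm_mul, ← div_eq_mul_inv]
  have hpos : 0 < ‖w‖ * ‖w + 1‖ := by
    by_contra hc
    have : ‖w‖ * ‖w + 1‖ = 0 := le_antisymm (not_lt.mp hc) (by positivity)
    rw [this, mul_zero] at h3
    linarith
  rwa [div_le_div_iff₀ hpos hp, one_mul]

lemma norm_perronKernel_le_of_one_le_im {w : ℂ} (h1 : 1 ≤ |w.im|) :
    ‖perronKernel w‖ ≤ 2 * (1 + w.im ^ 2)⁻¹ := by
  have e1 := Complex.abs_im_le_norm w
  have e2 : |w.im| ≤ ‖w + 1‖ := by simpa using Complex.abs_im_le_norm (w + 1)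
  have h3 : |w.im| * |w.im| ≤ ‖w‖ * ‖w + 1‖ := mul_le_mul e1 e2 (abs_nonneg _) (norm_nonneg _)
  have h4 : |w.im| * |w.im| = w.im ^ 2 := by rw [← sq, sq_abs]
  rw [perronKernel, norm_div, norm_one, norm_mul, ← div_eq_mul_inv]
  rw [div_le_div_iff₀ (by nlinarith) (by positivity)]
  nlinarith

lemma one_add_abs_rpow_half_le (u : ℝ) : (1 + |u|) ^ (1 / 2 : ℝ) ≤ 2 * (1 + u ^ 2) ^ (1 / 4 : ℝ) := by
  have h0 := abs_nonneg u
  have h1 : (1 + |u|) ^ (1 / 2 : ℝ) = ((1 + |u|) ^ 2) ^ (1 / 4 : ℝ) := by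
    rw [← Real.rpow_natCast, ← Real.rpow_mul (by positivity)]; norm_num
  have h2 : (1 + |u|) ^ 2 ≤ 16 * (1 + u ^ 2) := by
    nlinarith [sq_nonneg (|u| - 1), sq_abs u]
  have h3 : (16 : ℝ) ^ (1 / 4 : ℝ) = 2 := by
    rw [show (16 : ℝ) = 2 ^ (4 : ℝ) by norm_num, ← Real.rpow_mul (by norm_num)]; norm_num
  rw [h1, ← h3, ← Real.mul_rpow (by norm_num) (by positivity)]
  exact Real.rpow_le_rpow (by positivity) h2 (by norm_num)

lemma one_add_sq_rpow_mul_inv (u : ℝ) :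
    (1 + u ^ 2) ^ (1 / 4 : ℝ) * (1 + u ^ 2)⁻¹ = (1 + u ^ 2) ^ (-(3 / 4) : ℝ) := by
  have h : 0 < 1 + u ^ 2 := by positivity
  rw [← Real.rpow_neg_one, ← Real.rpow_add h]; norm_num

open MeasureTheory in
/-- An integral against the Perron kernel over a vertical line. -/
lemma norm_integral_mul_perronKernel_le {c : ℝ} (h0 : c ≠ 0) (h1 : -(1 / 2) ≤ c) :
    ∃ K : ℝ, 0 ≤ K ∧ ∀ (f : ℂ → ℂ) (Y Q : ℝ), 0 < Y → 0 ≤ Q →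
      (∀ z : ℂ, z.re = c → ‖f z‖ ≤ Q * (1 + z.im ^ 2) ^ (1 / 4 : ℝ)) →
      ‖∫ u : ℝ, f ((c : ℂ) + (u : ℂ) * Complex.I) * ((Y : ℂ) ^ ((c : ℂ) + (u : ℂ) * Complex.I) *
        perronKernel ((c : ℂ) + (u : ℂ) * Complex.I))‖ ≤ K * (Q * Y ^ c) := by
  set κ : ℝ := 2 * (1 + (c ^ 2)⁻¹) with hκ
  have hκ0 : 0 ≤ κ := by positivity
  refine ⟨κ * ∫ u : ℝ, (1 + u ^ 2) ^ (-(3 / 4) : ℝ),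
    mul_nonneg hκ0 (integral_nonneg fun u => by positivity), fun f Y Q hY hQ hf => ?_⟩
  have hYc : 0 ≤ Y ^ c := Real.rpow_nonneg hY.le _
  have hb : ∀ u : ℝ, ‖f ((c : ℂ) + (u : ℂ) * Complex.I) *
      ((Y : ℂ) ^ ((c : ℂ) + (u : ℂ) * Complex.I) *
        perronKernel ((c : ℂ) + (u : ℂ) * Complex.I))‖ ≤
      κ * (Q * Y ^ c) * (1 + u ^ 2) ^ (-(3 / 4) : ℝ) := by
    intro u
    have e1 := hf ((c : ℂ) + (u : ℂ) * Complex.I) (by simp)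
    have e2 := norm_perronKernel_le_of_ne_zero (w := (c : ℂ) + (u : ℂ) * Complex.I)
      (by simpa using h0) (by simpa using h1)
    simp only [Complex.add_re, Complex.ofReal_re, Complex.mul_re, Complex.I_re, mul_zero,
      Complex.ofReal_im, Complex.I_im, mul_one, sub_self, add_zero, Complex.add_im,
      Complex.mul_im, zero_add] at e1 e2
    rw [norm_mul, norm_mul, Complex.norm_cpow_eq_rpow_re_of_pos hY]
    simp only [Complex.add_re, Complex.ofReal_re, Complex.mul_re, Complex.I_re, mul_zero,
      Complex.ofReal_im, Complex.I_im, mul_one, sub_self, add_zero]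
    calc _ ≤ Q * (1 + u ^ 2) ^ (1 / 4 : ℝ) * (Y ^ c * (κ * (1 + u ^ 2)⁻¹)) := by
          refine mul_le_mul e1 (mul_le_mul_of_nonneg_left e2 hYc) (by positivity) (by positivity)
      _ = κ * (Q * Y ^ c) * ((1 + u ^ 2) ^ (1 / 4 : ℝ) * (1 + u ^ 2)⁻¹) := by ring
      _ = _ := by rw [one_add_sq_rpow_mul_inv]
  refine (norm_integral_le_of_norm_le (integrable_one_add_sq_rpow.const_mul (κ * (Q * Y ^ c)))
    (Eventually.of_forall hb)).trans (le_of_eq ?_)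
  rw [integral_const_mul]; ring

lemma norm_mul_perronKernel_le {z v : ℂ} {Y Q x : ℝ} (hY : 1 ≤ Y) (hz : z.re ≤ x)
    (h1 : 1 ≤ |z.im|) (hv : ‖v‖ ≤ Q * (1 + z.im ^ 2) ^ (1 / 4 : ℝ)) :
    ‖v * ((Y : ℂ) ^ z * perronKernel z)‖ ≤
      2 * (Q * Y ^ x) * (1 + z.im ^ 2) ^ (-(3 / 4) : ℝ) := by
  have hY0 : 0 < Y := by linarith
  rw [norm_mul, norm_mul, Complex.norm_cpow_eq_rpow_re_of_pos hY0]
  have e1 : Y ^ z.re ≤ Y ^ x := Real.rpow_le_rpow_of_exponent_le hY hz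
  have e0 : 0 ≤ Y ^ z.re := Real.rpow_nonneg hY0.le _
  have hq : 0 ≤ Q * (1 + z.im ^ 2) ^ (1 / 4 : ℝ) := (norm_nonneg _).trans hv
  calc _ ≤ Q * (1 + z.im ^ 2) ^ (1 / 4 : ℝ) * (Y ^ x * (2 * (1 + z.im ^ 2)⁻¹)) :=
        mul_le_mul hv (mul_le_mul e1 (norm_perronKernel_le_of_one_le_im h1) (norm_nonneg _)
          (e0.trans e1)) (by positivity) hq
    _ = 2 * (Q * Y ^ x) * ((1 + z.im ^ 2) ^ (1 / 4 : ℝ) * (1 + z.im ^ 2)⁻¹) := by ring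
    _ = _ := by rw [one_add_sq_rpow_mul_inv]

lemma differentiableAt_cpow_mul_perronKernel {Y : ℝ} (hY : 0 < Y) {z : ℂ} (h0 : z ≠ 0)
    (h1 : -1 < z.re) : DifferentiableAt ℂ (fun z => (Y : ℂ) ^ z * perronKernel z) z := by
  have hY' : (Y : ℂ) ≠ 0 := by exact_mod_cast hY.ne'
  have h2 : z + 1 ≠ 0 := by
    intro h; have := congrArg Complex.re h; simp at this; linarith
  refine DifferentiableAt.mul ?_ ?_
  · exact differentiableAt_id.const_cpow (Or.inl hY')
  · unfold perronKernel
    exact (differentiableAt_const _).div (by fun_prop) (mul_ne_zero h0 h2)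

namespace BeurlingSystem

variable (S : BeurlingSystem)

lemma div_val_cpow {Y : ℝ} (hY : 0 < Y) (k : ℕ →₀ ℕ) (z : ℂ) :
    ((Y / S.val k : ℝ) : ℂ) ^ z = (S.val k : ℂ) ^ (-z) * (Y : ℂ) ^ z := by
  have hn := S.val_pos k
  rw [div_eq_mul_inv, Complex.ofReal_mul, Complex.mul_cpow_ofReal_nonneg hY.le (by positivity),
    Complex.ofReal_inv, Complex.inv_cpow _ _
      (by rw [Complex.arg_ofReal_of_nonneg hn.le]; exact Real.pi_pos.ne), Complex.cpow_neg,
    mul_comm]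

open MeasureTheory in
/-- Perron's formula for generalized Dirichlet series with the Riesz weight. -/
theorem integral_mul_perronKernel_eq_sum {c Y : ℝ} (hc : 0 < c) (hY : 0 < Y)
    (b : (ℕ →₀ ℕ) → ℂ) (G : ℂ → ℂ)
    (hG : ∀ z : ℂ, z.re = c → HasSum (fun k => b k * (S.val k : ℂ) ^ (-z)) (G z))
    (hs : Summable fun k => ‖b k‖ * S.val k ^ (-c)) :
    ∫ u : ℝ, G ((c : ℂ) + (u : ℂ) * Complex.I) * ((Y : ℂ) ^ ((c : ℂ) + (u : ℂ) * Complex.I) *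
        perronKernel ((c : ℂ) + (u : ℂ) * Complex.I)) =
      2 * Real.pi * ∑ k ∈ S.upTo Y, b k * rieszWeight (Y / S.val k) := by
  set F : (ℕ →₀ ℕ) → ℝ → ℂ := fun k u =>
    b k * (((Y / S.val k : ℝ) : ℂ) ^ ((c : ℂ) + (u : ℂ) * Complex.I) *
      perronKernel ((c : ℂ) + (u : ℂ) * Complex.I)) with hF
  have hpos : ∀ k, 0 < Y / S.val k := fun k => div_pos hY (S.val_pos k)
  have hnorm : ∀ k u, ‖F k u‖ = ‖b k‖ * S.val k ^ (-c) * Y ^ c *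
      ‖perronKernel ((c : ℂ) + (u : ℂ) * Complex.I)‖ := by
    intro k u
    simp only [hF]
    rw [norm_mul, norm_mul, Complex.norm_cpow_eq_rpow_re_of_pos (hpos k), Real.rpow_neg
      (S.val_pos k).le]
    simp only [Complex.add_re, Complex.ofReal_re, Complex.mul_re, Complex.I_re, mul_zero,
      Complex.ofReal_im, Complex.I_im, mul_one, sub_self, add_zero]
    rw [Real.div_rpow hY.le (S.val_pos k).le]
    ring
  have hint : ∀ k, Integrable (F k) := by
    intro k
    have h1 : Continuous (F k) := by
      simp only [hF]
      refine continuous_const.mul (Continuous.mul ?_ (continuous_perronKernel_line hc))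
      exact Continuous.const_cpow (by fun_prop) (Or.inl (by exact_mod_cast (hpos k).ne'))
    refine ((integrable_perronKernel_line hc).norm.const_mul
      (‖b k‖ * S.val k ^ (-c) * Y ^ c)).mono' h1.aestronglyMeasurable
      (Eventually.of_forall fun u => (hnorm k u).le)
  have hsum : Summable fun k => ∫ u : ℝ, ‖F k u‖ := by
    simp only [hnorm, integral_const_mul]
    exact (hs.mul_right _).mul_right _
  have hmain := hasSum_integral_of_summable_integral_norm hint hsum
  have h1 : ∀ u : ℝ, ∑' k, F k u = G ((c : ℂ) + (u : ℂ) * Complex.I) *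
      ((Y : ℂ) ^ ((c : ℂ) + (u : ℂ) * Complex.I) *
        perronKernel ((c : ℂ) + (u : ℂ) * Complex.I)) := by
    intro u
    have h2 := (hG ((c : ℂ) + (u : ℂ) * Complex.I) (by simp)).mul_right
      ((Y : ℂ) ^ ((c : ℂ) + (u : ℂ) * Complex.I) *
        perronKernel ((c : ℂ) + (u : ℂ) * Complex.I))
    rw [← h2.tsum_eq]
    refine tsum_congr fun k => ?_
    simp only [hF]
    rw [S.div_val_cpow hY]
    ring
  have h2 : ∀ k, ∫ u, F k u = 2 * Real.pi * (b k * rieszWeight (Y / S.val k)) := by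
    intro k
    simp only [hF]
    rw [integral_const_mul, integral_cpow_perronKernel hc (hpos k)]
    ring
  simp only [h1, h2] at hmain
  have h3 : HasSum (fun k => 2 * (Real.pi : ℂ) * (b k * (rieszWeight (Y / S.val k) : ℂ)))
      (∑ k ∈ S.upTo Y, 2 * (Real.pi : ℂ) * (b k * (rieszWeight (Y / S.val k) : ℂ))) := by
    refine hasSum_sum_of_ne_finset_zero fun k hk => ?_
    rw [S.mem_upTo, not_le] at hk
    rw [rieszWeight_eq_zero (hpos k) ((div_le_one (S.val_pos k)).mpr hk.le)]
    simp
  rw [hmain.unique h3, Finset.mul_sum]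

end BeurlingSystem

namespace BeurlingSystem.Counting

variable {S : BeurlingSystem} {θ A C : ℝ} {Z : ℂ → ℂ}

lemma norm_zetaRegular_add_le_weight {K B : ℝ} (hK : 0 ≤ K) (hB : 0 < B) (hB1 : B ≤ 1 / 2)
    (hE : ∀ s : ℂ, (1 + θ) / 2 ≤ s.re → ‖zetaRegular Z A s‖ ≤ K * (1 + |s.im|) ^ B)
    {s z : ℂ} (hs : (1 + θ) / 2 ≤ s.re + z.re) :
    ‖zetaRegular Z A (s + z)‖ ≤ 2 * K * (1 + |s.im|) ^ B * (1 + z.im ^ 2) ^ (1 / 4 : ℝ) := by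
  have hv := abs_nonneg z.im
  have hsi := abs_nonneg s.im
  have h1 : (1 + |(s + z).im|) ^ B ≤ (1 + |s.im|) ^ B * (2 * (1 + z.im ^ 2) ^ (1 / 4 : ℝ)) := by
    have h2 : 1 + |(s + z).im| ≤ (1 + |s.im|) * (1 + |z.im|) := by
      have := abs_add_le s.im z.im
      rw [Complex.add_im]
      nlinarith
    calc (1 + |(s + z).im|) ^ B ≤ ((1 + |s.im|) * (1 + |z.im|)) ^ B :=
          Real.rpow_le_rpow (by positivity) h2 hB.le
      _ = (1 + |s.im|) ^ B * (1 + |z.im|) ^ B := Real.mul_rpow (by positivity) (by positivity)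
      _ ≤ _ := by
          refine mul_le_mul_of_nonneg_left ?_ (by positivity)
          exact (Real.rpow_le_rpow_of_exponent_le (by linarith) hB1).trans
            (one_add_abs_rpow_half_le _)
  calc _ ≤ K * (1 + |(s + z).im|) ^ B := hE _ (by simpa using hs)
    _ ≤ K * ((1 + |s.im|) ^ B * (2 * (1 + z.im ^ 2) ^ (1 / 4 : ℝ))) :=
        mul_le_mul_of_nonneg_left h1 hK
    _ = _ := by ring

lemma norm_pole_le (hA : 0 < A) {s z : ℂ} (hs : 2 ≤ s.re + z.re) (h0 : s.im ≠ 0) :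
    ‖(A : ℂ) / (s + z - 1)‖ ≤
      2 * A * |s.im| ^ (-(1 / 2) : ℝ) * (1 + z.im ^ 2) ^ (1 / 4 : ℝ) := by
  have hp : 0 < |s.im| := abs_pos.mpr h0
  have hv := abs_nonneg z.im
  set n := ‖s + z - 1‖ with hn
  have hn1 : 1 ≤ n := by
    have := Complex.re_le_norm (s + z - 1)
    simp only [Complex.add_re, Complex.sub_re, Complex.one_re] at this
    linarith
  have hn2 : |s.im + z.im| ≤ n := by
    have := Complex.abs_im_le_norm (s + z - 1)
    simpa using this
  have h1 : |s.im| ≤ n * (1 + |z.im|) := by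
    have : |s.im| ≤ |s.im + z.im| + |z.im| := by
      have := abs_sub (s.im + z.im) z.im
      simpa using this
    nlinarith
  have h2 : |s.im| ^ (1 / 2 : ℝ) ≤ n * (2 * (1 + z.im ^ 2) ^ (1 / 4 : ℝ)) := by
    calc _ ≤ (n * (1 + |z.im|)) ^ (1 / 2 : ℝ) := Real.rpow_le_rpow hp.le h1 (by norm_num)
      _ = n ^ (1 / 2 : ℝ) * (1 + |z.im|) ^ (1 / 2 : ℝ) :=
          Real.mul_rpow (by positivity) (by positivity)
      _ ≤ n ^ (1 : ℝ) * (2 * (1 + z.im ^ 2) ^ (1 / 4 : ℝ)) :=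
          mul_le_mul (Real.rpow_le_rpow_of_exponent_le hn1 (by norm_num))
            (one_add_abs_rpow_half_le _) (by positivity) (by positivity)
      _ = _ := by rw [Real.rpow_one]
  rw [norm_div, Complex.norm_real, Real.norm_of_nonneg hA.le, Real.rpow_neg hp.le,
    div_le_iff₀ (by linarith)]
  have h3 : 0 < |s.im| ^ (1 / 2 : ℝ) := Real.rpow_pos_of_pos hp _
  have h4 : 1 ≤ (|s.im| ^ (1 / 2 : ℝ))⁻¹ * (n * (2 * (1 + z.im ^ 2) ^ (1 / 4 : ℝ))) := by
    have h5 := mul_le_mul_of_nonneg_left h2 (inv_pos.mpr h3).le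
    rwa [inv_mul_cancel₀ h3.ne'] at h5
  calc A ≤ A * ((|s.im| ^ (1 / 2 : ℝ))⁻¹ * (n * (2 * (1 + z.im ^ 2) ^ (1 / 4 : ℝ)))) :=
        le_mul_of_one_le_right hA.le h4
    _ = _ := by ring

set_option maxHeartbeats 1000000 in
open MeasureTheory in
/-- Smoothed partial sums of the Beurling zeta function to the right of `(1 + θ) / 2`. -/
theorem exists_norm_weighted_sum_le (h : S.Counting θ A C) (hZ : S.IsZeta θ A Z)
    (hlin : ∀ B > (0:ℝ), ∃ CB : ℝ, ∀ t : ℝ,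
      ‖Z ((((1 + θ) / 2 : ℝ) : ℂ) + Complex.I * (t : ℂ))‖ ≤ CB * (1 + |t|) ^ B)
    {c B : ℝ} (hc : 0 < c) (hc2 : c ≤ 2) (hB : 0 < B) (hB1 : B ≤ 1 / 2) :
    ∃ K : ℝ, 0 ≤ K ∧ ∀ (s : ℂ) (Y : ℝ), 1 ≤ Y → (1 + θ) / 2 ≤ s.re → s.im ≠ 0 →
      ‖∑ k ∈ S.upTo Y, (S.val k : ℂ) ^ (-s) * rieszWeight (Y / S.val k)‖ ≤
        K * ((1 + |s.im|) ^ B * Y ^ c + |s.im| ^ (-(1 / 2) : ℝ) * Y ^ (2 : ℝ)) := by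
  have hA := h.density_pos
  have hθ0 := h.theta_nonneg
  have hθ1 := h.theta_lt
  obtain ⟨KE, hKE, hE⟩ := h.zetaRegular_lindelof hZ hlin hB
  obtain ⟨K1, hK1, hI1⟩ := norm_integral_mul_perronKernel_le hc.ne' (by linarith)
  obtain ⟨K2, hK2, hI2⟩ := norm_integral_mul_perronKernel_le (c := 2) (by norm_num) (by norm_num)
  refine ⟨K1 * (2 * KE) + K2 * (2 * A), by positivity, fun s Y hY hs h0 => ?_⟩
  have hY0 : 0 < Y := by linarith
  set Q1 : ℝ := 2 * KE * (1 + |s.im|) ^ B with hQ1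
  set Q2 : ℝ := 2 * A * |s.im| ^ (-(1 / 2) : ℝ) with hQ2
  have hEz : ∀ z : ℂ, 0 < z.re →
      ‖zetaRegular Z A (s + z)‖ ≤ Q1 * (1 + z.im ^ 2) ^ (1 / 4 : ℝ) := fun z hz =>
    norm_zetaRegular_add_le_weight hKE hB hB1 hE (by linarith)
  have hPz : ∀ z : ℂ, z.re = 2 →
      ‖(A : ℂ) / (s + z - 1)‖ ≤ Q2 * (1 + z.im ^ 2) ^ (1 / 4 : ℝ) := fun z hz =>
    norm_pole_le hA (by linarith) h0
  have hne : ∀ z : ℂ, z.re = 2 → s + z - 1 ≠ 0 := fun z hz h1 => by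
    have := congrArg Complex.re h1
    simp at this
    linarith
  have hk : ∀ z : ℂ, 0 < z.re →
      DifferentiableAt ℂ (fun z => (Y : ℂ) ^ z * perronKernel z) z := fun z hz =>
    differentiableAt_cpow_mul_perronKernel hY0 (fun h1 => by simp [h1] at hz) (by linarith)
  set fE : ℂ → ℂ := fun z => zetaRegular Z A (s + z) * ((Y : ℂ) ^ z * perronKernel z) with hfE
  set fP : ℂ → ℂ := fun z => (A : ℂ) / (s + z - 1) * ((Y : ℂ) ^ z * perronKernel z) with hfP
  have hdE : ∀ z : ℂ, c ≤ z.re → z.re ≤ 2 → DifferentiableAt ℂ fE z := by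
    intro z hz _
    refine DifferentiableAt.mul ?_ (hk z (by linarith))
    exact (differentiableAt_zetaRegular (S := S) (θ := θ) hZ (s := s + z)
      (by simp; linarith)).comp z ((differentiableAt_const s).add differentiableAt_id)
  have hbE : ∀ z : ℂ, c ≤ z.re → z.re ≤ 2 → 1 ≤ |z.im| →
      ‖fE z‖ ≤ 2 * (Q1 * Y ^ (2 : ℝ)) * (1 + z.im ^ 2) ^ (-(3 / 4) : ℝ) :=
    fun z hz hz2 hz1 => norm_mul_perronKernel_le hY hz2 hz1 (hEz z (by linarith))
  have hdP : ∀ z : ℂ, z.re = 2 → DifferentiableAt ℂ fP z := by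
    intro z hz
    refine DifferentiableAt.mul ?_ (hk z (by linarith))
    exact (differentiableAt_const _).div (by fun_prop) (hne z hz)
  have hbP : ∀ z : ℂ, z.re = 2 → 1 ≤ |z.im| →
      ‖fP z‖ ≤ 2 * (Q2 * Y ^ (2 : ℝ)) * (1 + z.im ^ 2) ^ (-(3 / 4) : ℝ) :=
    fun z hz hz1 => norm_mul_perronKernel_le hY hz.le hz1 (hPz z hz)
  have hshift := integral_vertical_eq hc2 hdE hbE
  have hiE := integrable_vertical (f := fE) (a := 2) (fun z hz => hdE z (by linarith) hz.le)
    (fun z hz => hbE z (by linarith) hz.le)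
  have hiP := integrable_vertical (f := fP) (a := 2) hdP hbP
  have hperron := S.integral_mul_perronKernel_eq_sum (c := 2) (Y := Y) two_pos hY0
    (fun k => (S.val k : ℂ) ^ (-s)) (fun z => Z (s + z)) (fun z hz => by
      have h1 := h.hasSum_val_cpow hZ (s := s + z) (by simp; linarith)
      refine h1.congr_fun fun k => ?_
      rw [← Complex.cpow_add _ _ (val_ne_zero S k), neg_add]) (by
      have h1 := h.summable_val_rpow (a := s.re + 2) (by linarith)
      refine h1.congr fun k => ?_
      rw [norm_val_cpow, ← Real.rpow_add (S.val_pos k), Complex.neg_re, neg_add])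
  have hsplit : ∀ u : ℝ, Z (s + (((2 : ℝ) : ℂ) + (u : ℂ) * Complex.I)) *
      ((Y : ℂ) ^ (((2 : ℝ) : ℂ) + (u : ℂ) * Complex.I) *
        perronKernel (((2 : ℝ) : ℂ) + (u : ℂ) * Complex.I)) =
      fE (((2 : ℝ) : ℂ) + (u : ℂ) * Complex.I) + fP (((2 : ℝ) : ℂ) + (u : ℂ) * Complex.I) := by
    intro u
    simp only [hfE, hfP, zetaRegular]
    ring
  simp only [hsplit] at hperron
  rw [integral_add hiE hiP, ← hshift] at hperron
  have hb1 := hI1 (fun z => zetaRegular Z A (s + z)) Y Q1 hY0 (by positivity)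
    (fun z hz => hEz z (by linarith))
  have hb2 := hI2 (fun z => (A : ℂ) / (s + z - 1)) Y Q2 hY0 (by positivity) hPz
  have hfin : ‖2 * (Real.pi : ℂ) * ∑ k ∈ S.upTo Y, (S.val k : ℂ) ^ (-s) *
      rieszWeight (Y / S.val k)‖ ≤ K1 * (Q1 * Y ^ c) + K2 * (Q2 * Y ^ (2 : ℝ)) := by
    rw [← hperron]
    exact (norm_add_le _ _).trans (add_le_add hb1 hb2)
  have hpi : 1 ≤ ‖2 * (Real.pi : ℂ)‖ := by
    rw [norm_mul, Complex.norm_real, Real.norm_of_nonneg Real.pi_pos.le]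
    have := Real.pi_gt_three
    simp; linarith
  rw [norm_mul] at hfin
  refine (le_mul_of_one_le_left (norm_nonneg _) hpi).trans (hfin.trans ?_)
  simp only [hQ1, hQ2]
  have e1 : 0 ≤ (1 + |s.im|) ^ B * Y ^ c := by positivity
  have e2 : 0 ≤ |s.im| ^ (-(1 / 2) : ℝ) * Y ^ (2 : ℝ) := by positivity
  have e3 := mul_nonneg (mul_nonneg hK1 hKE) e2
  have e4 := mul_nonneg (mul_nonneg hK2 hA.le) e1
  nlinarith

set_option maxHeartbeats 1000000 in
open MeasureTheory in
/-- The smoothed partial sums of `ζ M` are small at the zeros of `ζ` to the right of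
`(3 + θ) / 4`. -/
theorem exists_norm_mollified_sum_le (h : S.Counting θ A C) (hZ : S.IsZeta θ A Z)
    (hlin : ∀ B > (0:ℝ), ∃ CB : ℝ, ∀ t : ℝ,
      ‖Z ((((1 + θ) / 2 : ℝ) : ℂ) + Complex.I * (t : ℂ))‖ ≤ CB * (1 + |t|) ^ B)
    {B : ℝ} (hB : 0 < B) (hB1 : B ≤ 1 / 2) :
    ∃ K : ℝ, 0 ≤ K ∧ ∀ (ρ : ℂ) (X Y : ℝ), 1 ≤ X → 1 ≤ Y → Z ρ = 0 → (3 + θ) / 4 ≤ ρ.re →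
      1 ≤ |ρ.im| →
      ‖∑ k ∈ S.upTo Y, (S.mollCoeff X k : ℂ) * (S.val k : ℂ) ^ (-ρ) *
          rieszWeight (Y / S.val k)‖ ≤
        K * X * ((1 + |ρ.im|) ^ B * Y ^ (-((1 - θ) / 4)) +
          |ρ.im| ^ (-(1 / 2) : ℝ) * Y ^ (2 : ℝ)) := by
  have hA := h.density_pos
  have hC := h.const_nonneg
  have hθ0 := h.theta_nonneg
  have hθ1 := h.theta_lt
  set q : ℝ := (1 - θ) / 4 with hq
  have hq0 : 0 < q := by simp only [hq]; linarith
  have hq1 : q ≤ 1 / 4 := by simp only [hq]; linarith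
  obtain ⟨KE, hKE, hE⟩ := h.zetaRegular_lindelof hZ hlin hB
  obtain ⟨K1, hK1, hI1⟩ := norm_integral_mul_perronKernel_le (c := -q) (by linarith) (by linarith)
  obtain ⟨K2, hK2, hI2⟩ := norm_integral_mul_perronKernel_le (c := 2) (by norm_num) (by norm_num)
  refine ⟨K1 * (4 * KE * (A + C)) + (2 * Real.pi * (A * (A + C)) + K2 * (2 * A * (A + C))),
    by positivity, fun ρ X Y hX hY hρ hre him => ?_⟩
  have hY0 : 0 < Y := by linarith
  have hX0 : 0 < X := by linarith
  have him0 : ρ.im ≠ 0 := fun h0 => by rw [h0, abs_zero] at him; linarith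
  have hqρ : (1 + θ) / 2 ≤ ρ.re - q := by simp only [hq]; linarith
  set F : ℂ → ℂ := fun w => zetaRegular Z A (ρ + w) * S.mollifier X (ρ + w) with hF
  set QF : ℝ := 2 * KE * (1 + |ρ.im|) ^ B * ((A + C) * X) with hQF
  have hQF0 : 0 ≤ QF := by positivity
  set Q2 : ℝ := 2 * A * |ρ.im| ^ (-(1 / 2) : ℝ) * ((A + C) * X) with hQ2
  have hQ20 : 0 ≤ Q2 := by positivity
  have hM : ∀ z : ℂ, -q ≤ z.re → ‖S.mollifier X (ρ + z)‖ ≤ (A + C) * X := fun z hz =>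
    h.norm_mollifier_le hX (by simp; linarith)
  have hFz : ∀ z : ℂ, -q ≤ z.re → ‖F z‖ ≤ QF * (1 + z.im ^ 2) ^ (1 / 4 : ℝ) := by
    intro z hz
    have h1 := norm_zetaRegular_add_le_weight hKE hB hB1 hE (s := ρ) (z := z) (by linarith)
    simp only [hF]
    rw [norm_mul]
    refine (mul_le_mul h1 (hM z hz) (norm_nonneg _) (by positivity)).trans (le_of_eq ?_)
    simp only [hQF]; ring
  have hone : ∀ z : ℂ, 1 ≤ (1 + z.im ^ 2) ^ (1 / 4 : ℝ) := fun z =>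
    Real.one_le_rpow (by nlinarith [sq_nonneg z.im]) (by norm_num)
  have hF0 : ‖F 0‖ ≤ QF := by
    have := hFz 0 (by simp; linarith)
    simpa using this
  have hF0' : ‖F 0‖ ≤ A * (A + C) * X * |ρ.im| ^ (-(1 / 2) : ℝ) := by
    have h1 := hM 0 (by simp; linarith)
    have h2 : ‖zetaRegular Z A ρ‖ ≤ A * |ρ.im| ^ (-(1 / 2) : ℝ) := by
      have h3 : |ρ.im| ≤ ‖ρ - 1‖ := by simpa using Complex.abs_im_le_norm (ρ - 1)
      rw [zetaRegular, hρ, zero_sub, norm_neg, norm_div, Complex.norm_real,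
        Real.norm_of_nonneg hA.le]
      have hp : 0 < |ρ.im| := by linarith
      calc A / ‖ρ - 1‖ ≤ A / |ρ.im| := div_le_div_of_nonneg_left hA.le hp h3
        _ = A * |ρ.im| ^ (-1 : ℝ) := by rw [Real.rpow_neg_one, div_eq_mul_inv]
        _ ≤ _ := mul_le_mul_of_nonneg_left
            (Real.rpow_le_rpow_of_exponent_le him (by norm_num)) hA.le
    simp only [hF]
    rw [norm_mul]
    rw [add_zero] at h1 ⊢
    refine (mul_le_mul h2 h1 (norm_nonneg _) (by positivity)).trans (le_of_eq ?_)
    ring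
  have hFF : ∀ z : ℂ, -q ≤ z.re → ‖F z - F 0‖ ≤ 2 * QF * (1 + z.im ^ 2) ^ (1 / 4 : ℝ) := by
    intro z hz
    refine (norm_sub_le _ _).trans ?_
    have := mul_le_mul_of_nonneg_left (hone z) hQF0
    linarith [hFz z hz]
  have hdF : DifferentiableOn ℂ F {z : ℂ | θ - ρ.re < z.re} := by
    intro z hz
    have hz' : θ - ρ.re < z.re := hz
    refine DifferentiableAt.differentiableWithinAt (DifferentiableAt.mul ?_ ?_)
    · exact (differentiableAt_zetaRegular (S := S) (θ := θ) hZ (s := ρ + z)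
        (by simp; linarith)).comp z ((differentiableAt_const ρ).add differentiableAt_id)
    · exact (S.differentiable_mollifier X _).comp z
        ((differentiableAt_const ρ).add differentiableAt_id)
  have hopen : IsOpen {z : ℂ | θ - ρ.re < z.re} := isOpen_lt continuous_const Complex.continuous_re
  have hmem : ∀ z : ℂ, -q ≤ z.re → {z : ℂ | θ - ρ.re < z.re} ∈ nhds z := fun z hz =>
    hopen.mem_nhds (show θ - ρ.re < z.re by linarith)
  have hds := (Complex.differentiableOn_dslope (hmem 0 (by simp; linarith))).mpr hdF
  set P : ℂ → ℂ := fun z => dslope F 0 z * ((Y : ℂ) ^ z / (z + 1)) with hP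
  have hPeq : ∀ z : ℂ, z ≠ 0 → P z = (F z - F 0) * ((Y : ℂ) ^ z * perronKernel z) := by
    intro z hz
    simp only [hP]
    rw [dslope_of_ne _ hz, slope_def_field, sub_zero, perronKernel]
    field_simp
  have hYne : (Y : ℂ) ≠ 0 := by exact_mod_cast hY0.ne'
  have hdP : ∀ z : ℂ, -q ≤ z.re → z.re ≤ 2 → DifferentiableAt ℂ P z := by
    intro z hz _
    refine DifferentiableAt.mul (hds.differentiableAt (hmem z hz)) ?_
    refine DifferentiableAt.div (differentiableAt_id.const_cpow (Or.inl hYne)) (by fun_prop) ?_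
    intro h0
    have := congrArg Complex.re h0
    simp at this
    linarith
  have hbP : ∀ z : ℂ, -q ≤ z.re → z.re ≤ 2 → 1 ≤ |z.im| →
      ‖P z‖ ≤ 2 * (2 * QF * Y ^ (2 : ℝ)) * (1 + z.im ^ 2) ^ (-(3 / 4) : ℝ) := by
    intro z hz hz2 hz1
    rw [hPeq z (fun h0 => by rw [h0] at hz1; simp at hz1; linarith)]
    exact norm_mul_perronKernel_le hY hz2 hz1 (hFF z hz)
  have hshift := integral_vertical_eq (by linarith : -q ≤ 2) hdP hbP
  have hiP := integrable_vertical (f := P) (a := 2) (fun z hz => hdP z (by linarith) hz.le)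
    (fun z hz => hbP z (by linarith) hz.le)
  have hk : ∀ z : ℂ, z.re = 2 →
      DifferentiableAt ℂ (fun z => (Y : ℂ) ^ z * perronKernel z) z := fun z hz =>
    differentiableAt_cpow_mul_perronKernel hY0 (fun h1 => by simp [h1] at hz) (by linarith)
  have hi0 := integrable_vertical (f := fun z => (1 : ℂ) * ((Y : ℂ) ^ z * perronKernel z)) (a := 2)
    (fun z hz => (hk z hz).const_mul 1)
    (fun z hz hz1 => norm_mul_perronKernel_le (Q := 1) hY hz.le hz1 (by simpa using hone z))
  set H : ℂ → ℂ := fun z => (A : ℂ) / (ρ + z - 1) * S.mollifier X (ρ + z) with hH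
  have hHz : ∀ z : ℂ, z.re = 2 → ‖H z‖ ≤ Q2 * (1 + z.im ^ 2) ^ (1 / 4 : ℝ) := by
    intro z hz
    have h1 := norm_pole_le hA (s := ρ) (z := z) (by linarith) him0
    simp only [hH]
    rw [norm_mul]
    refine (mul_le_mul h1 (hM z (by linarith)) (norm_nonneg _) (by positivity)).trans (le_of_eq ?_)
    simp only [hQ2]; ring
  have hne : ∀ z : ℂ, z.re = 2 → ρ + z - 1 ≠ 0 := fun z hz h1 => by
    have := congrArg Complex.re h1
    simp at this
    linarith
  have hiH := integrable_vertical (f := fun z => H z * ((Y : ℂ) ^ z * perronKernel z)) (a := 2)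
    (fun z hz => by
      refine DifferentiableAt.mul (DifferentiableAt.mul ?_ ?_) (hk z hz)
      · exact (differentiableAt_const _).div (by fun_prop) (hne z hz)
      · exact (S.differentiable_mollifier X _).comp z
          ((differentiableAt_const ρ).add differentiableAt_id))
    (fun z hz hz1 => norm_mul_perronKernel_le hY hz.le hz1 (hHz z hz))
  have hperron := S.integral_mul_perronKernel_eq_sum (c := 2) (Y := Y) two_pos hY0
    (fun k => (S.mollCoeff X k : ℂ) * (S.val k : ℂ) ^ (-ρ))
    (fun z => Z (ρ + z) * S.mollifier X (ρ + z)) (fun z hz => by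
      have h1 := h.hasSum_mollCoeff hZ X (s := ρ + z) (by simp; linarith)
      refine h1.congr_fun fun k => ?_
      rw [mul_assoc, ← Complex.cpow_add _ _ (val_ne_zero S k), neg_add]) (by
      have h1 := (h.hasSum_mollCoeff hZ X (s := ρ + 2) (by simp; linarith)).summable.norm
      refine h1.congr fun k => ?_
      rw [norm_mul, norm_mul, norm_val_cpow, norm_val_cpow, mul_assoc,
        ← Real.rpow_add (S.val_pos k)]
      congr 2
      simp
      ring)
  have hsplit : ∀ u : ℝ, Z (ρ + (((2 : ℝ) : ℂ) + (u : ℂ) * Complex.I)) *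
      S.mollifier X (ρ + (((2 : ℝ) : ℂ) + (u : ℂ) * Complex.I)) *
      ((Y : ℂ) ^ (((2 : ℝ) : ℂ) + (u : ℂ) * Complex.I) *
        perronKernel (((2 : ℝ) : ℂ) + (u : ℂ) * Complex.I)) =
      P (((2 : ℝ) : ℂ) + (u : ℂ) * Complex.I) +
      (F 0 * (1 * ((Y : ℂ) ^ (((2 : ℝ) : ℂ) + (u : ℂ) * Complex.I) *
        perronKernel (((2 : ℝ) : ℂ) + (u : ℂ) * Complex.I))) +
      H (((2 : ℝ) : ℂ) + (u : ℂ) * Complex.I) *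
      ((Y : ℂ) ^ (((2 : ℝ) : ℂ) + (u : ℂ) * Complex.I) *
        perronKernel (((2 : ℝ) : ℂ) + (u : ℂ) * Complex.I))) := by
    intro u
    rw [hPeq _ (fun h0 => by have := congrArg Complex.re h0; simp at this)]
    simp only [hF, hH, zetaRegular]
    ring
  simp only [hsplit] at hperron
  have hPI : ‖∫ u : ℝ, P (((2 : ℝ) : ℂ) + (u : ℂ) * Complex.I)‖ ≤ K1 * (2 * QF * Y ^ (-q)) := by
    rw [← hshift]
    have h1 := hI1 (fun z => F z - F 0) Y (2 * QF) hY0 (by positivity)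
      (fun z hz => hFF z hz.ge)
    refine le_of_eq_of_le ?_ h1
    congr 2
    funext u
    refine hPeq _ fun h0 => ?_
    have := congrArg Complex.re h0
    simp at this
    linarith
  have h0I : ‖∫ u : ℝ, F 0 * (1 * ((Y : ℂ) ^ (((2 : ℝ) : ℂ) + (u : ℂ) * Complex.I) *
        perronKernel (((2 : ℝ) : ℂ) + (u : ℂ) * Complex.I)))‖ ≤ 2 * Real.pi * ‖F 0‖ := by
    simp only [one_mul]
    rw [integral_const_mul, integral_cpow_perronKernel two_pos hY0, norm_mul (F 0),
      norm_mul (2 * (Real.pi : ℂ)), norm_mul (2 : ℂ), Complex.norm_real, Complex.norm_real, Real.norm_of_nonneg Real.pi_pos.le,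
      Real.norm_of_nonneg (rieszWeight_nonneg Y)]
    have h1 := rieszWeight_le_one hY0
    have h2 : ‖(2 : ℂ)‖ = 2 := by simp
    rw [h2]
    have h3 : 0 ≤ 2 * Real.pi * ‖F 0‖ := by positivity
    nlinarith
  have hHI := hI2 H Y Q2 hY0 hQ20 hHz
  have hi0H : Integrable fun u : ℝ =>
      F 0 * (1 * ((Y : ℂ) ^ (((2 : ℝ) : ℂ) + (u : ℂ) * Complex.I) *
        perronKernel (((2 : ℝ) : ℂ) + (u : ℂ) * Complex.I))) +
      H (((2 : ℝ) : ℂ) + (u : ℂ) * Complex.I) *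
      ((Y : ℂ) ^ (((2 : ℝ) : ℂ) + (u : ℂ) * Complex.I) *
        perronKernel (((2 : ℝ) : ℂ) + (u : ℂ) * Complex.I)) := (hi0.const_mul (F 0)).add hiH
  rw [integral_add hiP hi0H, integral_add (hi0.const_mul (F 0)) hiH] at hperron
  have hfin : ‖2 * (Real.pi : ℂ) * ∑ k ∈ S.upTo Y, (S.mollCoeff X k : ℂ) * (S.val k : ℂ) ^ (-ρ) *
      rieszWeight (Y / S.val k)‖ ≤
      K1 * (2 * QF * Y ^ (-q)) + (2 * Real.pi * ‖F 0‖ + K2 * (Q2 * Y ^ (2 : ℝ))) := by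
    rw [← hperron]
    exact (norm_add_le _ _).trans (add_le_add hPI ((norm_add_le _ _).trans (add_le_add h0I hHI)))
  have hpi : 1 ≤ ‖2 * (Real.pi : ℂ)‖ := by
    rw [norm_mul, Complex.norm_real, Real.norm_of_nonneg Real.pi_pos.le]
    have := Real.pi_gt_three
    simp; linarith
  rw [norm_mul] at hfin
  refine (le_mul_of_one_le_left (norm_nonneg _) hpi).trans (hfin.trans ?_)
  have hY2 : 1 ≤ Y ^ (2 : ℝ) := Real.one_le_rpow hY (by norm_num)
  have hg : 0 ≤ |ρ.im| ^ (-(1 / 2) : ℝ) := by positivity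
  have h3 : 2 * Real.pi * ‖F 0‖ ≤
      2 * Real.pi * (A * (A + C) * X * |ρ.im| ^ (-(1 / 2) : ℝ) * Y ^ (2 : ℝ)) := by
    refine mul_le_mul_of_nonneg_left (hF0'.trans ?_) (by positivity)
    exact le_mul_of_one_le_right (by positivity) hY2
  set a1 := (1 + |ρ.im|) ^ B * Y ^ (-q) with ha1
  set a2 := |ρ.im| ^ (-(1 / 2) : ℝ) * Y ^ (2 : ℝ) with ha2
  have e1 : 0 ≤ a1 := by positivity
  have e2 : 0 ≤ a2 := by positivity
  set k1 := K1 * (4 * KE * (A + C)) with hk1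
  set k2 := 2 * Real.pi * (A * (A + C)) + K2 * (2 * A * (A + C)) with hk2
  have hk10 : 0 ≤ k1 := by positivity
  have hk20 : 0 ≤ k2 := by positivity
  calc _ ≤ K1 * (2 * QF * Y ^ (-q)) +
        (2 * Real.pi * (A * (A + C) * X * |ρ.im| ^ (-(1 / 2) : ℝ) * Y ^ (2 : ℝ)) +
          K2 * (Q2 * Y ^ (2 : ℝ))) := by linarith
    _ = k1 * X * a1 + k2 * X * a2 := by
        simp only [hk1, hk2, ha1, ha2, hQF, hQ2]; ring
    _ ≤ (k1 + k2) * X * a1 + (k1 + k2) * X * a2 := by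
        gcongr <;> linarith
    _ = _ := by ring

end BeurlingSystem.Counting

namespace BeurlingSystem

variable (S : BeurlingSystem)

/-- Duality: a Dirichlet polynomial that is large at many points forces the dual sum to be
large. -/
lemma sq_card_le_of_re_sum_le {X Y : ℝ} (η : ℝ) (G : Finset ℂ)
    (hG : ∀ ρ ∈ G, (∑ k ∈ S.upTo Y with X < S.val k, (S.mollCoeff X k : ℂ) *
      (S.val k : ℂ) ^ (-ρ) * rieszWeight (Y / S.val k)).re ≤ -(1 / 2)) :
    ((G.card : ℝ) / 2) ^ 2 ≤
      (∑ k ∈ S.upTo Y with X < S.val k, S.mollCoeff X k ^ 2 * rieszWeight (Y / S.val k) *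
        S.val k ^ (-(1 + η))) *
      ∑ k ∈ S.upTo Y, rieszWeight (Y / S.val k) * S.val k ^ (1 + η) *
        ‖∑ ρ ∈ G, (S.val k : ℂ) ^ (-ρ)‖ ^ 2 := by
  set J := (S.upTo Y).filter fun k => X < S.val k with hJ
  have h1 : (G.card : ℝ) / 2 ≤ ∑ k ∈ J, |S.mollCoeff X k| * rieszWeight (Y / S.val k) *
      ‖∑ ρ ∈ G, (S.val k : ℂ) ^ (-ρ)‖ := by
    have h2 : (∑ ρ ∈ G, ∑ k ∈ J, (S.mollCoeff X k : ℂ) *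
        (S.val k : ℂ) ^ (-ρ) * rieszWeight (Y / S.val k)).re ≤ -((G.card : ℝ) / 2) := by
      rw [Complex.re_sum]
      refine (Finset.sum_le_sum hG).trans (le_of_eq ?_)
      simp
      ring
    have h3 : ∑ ρ ∈ G, ∑ k ∈ J, (S.mollCoeff X k : ℂ) *
        (S.val k : ℂ) ^ (-ρ) * rieszWeight (Y / S.val k) =
        ∑ k ∈ J, (S.mollCoeff X k : ℂ) * rieszWeight (Y / S.val k) *
          ∑ ρ ∈ G, (S.val k : ℂ) ^ (-ρ) := by
      rw [Finset.sum_comm]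
      refine Finset.sum_congr rfl fun k _ => ?_
      rw [Finset.mul_sum]
      refine Finset.sum_congr rfl fun ρ _ => by ring
    rw [h3] at h2
    have h4 := neg_le_of_abs_le (Complex.abs_re_le_norm
      (∑ k ∈ J, (S.mollCoeff X k : ℂ) * rieszWeight (Y / S.val k) *
          ∑ ρ ∈ G, (S.val k : ℂ) ^ (-ρ)))
    have h5 : (G.card : ℝ) / 2 ≤ ‖∑ k ∈ J, (S.mollCoeff X k : ℂ) *
        rieszWeight (Y / S.val k) * ∑ ρ ∈ G, (S.val k : ℂ) ^ (-ρ)‖ := by linarith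
    refine h5.trans ((norm_sum_le _ _).trans (Finset.sum_le_sum fun k _ => ?_))
    rw [norm_mul, norm_mul, Complex.norm_real, Complex.norm_real, Real.norm_eq_abs,
      Real.norm_of_nonneg (rieszWeight_nonneg _)]
  have hpos : ∀ (k : ℕ →₀ ℕ) (e : ℝ), 0 ≤ S.val k ^ e := fun k e => Real.rpow_nonneg (S.val_pos k).le e
  have h2 : ∑ k ∈ J, rieszWeight (Y / S.val k) * S.val k ^ (1 + η) *
        ‖∑ ρ ∈ G, (S.val k : ℂ) ^ (-ρ)‖ ^ 2 ≤
      ∑ k ∈ S.upTo Y, rieszWeight (Y / S.val k) * S.val k ^ (1 + η) *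
        ‖∑ ρ ∈ G, (S.val k : ℂ) ^ (-ρ)‖ ^ 2 :=
    Finset.sum_le_sum_of_subset_of_nonneg (Finset.filter_subset _ _) fun k _ _ =>
      mul_nonneg (mul_nonneg (rieszWeight_nonneg _) (hpos k _)) (sq_nonneg _)
  refine (pow_le_pow_left₀ (by positivity) h1 2).trans ?_
  refine le_trans ?_ (mul_le_mul_of_nonneg_left h2 (Finset.sum_nonneg fun k _ =>
    mul_nonneg (mul_nonneg (sq_nonneg _) (rieszWeight_nonneg _)) (hpos k _)))
  refine Finset.sum_sq_le_sum_mul_sum_of_sq_le_mul J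
    (fun k _ => mul_nonneg (mul_nonneg (sq_nonneg _) (rieszWeight_nonneg _)) (hpos k _))
    (fun k _ => mul_nonneg (mul_nonneg (rieszWeight_nonneg _) (hpos k _)) (sq_nonneg _))
    fun k _ => le_of_eq ?_
  have h3 : S.val k ^ (-(1 + η)) * S.val k ^ (1 + η) = 1 := by
    rw [← Real.rpow_add (S.val_pos k)]; simp
  calc _ = S.mollCoeff X k ^ 2 * rieszWeight (Y / S.val k) ^ 2 *
        ‖∑ ρ ∈ G, (S.val k : ℂ) ^ (-ρ)‖ ^ 2 * 1 := by
        rw [mul_pow, mul_pow, sq_abs, mul_one]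
    _ = S.mollCoeff X k ^ 2 * rieszWeight (Y / S.val k) ^ 2 *
        ‖∑ ρ ∈ G, (S.val k : ℂ) ^ (-ρ)‖ ^ 2 * (S.val k ^ (-(1 + η)) * S.val k ^ (1 + η)) := by
        rw [h3]
    _ = _ := by ring

lemma conj_val_cpow (k : ℕ →₀ ℕ) (s : ℂ) :
    (starRingEnd ℂ) ((S.val k : ℂ) ^ s) = (S.val k : ℂ) ^ (starRingEnd ℂ) s := by
  have harg : (S.val k : ℂ).arg ≠ Real.pi := by
    rw [Complex.arg_ofReal_of_nonneg (S.val_pos k).le]; exact Real.pi_pos.ne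
  rw [← Complex.conj_ofReal, ← Complex.cpow_conj _ _ harg,
    Complex.conj_ofReal]

/-- Expanding the square in the dual sum. -/
lemma sum_weight_mul_sq_norm_le (Y η : ℝ) (G : Finset ℂ) :
    ∑ k ∈ S.upTo Y, rieszWeight (Y / S.val k) * S.val k ^ (1 + η) *
        ‖∑ ρ ∈ G, (S.val k : ℂ) ^ (-ρ)‖ ^ 2 ≤
      ∑ ρ ∈ G, ∑ σ ∈ G, ‖∑ k ∈ S.upTo Y,
        (S.val k : ℂ) ^ (-(ρ + (starRingEnd ℂ) σ - (1 + η : ℝ))) *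
          rieszWeight (Y / S.val k)‖ := by
  have h1 : ((∑ k ∈ S.upTo Y, rieszWeight (Y / S.val k) * S.val k ^ (1 + η) *
        ‖∑ ρ ∈ G, (S.val k : ℂ) ^ (-ρ)‖ ^ 2 : ℝ) : ℂ) =
      ∑ ρ ∈ G, ∑ σ ∈ G, ∑ k ∈ S.upTo Y,
        (S.val k : ℂ) ^ (-(ρ + (starRingEnd ℂ) σ - (1 + η : ℝ))) *
          rieszWeight (Y / S.val k) := by
    have h2 : ∀ ρ ∈ G, ∑ σ ∈ G, ∑ k ∈ S.upTo Y,
        (S.val k : ℂ) ^ (-(ρ + (starRingEnd ℂ) σ - (1 + η : ℝ))) *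
          rieszWeight (Y / S.val k) = ∑ k ∈ S.upTo Y, ∑ σ ∈ G,
        (S.val k : ℂ) ^ (-(ρ + (starRingEnd ℂ) σ - (1 + η : ℝ))) *
          rieszWeight (Y / S.val k) := fun ρ _ => Finset.sum_comm
    rw [Finset.sum_congr rfl h2, Finset.sum_comm, Complex.ofReal_sum]
    refine Finset.sum_congr rfl fun k _ => ?_
    rw [Complex.ofReal_mul, Complex.ofReal_mul, Complex.ofReal_pow, ← Complex.mul_conj', map_sum,
      Finset.sum_mul_sum, Finset.mul_sum]
    refine Finset.sum_congr rfl fun ρ _ => ?_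
    rw [Finset.mul_sum]
    refine Finset.sum_congr rfl fun σ _ => ?_
    have hv := Counting.val_ne_zero S k
    rw [conj_val_cpow, Complex.ofReal_cpow (S.val_pos k).le, map_neg, ← Complex.cpow_add _ _ hv,
      mul_assoc, ← Complex.cpow_add _ _ hv, mul_comm]
    congr 2
    ring
  have h3 : 0 ≤ ∑ k ∈ S.upTo Y, rieszWeight (Y / S.val k) * S.val k ^ (1 + η) *
        ‖∑ ρ ∈ G, (S.val k : ℂ) ^ (-ρ)‖ ^ 2 := Finset.sum_nonneg fun k _ =>
    mul_nonneg (mul_nonneg (rieszWeight_nonneg _) (Real.rpow_nonneg (S.val_pos k).le _))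
      (sq_nonneg _)
  rw [← Real.norm_of_nonneg h3, ← Complex.norm_real, h1]
  exact (norm_sum_le _ _).trans (Finset.sum_le_sum fun ρ _ => norm_sum_le _ _)

end BeurlingSystem

namespace BeurlingSystem.Counting

variable {S : BeurlingSystem} {θ A C : ℝ} {Z : ℂ → ℂ}

lemma exists_sum_sq_mollCoeff_le (h : S.Counting θ A C) {η : ℝ} (hη : 0 < η) :
    ∃ K : ℝ, 0 ≤ K ∧ ∀ X Y : ℝ, 1 ≤ X →
      ∑ k ∈ S.upTo Y with X < S.val k, S.mollCoeff X k ^ 2 * rieszWeight (Y / S.val k) *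
        S.val k ^ (-(1 + η)) ≤ K * X ^ (-(η / 4)) := by
  obtain ⟨K, hK, hcoeff⟩ := exists_abs_mollCoeff_le S (ε := η / 4) (by positivity)
  have hsum := h.summable_val_rpow (a := 1 + η / 4) (by linarith)
  refine ⟨K ^ 2 * ∑' k, S.val k ^ (-(1 + η / 4)),
    mul_nonneg (sq_nonneg _) (tsum_nonneg fun k => Real.rpow_nonneg (S.val_pos k).le _),
    fun X Y hX => ?_⟩
  have hterm : ∀ k ∈ (S.upTo Y).filter (fun k => X < S.val k),
      S.mollCoeff X k ^ 2 * rieszWeight (Y / S.val k) * S.val k ^ (-(1 + η)) ≤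
      K ^ 2 * X ^ (-(η / 4)) * S.val k ^ (-(1 + η / 4)) := by
    intro k hk
    have hn := S.val_pos k
    have hY : 0 < Y := hn.trans_le (S.mem_upTo.mp (Finset.mem_filter.mp hk).1)
    have hXk : X < S.val k := (Finset.mem_filter.mp hk).2
    have h1 : S.mollCoeff X k ^ 2 ≤ (K * S.val k ^ (η / 4)) ^ 2 := by
      rw [← sq_abs]; exact pow_le_pow_left₀ (abs_nonneg _) (hcoeff X k) 2
    have h2 : rieszWeight (Y / S.val k) ≤ 1 := rieszWeight_le_one (div_pos hY hn)
    have h3 : S.val k ^ (-(η / 4)) ≤ X ^ (-(η / 4)) :=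
      Real.rpow_le_rpow_of_nonpos (by linarith) hXk.le (by linarith)
    have h4 : (S.val k ^ (η / 4)) ^ 2 * S.val k ^ (-(1 + η)) =
        S.val k ^ (-(η / 4)) * S.val k ^ (-(1 + η / 4)) := by
      rw [← Real.rpow_natCast, ← Real.rpow_mul hn.le, ← Real.rpow_add hn, ← Real.rpow_add hn]
      congr 1; push_cast; ring
    have hp : ∀ e : ℝ, 0 ≤ S.val k ^ e := fun e => Real.rpow_nonneg hn.le e
    calc _ ≤ (K * S.val k ^ (η / 4)) ^ 2 * 1 * S.val k ^ (-(1 + η)) := by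
          refine mul_le_mul_of_nonneg_right ?_ (hp _)
          exact mul_le_mul h1 h2 (rieszWeight_nonneg _) (sq_nonneg _)
      _ = K ^ 2 * (S.val k ^ (-(η / 4)) * S.val k ^ (-(1 + η / 4))) := by rw [← h4]; ring
      _ ≤ K ^ 2 * (X ^ (-(η / 4)) * S.val k ^ (-(1 + η / 4))) :=
          mul_le_mul_of_nonneg_left (mul_le_mul_of_nonneg_right h3 (hp _)) (sq_nonneg _)
      _ = _ := by ring
  refine (Finset.sum_le_sum hterm).trans ?_
  rw [← Finset.mul_sum, mul_right_comm]
  have hX0 : 0 ≤ X ^ (-(η / 4)) := Real.rpow_nonneg (by linarith) _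
  exact mul_le_mul_of_nonneg_right (mul_le_mul_of_nonneg_left
    (hsum.sum_le_tsum _ fun k _ => Real.rpow_nonneg (S.val_pos k).le _) (sq_nonneg _)) hX0

set_option maxHeartbeats 1000000 in
/-- A large values estimate of Halász–Montgomery type. -/
theorem exists_sq_card_le (h : S.Counting θ A C) (hZ : S.IsZeta θ A Z)
    (hlin : ∀ B > (0:ℝ), ∃ CB : ℝ, ∀ t : ℝ,
      ‖Z ((((1 + θ) / 2 : ℝ) : ℂ) + Complex.I * (t : ℂ))‖ ≤ CB * (1 + |t|) ^ B)
    {c B η : ℝ} (hc : 0 < c) (hc2 : c ≤ 2) (hB : 0 < B) (hB1 : B ≤ 1 / 2) (hη : 0 < η) :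
    ∃ K : ℝ, 0 ≤ K ∧ ∀ (X Y T D : ℝ) (G : Finset ℂ), 1 ≤ X → 1 ≤ Y → 0 ≤ T → 1 ≤ D →
      (∀ ρ ∈ G, (3 + θ) / 4 + η ≤ ρ.re ∧ |ρ.im| ≤ T) →
      (∀ x ∈ G, ∀ y ∈ G, x ≠ y → D ≤ |x.im - y.im|) →
      (∀ ρ ∈ G, (∑ k ∈ S.upTo Y with X < S.val k, (S.mollCoeff X k : ℂ) *
        (S.val k : ℂ) ^ (-ρ) * rieszWeight (Y / S.val k)).re ≤ -(1 / 2)) →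
      (G.card : ℝ) ^ 2 ≤ K * X ^ (-(η / 4)) * (G.card * Y +
        G.card ^ 2 * ((1 + 2 * T) ^ B * Y ^ c + D ^ (-(1 / 2) : ℝ) * Y ^ (2 : ℝ))) := by
  classical
  have hA := h.density_pos
  have hC := h.const_nonneg
  have hθ0 := h.theta_nonneg
  obtain ⟨K1, hK1, hcoeff⟩ := h.exists_sum_sq_mollCoeff_le hη
  obtain ⟨K2, hK2, hW⟩ := h.exists_norm_weighted_sum_le hZ hlin hc hc2 hB hB1
  refine ⟨4 * K1 * (A + C + K2), by positivity,
    fun X Y T D G hX hY hT hD hG hsep hdet => ?_⟩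
  have hY0 : 0 < Y := by linarith
  set R : ℝ := (G.card : ℝ) with hR
  have hR0 : 0 ≤ R := Nat.cast_nonneg _
  set Q : ℝ := (1 + 2 * T) ^ B * Y ^ c + D ^ (-(1 / 2) : ℝ) * Y ^ (2 : ℝ) with hQ
  have hQ0 : 0 ≤ Q := by positivity
  have hXp : 0 ≤ X ^ (-(η / 4)) := by positivity
  have hs : ∀ ρ ∈ G, ∀ σ ∈ G,
      (1 + θ) / 2 ≤ (ρ + (starRingEnd ℂ) σ - ((1 + η : ℝ) : ℂ)).re := by
    intro ρ hρ σ hσ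
    have h1 := (hG ρ hρ).1
    have h2 := (hG σ hσ).1
    simp only [Complex.sub_re, Complex.add_re, Complex.conj_re, Complex.ofReal_re]
    linarith
  have him : ∀ ρ σ : ℂ, (ρ + (starRingEnd ℂ) σ - ((1 + η : ℝ) : ℂ)).im = ρ.im - σ.im := by
    intro ρ σ
    simp only [Complex.sub_im, Complex.add_im, Complex.conj_im, Complex.ofReal_im]
    ring
  have hentry : ∀ ρ ∈ G, ∀ σ ∈ G, ‖∑ k ∈ S.upTo Y,
        (S.val k : ℂ) ^ (-(ρ + (starRingEnd ℂ) σ - (1 + η : ℝ))) *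
          rieszWeight (Y / S.val k)‖ ≤ (if ρ = σ then (A + C) * Y else 0) + K2 * Q := by
    intro ρ hρ σ hσ
    split_ifs with hρσ
    · have h1 : ‖∑ k ∈ S.upTo Y, (S.val k : ℂ) ^ (-(ρ + (starRingEnd ℂ) σ - (1 + η : ℝ))) *
          rieszWeight (Y / S.val k)‖ ≤ (A + C) * Y := by
        refine (norm_sum_le _ _).trans ?_
        have h2 : ∀ k ∈ S.upTo Y, ‖(S.val k : ℂ) ^ (-(ρ + (starRingEnd ℂ) σ - (1 + η : ℝ))) *
          (rieszWeight (Y / S.val k) : ℂ)‖ ≤ 1 := by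
          intro k _
          rw [norm_mul, norm_val_cpow, Complex.norm_real,
            Real.norm_of_nonneg (rieszWeight_nonneg _)]
          refine mul_le_one₀ ?_ (rieszWeight_nonneg _)
            (rieszWeight_le_one (div_pos hY0 (S.val_pos k)))
          refine Real.rpow_le_one_of_one_le_of_nonpos (S.one_le_val k) ?_
          have := hs ρ hρ σ hσ
          rw [Complex.neg_re]; linarith
        refine (Finset.sum_le_sum h2).trans ?_
        rw [Finset.sum_const, nsmul_eq_mul, mul_one, card_upTo]
        exact h.Nint_le hY
      have h3 : 0 ≤ K2 * Q := by positivity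
      linarith
    · rw [zero_add]
      have hd := hsep ρ hρ σ hσ hρσ
      have h0 : ρ.im - σ.im ≠ 0 := fun h0 => by rw [h0, abs_zero] at hd; linarith
      have h1 := hW _ Y hY (hs ρ hρ σ hσ) (by rw [him]; exact h0)
      refine h1.trans (mul_le_mul_of_nonneg_left ?_ hK2)
      rw [him]
      have h2 : |ρ.im - σ.im| ≤ 2 * T := by
        have := abs_sub ρ.im σ.im
        have h3 := (hG ρ hρ).2
        have h4 := (hG σ hσ).2
        linarith
      have h3 : (1 + |ρ.im - σ.im|) ^ B ≤ (1 + 2 * T) ^ B :=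
        Real.rpow_le_rpow (by positivity) (by linarith) hB.le
      have h4 : |ρ.im - σ.im| ^ (-(1 / 2) : ℝ) ≤ D ^ (-(1 / 2) : ℝ) :=
        Real.rpow_le_rpow_of_nonpos (by linarith) hd (by norm_num)
      exact add_le_add (mul_le_mul_of_nonneg_right h3 (by positivity))
        (mul_le_mul_of_nonneg_right h4 (by positivity))
  have hdual : ∑ k ∈ S.upTo Y, rieszWeight (Y / S.val k) * S.val k ^ (1 + η) *
      ‖∑ ρ ∈ G, (S.val k : ℂ) ^ (-ρ)‖ ^ 2 ≤ R * ((A + C) * Y) + R ^ 2 * (K2 * Q) := by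
    refine (S.sum_weight_mul_sq_norm_le Y η G).trans ?_
    refine (Finset.sum_le_sum fun ρ hρ => Finset.sum_le_sum fun σ hσ =>
      hentry ρ hρ σ hσ).trans (le_of_eq ?_)
    simp only [Finset.sum_add_distrib, Finset.sum_const, nsmul_eq_mul]
    rw [Finset.sum_congr rfl fun ρ hρ => by rw [Finset.sum_ite_eq, if_pos hρ]]
    simp only [Finset.sum_const, nsmul_eq_mul]
    ring
  have hmain := S.sq_card_le_of_re_sum_le η G hdet
  have hfin := hmain.trans (mul_le_mul (hcoeff X Y hX) hdual
    (Finset.sum_nonneg fun k _ => mul_nonneg (mul_nonneg (rieszWeight_nonneg _)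
      (Real.rpow_nonneg (S.val_pos k).le _)) (sq_nonneg _)) (by positivity))
  rw [div_pow] at hfin
  have h1 : R * ((A + C) * Y) + R ^ 2 * (K2 * Q) ≤ (A + C + K2) * (R * Y + R ^ 2 * Q) := by
    have e1 : 0 ≤ K2 * (R * Y) := by positivity
    have e2 : 0 ≤ (A + C) * (R ^ 2 * Q) := by positivity
    linarith
  have h2 := mul_le_mul_of_nonneg_left h1 (mul_nonneg hK1 hXp)
  calc R ^ 2 = 4 * (R ^ 2 / 2 ^ 2) := by ring
    _ ≤ 4 * (K1 * X ^ (-(η / 4)) * ((A + C + K2) * (R * Y + R ^ 2 * Q))) := by linarith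
    _ = _ := by ring

end BeurlingSystem.Counting

namespace BeurlingSystem

/-- If the full mollified sum is small, then its terms beyond the mollifier length are large. -/
lemma re_sum_tail_le (S : BeurlingSystem) {X Y : ℝ} (hX : 1 ≤ X) (hY : 4 ≤ Y) (ρ : ℂ)
    (hsum : ‖∑ k ∈ S.upTo Y, (S.mollCoeff X k : ℂ) * (S.val k : ℂ) ^ (-ρ) *
      rieszWeight (Y / S.val k)‖ ≤ 1 / 4) :
    (∑ k ∈ S.upTo Y with X < S.val k, (S.mollCoeff X k : ℂ) *
        (S.val k : ℂ) ^ (-ρ) * rieszWeight (Y / S.val k)).re ≤ -(1 / 2) := by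
  classical
  set f : (ℕ →₀ ℕ) → ℂ := fun k => (S.mollCoeff X k : ℂ) * (S.val k : ℂ) ^ (-ρ) *
      rieszWeight (Y / S.val k) with hf
  have h0 : ∑ k ∈ S.upTo Y with ¬ X < S.val k, f k = rieszWeight Y := by
    rw [Finset.sum_eq_single_of_mem 0]
    · simp only [hf]
      rw [mollCoeff_eq (by rw [val_zero]; exact hX)]
      simp
    · rw [Finset.mem_filter, S.mem_upTo, val_zero]
      exact ⟨by linarith, not_lt.mpr hX⟩
    · intro k hk hk0
      simp only [hf]
      rw [mollCoeff_eq (not_lt.mp (Finset.mem_filter.mp hk).2), if_neg hk0]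
      simp
  have hw : 3 / 4 ≤ rieszWeight Y := by
    refine le_trans ?_ (le_max_right _ _)
    have : Y⁻¹ ≤ 4⁻¹ := inv_anti₀ (by norm_num) hY
    linarith
  have h1 := Finset.sum_filter_add_sum_filter_not (S.upTo Y) (fun k => X < S.val k) f
  rw [h0] at h1
  have h2 := (Complex.re_le_norm _).trans hsum
  change (∑ k ∈ S.upTo Y, f k).re ≤ 1 / 4 at h2
  rw [← h1, Complex.add_re, Complex.ofReal_re] at h2
  change (∑ k ∈ S.upTo Y with X < S.val k, f k).re ≤ -(1 / 2)
  linarith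

end BeurlingSystem

namespace BeurlingSystem.Counting

variable {S : BeurlingSystem} {θ A C : ℝ} {Z : ℂ → ℂ}

lemma eventually_mul_rpow_neg_le (K : ℝ) {a b : ℝ} (ha : 0 < a) (hb : 0 < b) :
    ∀ᶠ T : ℝ in atTop, K * T ^ (-a) ≤ b := by
  have h1 : Tendsto (fun T : ℝ => K * T ^ (-a)) atTop (nhds (K * 0)) :=
    (tendsto_rpow_neg_atTop ha).const_mul K
  rw [mul_zero] at h1
  exact (h1.eventually_lt_const hb).mono fun T hT => hT.le

set_option maxHeartbeats 1000000 in
/-- Few well-spaced zeros lie to the right of `(3 + θ) / 4`. -/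
theorem exists_eventually_card_le (h : S.Counting θ A C) (hZ : S.IsZeta θ A Z)
    (hlin : ∀ B > (0:ℝ), ∃ CB : ℝ, ∀ t : ℝ,
      ‖Z ((((1 + θ) / 2 : ℝ) : ℂ) + Complex.I * (t : ℂ))‖ ≤ CB * (1 + |t|) ^ B)
    {y δ : ℝ} (hy : 0 < y) (hδ : 0 < δ) :
    ∃ K : ℝ, 0 ≤ K ∧ ∀ᶠ T : ℝ in atTop, ∀ G : Finset ℂ,
      (∀ ρ ∈ G, Z ρ = 0 ∧ (3 + θ) / 4 + δ ≤ ρ.re ∧ T ^ (6 * y) ≤ |ρ.im| ∧ |ρ.im| ≤ T) →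
      (∀ u ∈ G, ∀ v ∈ G, u ≠ v → T ^ (4 * y) ≤ |u.im - v.im|) →
      (G.card : ℝ) ≤ K * T ^ y := by
  have hθ0 := h.theta_nonneg
  have hθ1 := h.theta_lt
  set q : ℝ := (1 - θ) / 4 with hq
  have hq0 : 0 < q := by simp only [hq]; linarith
  have hq1 : q ≤ 1 / 4 := by simp only [hq]; linarith
  set x : ℝ := q * y / 3 with hx
  have hx0 : 0 < x := by positivity
  have hxy : x ≤ y / 12 := by
    have := mul_le_mul_of_nonneg_right hq1 hy.le
    simp only [hx]; linarith
  set B : ℝ := min (min x (x * δ / 16)) (1 / 2) with hB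
  have hB0 : 0 < B := by simp only [hB]; positivity
  have hB1 : B ≤ 1 / 2 := min_le_right _ _
  have hBx : B ≤ x := (min_le_left _ _).trans (min_le_left _ _)
  have hBδ : B ≤ x * δ / 16 := (min_le_left _ _).trans (min_le_right _ _)
  set c : ℝ := min (x * δ / (16 * y)) 2 with hc
  have hc0 : 0 < c := by simp only [hc]; positivity
  have hc2 : c ≤ 2 := min_le_right _ _
  have hyc : y * c ≤ x * δ / 16 := by
    refine (mul_le_mul_of_nonneg_left (min_le_left _ _) hy.le).trans (le_of_eq ?_)
    field_simp
  obtain ⟨K1, hK1, hdet⟩ := h.exists_norm_mollified_sum_le hZ hlin hB0 hB1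
  obtain ⟨K2, hK2, hlarge⟩ := h.exists_sq_card_le hZ hlin hc0 hc2 hB0 hB1 hδ
  refine ⟨2 * K2, by positivity, ?_⟩
  filter_upwards [eventually_ge_atTop 1,
    eventually_mul_rpow_neg_le (3 * K1) hx0 (b := 1 / 4) (by norm_num),
    eventually_mul_rpow_neg_le (4 * K2) (a := x * δ / 8) (b := 1 / 2) (by positivity)
      (by norm_num), (tendsto_rpow_atTop hy).eventually_ge_atTop 4] with T hT e1 e2 e3 G hG hsep
  have hT0 : 0 < T := by linarith
  have hmono : ∀ {a b : ℝ}, a ≤ b → T ^ a ≤ T ^ b := fun hab =>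
    Real.rpow_le_rpow_of_exponent_le hT hab
  have hpow : ∀ a b : ℝ, (T ^ a) ^ b = T ^ (a * b) := fun a b => (Real.rpow_mul hT0.le a b).symm
  have hX1 : 1 ≤ T ^ x := Real.one_le_rpow hT hx0.le
  have hY1 : 1 ≤ T ^ y := Real.one_le_rpow hT hy.le
  have hD1 : 1 ≤ T ^ (4 * y) := Real.one_le_rpow hT (by positivity)
  have hbase : ∀ {u m : ℝ}, 0 ≤ u → 1 ≤ m → u ≤ m * T → u ^ B ≤ m * T ^ B := by
    intro u m hu hm hum
    refine (Real.rpow_le_rpow hu hum hB0.le).trans ?_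
    rw [Real.mul_rpow (by linarith) hT0.le]
    refine mul_le_mul_of_nonneg_right ?_ (by positivity)
    calc m ^ B ≤ m ^ (1 : ℝ) := Real.rpow_le_rpow_of_exponent_le hm (by linarith)
      _ = m := Real.rpow_one m
  have htail : ∀ ρ ∈ G, (∑ k ∈ S.upTo (T ^ y) with T ^ x < S.val k, (S.mollCoeff (T ^ x) k : ℂ) *
        (S.val k : ℂ) ^ (-ρ) * rieszWeight (T ^ y / S.val k)).re ≤ -(1 / 2) := by
    intro ρ hρ
    obtain ⟨hρ0, hρre, hρlow, hρT⟩ := hG ρ hρ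
    have hlow1 : 1 ≤ |ρ.im| := (Real.one_le_rpow hT (by positivity)).trans hρlow
    refine S.re_sum_tail_le hX1 e3 ρ ((hdet ρ _ _ hX1 hY1 hρ0 (by linarith) hlow1).trans ?_)
    have a1 : (1 + |ρ.im|) ^ B ≤ 2 * T ^ B := hbase (by positivity) (by norm_num) (by linarith)
    have a2 : |ρ.im| ^ (-(1 / 2) : ℝ) ≤ T ^ (-(3 * y)) := by
      refine (Real.rpow_le_rpow_of_nonpos (by positivity) hρlow (by norm_num)).trans
        (le_of_eq ?_)
      rw [hpow]; congr 1; ring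
    have a3 : (1 + |ρ.im|) ^ B * (T ^ y) ^ (-q) ≤ 2 * T ^ (-(2 * x)) := by
      calc _ ≤ 2 * T ^ B * (T ^ y) ^ (-q) := mul_le_mul_of_nonneg_right a1 (by positivity)
        _ = 2 * T ^ (B + y * -q) := by rw [hpow, mul_assoc, ← Real.rpow_add hT0]
        _ ≤ _ := by
          refine mul_le_mul_of_nonneg_left (hmono ?_) zero_le_two
          simp only [hx] at hBx ⊢; linarith
    have a4 : |ρ.im| ^ (-(1 / 2) : ℝ) * (T ^ y) ^ (2 : ℝ) ≤ T ^ (-(2 * x)) := by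
      calc _ ≤ T ^ (-(3 * y)) * (T ^ y) ^ (2 : ℝ) := mul_le_mul_of_nonneg_right a2 (by positivity)
        _ = T ^ (-(3 * y) + y * 2) := by rw [hpow, ← Real.rpow_add hT0]
        _ ≤ _ := hmono (by linarith)
    calc _ ≤ K1 * T ^ x * (2 * T ^ (-(2 * x)) + T ^ (-(2 * x))) :=
          mul_le_mul_of_nonneg_left (add_le_add a3 a4) (by positivity)
      _ = 3 * K1 * (T ^ x * T ^ (-(2 * x))) := by ring
      _ = 3 * K1 * T ^ (-x) := by rw [← Real.rpow_add hT0]; congr 2; ring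
      _ ≤ _ := e1
  have hmain := hlarge (T ^ x) (T ^ y) T (T ^ (4 * y)) G hX1 hY1 hT0.le hD1
    (fun ρ hρ => ⟨(hG ρ hρ).2.1, (hG ρ hρ).2.2.2⟩) hsep htail
  set R : ℝ := (G.card : ℝ) with hR
  have hR0 : 0 ≤ R := Nat.cast_nonneg _
  have b1 : (T ^ (4 * y)) ^ (-(1 / 2) : ℝ) * (T ^ y) ^ (2 : ℝ) = 1 := by
    rw [hpow, hpow, ← Real.rpow_add hT0]
    ring_nf
    exact Real.rpow_zero T
  have b2 : (1 + 2 * T) ^ B * (T ^ y) ^ c ≤ 3 * T ^ (x * δ / 8) := by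
    calc _ ≤ 3 * T ^ B * (T ^ y) ^ c := mul_le_mul_of_nonneg_right
          (hbase (by positivity) (by norm_num) (by linarith)) (by positivity)
      _ = 3 * T ^ (B + y * c) := by rw [hpow, mul_assoc, ← Real.rpow_add hT0]
      _ ≤ _ := mul_le_mul_of_nonneg_left (hmono (by linarith)) (by norm_num)
  have b3 : 1 ≤ T ^ (x * δ / 8) := Real.one_le_rpow hT (by positivity)
  have b4 : (T ^ x) ^ (-(δ / 4)) ≤ 1 :=
    Real.rpow_le_one_of_one_le_of_nonpos hX1 (by linarith)
  have b5 : K2 * (T ^ x) ^ (-(δ / 4)) * ((1 + 2 * T) ^ B * (T ^ y) ^ c +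
      (T ^ (4 * y)) ^ (-(1 / 2) : ℝ) * (T ^ y) ^ (2 : ℝ)) ≤ 1 / 2 := by
    calc _ ≤ K2 * (T ^ x) ^ (-(δ / 4)) * (4 * T ^ (x * δ / 8)) := by
          refine mul_le_mul_of_nonneg_left ?_ (by positivity)
          rw [b1]; linarith
      _ = 4 * K2 * (T ^ (x * -(δ / 4)) * T ^ (x * δ / 8)) := by rw [hpow]; ring
      _ = 4 * K2 * T ^ (-(x * δ / 8)) := by rw [← Real.rpow_add hT0]; congr 2; ring
      _ ≤ _ := e2
  have b6 : K2 * (T ^ x) ^ (-(δ / 4)) * (R * T ^ y) ≤ K2 * (R * T ^ y) := by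
    refine mul_le_mul_of_nonneg_right ?_ (by positivity)
    exact mul_le_of_le_one_right hK2 b4
  have b7 := mul_le_mul_of_nonneg_left b5 (sq_nonneg R)
  have b8 : R * R ≤ R * (2 * K2 * T ^ y) := by
    rw [mul_add] at hmain
    linarith
  rcases hR0.eq_or_lt with h0 | h0
  · rw [← h0]; positivity
  · exact le_of_mul_le_mul_left b8 h0

set_option maxHeartbeats 1000000 in
theorem zeroCount_le_beyond (h : S.Counting θ A C) (hZ : S.IsZeta θ A Z)
    (hlin : ∀ B > (0:ℝ), ∃ CB : ℝ, ∀ t : ℝ,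
      ‖Z ((((1 + θ) / 2 : ℝ) : ℂ) + Complex.I * (t : ℂ))‖ ≤ CB * (1 + |t|) ^ B)
    {ε δ : ℝ} (hε : 0 < ε) (hδ : 0 < δ) :
    ∃ K : ℝ, ∀ T : ℝ, 2 ≤ T → (zeroCount Z ((3 + θ) / 4 + δ) T : ℝ) ≤ K * T ^ ε := by
  classical
  have hθ0 := h.theta_nonneg
  have hθ1 := h.theta_lt
  set y : ℝ := ε / 12 with hy
  have hy0 : 0 < y := by positivity
  set e : ℝ := 7 * y / (1 + 4 * y) with he
  have he0 : 0 < e := by positivity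
  obtain ⟨L, hL, hsep⟩ := h.exists_separated_zeros hZ
  obtain ⟨K0, hK0, hcard⟩ := h.exists_card_le_mul
  obtain ⟨K1, hK1, hhigh⟩ := h.exists_eventually_card_le hZ hlin hy0 hδ
  obtain ⟨T0, hT0⟩ := eventually_atTop.mp
    (hhigh.and ((tendsto_rpow_atTop (y := 6 * y) (by positivity)).eventually_ge_atTop 2))
  have hcrude : ∀ (T : ℝ) (F : Finset ℂ), 2 ≤ T → (∀ ρ ∈ F, Z ρ = 0 ∧ ρ ≠ 1 ∧
      (3 + θ) / 4 + δ ≤ ρ.re ∧ |ρ.im| ≤ T) → (F.card : ℝ) ≤ 4 * K0 * L * T ^ (2 : ℝ) := by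
    intro T F hT hF
    obtain ⟨G, hGF, hGsep, hGcard⟩ := hsep T 1 F (by linarith) le_rfl fun ρ hρ =>
      ⟨(hF ρ hρ).1, (hF ρ hρ).2.1, by linarith [(hF ρ hρ).2.2.1], (hF ρ hρ).2.2.2⟩
    have h1 := hcard T G hT (fun ρ hρ => (hF ρ (hGF hρ)).2.2.2) hGsep
    have h2 : Real.log (4 + T + 1) ≤ 4 * T :=
      (Real.log_le_sub_one_of_pos (by linarith)).trans (by linarith)
    have h3 : 0 ≤ Real.log (4 + T + 1) := Real.log_nonneg (by linarith)
    calc _ ≤ (G.card : ℝ) * (1 * (L * Real.log (4 + T + 1))) := hGcard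
      _ ≤ K0 * T * (1 * (L * (4 * T))) := by gcongr
      _ = _ := by rw [Real.rpow_two]; ring
  set M : ℝ := max T0 2 with hM
  have hM2 : 2 ≤ M := le_max_right _ _
  refine ⟨4 * K0 * L * M ^ (2 : ℝ) + (4 * K0 * L + K1 * (L * (6 ^ e / e))) + 1,
    fun T hT => ?_⟩
  have hTp : 0 < T := by linarith
  have hT1 : 1 ≤ T := by linarith
  have hTε : 1 ≤ T ^ ε := Real.one_le_rpow hT1 hε.le
  have hc1 : 0 ≤ 4 * K0 * L * M ^ (2 : ℝ) := by positivity
  have hc2 : 0 ≤ 4 * K0 * L + K1 * (L * (6 ^ e / e)) := by positivity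
  refine (zeroCount_le_of_forall_finset (B := (4 * K0 * L * M ^ (2 : ℝ) +
    (4 * K0 * L + K1 * (L * (6 ^ e / e)))) * T ^ ε) fun F hF => ?_).trans
    (by linarith)
  rcases le_or_gt T M with hTM | hTM
  · have h1 := hcrude M F hM2 fun ρ hρ =>
      ⟨(hF ρ hρ).1, (hF ρ hρ).2.1, (hF ρ hρ).2.2.1, (hF ρ hρ).2.2.2.trans hTM⟩
    refine h1.trans ((le_add_of_nonneg_right hc2).trans ?_)
    exact le_mul_of_one_le_right (by positivity) hTε
  obtain ⟨hhighT, hlowT⟩ := hT0 T ((le_max_left _ _).trans hTM.le)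
  have h1 : ((F.filter fun ρ => |ρ.im| ≤ T ^ (6 * y)).card : ℝ) ≤ 4 * K0 * L * T ^ ε := by
    refine (hcrude (T ^ (6 * y)) _ hlowT fun ρ hρ => ?_).trans (le_of_eq ?_)
    · obtain ⟨hρF, hρ⟩ := Finset.mem_filter.mp hρ
      exact ⟨(hF ρ hρF).1, (hF ρ hρF).2.1, (hF ρ hρF).2.2.1, hρ⟩
    · rw [← Real.rpow_mul hTp.le]
      congr 2
      simp only [hy]; ring
  have h2 : ((F.filter fun ρ => ¬ |ρ.im| ≤ T ^ (6 * y)).card : ℝ) ≤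
      K1 * (L * (6 ^ e / e)) * T ^ ε := by
    have hD1 : 1 ≤ T ^ (4 * y) := Real.one_le_rpow hT1 (by positivity)
    obtain ⟨G, hGF, hGsep, hGcard⟩ := hsep T (T ^ (4 * y))
      (F.filter fun ρ => ¬ |ρ.im| ≤ T ^ (6 * y)) hTp.le hD1 fun ρ hρ => by
        have h3 := hF ρ (Finset.mem_filter.mp hρ).1
        exact ⟨h3.1, h3.2.1, by linarith [h3.2.2.1], h3.2.2.2⟩
    have h3 := hhighT G (fun ρ hρ => by
      obtain ⟨hρF, hρ⟩ := Finset.mem_filter.mp (hGF hρ)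
      exact ⟨(hF ρ hρF).1, (hF ρ hρF).2.2.1, (not_le.mp hρ).le, (hF ρ hρF).2.2.2⟩) hGsep
    have h4 : Real.log (4 + T + T ^ (4 * y)) ≤ 6 ^ e / e * T ^ (7 * y) := by
      have h5 : 4 + T + T ^ (4 * y) ≤ 6 * T ^ (1 + 4 * y) := by
        rw [Real.rpow_add hTp, Real.rpow_one]
        nlinarith
      have h6 : (1 + 4 * y) * e = 7 * y := by simp only [he]; field_simp
      refine (Real.log_le_log (by positivity) h5).trans
        ((Real.log_le_rpow_div (by positivity) he0).trans (le_of_eq ?_))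
      rw [Real.mul_rpow (by norm_num) (by positivity), ← Real.rpow_mul hTp.le, h6]
      ring
    have h5 : 0 ≤ Real.log (4 + T + T ^ (4 * y)) := Real.log_nonneg (by linarith)
    calc _ ≤ (G.card : ℝ) * (T ^ (4 * y) * (L * Real.log (4 + T + T ^ (4 * y)))) := hGcard
      _ ≤ K1 * T ^ y * (T ^ (4 * y) * (L * (6 ^ e / e * T ^ (7 * y)))) := by gcongr
      _ = K1 * (L * (6 ^ e / e)) * (T ^ y * T ^ (4 * y) * T ^ (7 * y)) := by ring
      _ = _ := by
        rw [← Real.rpow_add hTp, ← Real.rpow_add hTp]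
        congr 2
        simp only [hy]; ring
  rw [← Finset.card_filter_add_card_filter_not (s := F) (fun ρ => |ρ.im| ≤ T ^ (6 * y))]
  push_cast
  have h3 : 0 ≤ 4 * K0 * L * M ^ (2 : ℝ) * T ^ ε := by positivity
  linarith

end BeurlingSystem.Counting

/-- Corollary 5.3: under a Lindelöf-type hypothesis on the line `Re s = (1+θ)/2`,
the density hypothesis `N(α, T) ≪_ε T^{2(1-α)/(1-θ)+ε}` holds, and
`N((3+θ)/4 + δ, T) ≪_{ε,δ} T^ε`. -/
theorem zero_density_lindelof
    (θ : ℝ) (hθ0 : 0 ≤ θ) (hθ1 : θ < 1) (S : BeurlingSystem)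
    (A : ℝ) (hA : 0 < A)
    (hwb : (fun x : ℝ => (S.Nint x : ℝ) - A * x) =O[atTop] fun x : ℝ => x ^ θ)
    (Z : ℂ → ℂ) (hZ : S.IsZeta θ A Z)
    (hlin : ∀ B > (0:ℝ), ∃ CB : ℝ, ∀ t : ℝ,
      ‖Z ((((1 + θ) / 2 : ℝ) : ℂ) + Complex.I * (t : ℂ))‖ ≤ CB * (1 + |t|) ^ B) :
    (∀ ε > (0:ℝ), ∃ C : ℝ, ∀ α T : ℝ, (1 + θ) / 2 ≤ α → 2 ≤ T →
      (zeroCount Z α T : ℝ) ≤ C * T ^ (2 * (1 - α) / (1 - θ) + ε)) ∧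
    (∀ ε > (0:ℝ), ∀ δ > (0:ℝ), ∃ C : ℝ, ∀ T : ℝ, 2 ≤ T →
      (zeroCount Z ((3 + θ) / 4 + δ) T : ℝ) ≤ C * T ^ ε) := by
  obtain ⟨C, hC, hbound⟩ := S.exists_counting_bound hθ0 hwb
  have h : S.Counting θ A C := ⟨hθ0, hθ1, hA, hC, hbound⟩
  exact ⟨fun ε hε => h.zeroCount_le_density hZ hlin hε,
    fun ε hε δ hδ => h.zeroCount_le_beyond hZ hlin hε hδ⟩
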